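/- Let F be an algebraically closed field, let X ≤ A_n be a subgroup acting transitively on Ω = {1,…,n} with X isomorphic to A_m, where n > m and 5 ≤ m ≤ 10. Suppose V is an F A_n-module with dim_F V > 1 such that the restriction of V to X is an irreducible F X-module. Then (m, n) ∈ {(5,6), (6,10), (7,15), (8,15)}. -/

import Mathlib

/-- A submodule is invariant under a representation. -/
def RepInvariant {F G V : Type*} [Field F] [Monoid G] [AddCommGroup V] [Module F V]
    (ρ : Representation F G V) (p : Submodule F V) : Prop :=
  ∀ g : G, ∀ v ∈ p, ρ g v ∈ p

/-- A representation is irreducible if the space is nonzero and the only invariant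
submodules are `⊥` and `⊤`. -/
def RepIrreducible {F G V : Type*} [Field F] [Monoid G] [AddCommGroup V] [Module F V]
    (ρ : Representation F G V) : Prop :=
  Nontrivial V ∧ ∀ p : Submodule F V, RepInvariant ρ p → p = ⊥ ∨ p = ⊤

namespace AltRestriction

section General

variable {F G V : Type*} [Field F] [Group G] [AddCommGroup V] [Module F V]

/-- The linear map sending a coefficient function `a` to `∑ g, a g • ρ g v`. -/
def orbitMap [Fintype G] (ρ : Representation F G V) (v : V) : (G → F) →ₗ[F] V :=
  Fintype.linearCombination F (fun g => ρ g v)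

lemma orbitMap_apply [Fintype G] (ρ : Representation F G V) (v : V) (a : G → F) :
    orbitMap ρ v a = ∑ g, a g • ρ g v := rfl

lemma orbitMap_translate [Fintype G] (ρ : Representation F G V) (v : V) (a : G → F) (h : G) :
    orbitMap ρ v (fun g => a (h⁻¹ * g)) = ρ h (orbitMap ρ v a) := by
  simp only [orbitMap_apply, map_sum, map_smul]
  rw [← Equiv.sum_comp (Equiv.mulLeft h)]
  simp

lemma exists_factor {U W : Type*} [AddCommGroup U] [Module F U] [AddCommGroup W] [Module F W]
    (S : U →ₗ[F] V) (hS : Function.Surjective S) (T : U →ₗ[F] W)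
    (h : ∀ u, S u = 0 → T u = 0) : ∃ f : V →ₗ[F] W, ∀ u, f (S u) = T u := by
  obtain ⟨s, hs⟩ := LinearMap.exists_rightInverse_of_surjective S (LinearMap.range_eq_top.2 hS)
  refine ⟨T ∘ₗ s, fun u => ?_⟩
  have h1 : S (s (S u) - u) = 0 := by
    rw [map_sub, sub_eq_zero]; exact LinearMap.congr_fun hs (S u)
  have := h _ h1
  rwa [map_sub, sub_eq_zero] at this

lemma _root_.RepIrreducible.span_orbit {ρ : Representation F G V} (hρ : RepIrreducible ρ) {v : V}
    (hv : v ≠ 0) : Submodule.span F (Set.range fun g => ρ g v) = ⊤ := by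
  refine (hρ.2 _ ?_).resolve_left ?_
  · intro g w hw
    have : Submodule.span F (Set.range fun g => ρ g v) ≤
        (Submodule.span F (Set.range fun g => ρ g v)).comap (ρ g) := by
      rw [Submodule.span_le]
      rintro _ ⟨h, rfl⟩
      refine Submodule.subset_span ⟨g * h, ?_⟩
      simp
    exact this hw
  · intro h
    rw [Submodule.span_eq_bot] at h
    exact hv (by simpa using h _ ⟨1, rfl⟩)

lemma _root_.RepIrreducible.finiteDimensional [Finite G] {ρ : Representation F G V}
    (hρ : RepIrreducible ρ) : FiniteDimensional F V := by
  obtain ⟨v, hv⟩ := @exists_ne _ hρ.1 (0 : V)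
  exact ⟨(Submodule.fg_def.2 ⟨_, Set.finite_range _, RepIrreducible.span_orbit hρ hv⟩)⟩

lemma _root_.RepIrreducible.schur [IsAlgClosed F] [FiniteDimensional F V] {ρ : Representation F G V}
    (hρ : RepIrreducible ρ) (f : V →ₗ[F] V) (hf : ∀ g v, f (ρ g v) = ρ g (f v)) :
    ∃ c : F, ∀ v, f v = c • v := by
  have := hρ.1
  obtain ⟨c, hc⟩ := Module.End.exists_eigenvalue f
  refine ⟨c, fun v => ?_⟩
  have : Module.End.eigenspace f c = ⊤ := by
    refine (hρ.2 _ ?_).resolve_left hc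
    intro g v hv
    rw [Module.End.mem_eigenspace_iff] at hv ⊢
    rw [hf, hv, map_smul]
  exact Module.End.mem_eigenspace_iff.1 (this ▸ Submodule.mem_top)

lemma _root_.RepIrreducible.density [IsAlgClosed F] [Fintype G] {ρ : Representation F G V}
    (hρ : RepIrreducible ρ) (r : ℕ) (v : Fin r → V) (hv : LinearIndependent F v) :
    Function.Surjective (LinearMap.pi (fun i => orbitMap ρ (v i))) := by
  classical
  have := hρ.finiteDimensional
  induction r with
  | zero => exact fun b => ⟨0, Subsingleton.elim _ _⟩
  | succ r ih =>
    set S := LinearMap.pi (fun i : Fin r => orbitMap ρ (v i.castSucc)) with hSdef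
    have hS : Function.Surjective S :=
      ih _ (hv.comp _ (Fin.castSucc_injective r))
    have hSt : ∀ (a : G → F) (h : G), S (fun g => a (h⁻¹ * g)) = fun i => ρ h (S a i) := by
      intro a h; funext i; exact orbitMap_translate ρ _ a h
    let N := LinearMap.ker S
    rcases hρ.2 (N.map (orbitMap ρ (v (Fin.last r)))) (by
      rintro h _ ⟨a, ha, rfl⟩
      refine ⟨fun g => a (h⁻¹ * g), ?_, orbitMap_translate ρ _ a h⟩
      have ha' : S a = 0 := ha
      change S _ = 0
      rw [hSt, ha']; funext i; simp) with hb | ht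
    · exfalso
      obtain ⟨f, hf⟩ := exists_factor S hS (orbitMap ρ (v (Fin.last r))) (by
        intro a ha
        have : orbitMap ρ (v (Fin.last r)) a ∈ N.map (orbitMap ρ (v (Fin.last r))) :=
          ⟨a, ha, rfl⟩
        rw [hb] at this
        simpa using this)
      have hfe : ∀ (h : G) (b : Fin r → V), f (fun i => ρ h (b i)) = ρ h (f b) := by
        intro h b
        obtain ⟨a, rfl⟩ := hS b
        rw [← hSt, hf, hf, orbitMap_translate]
      have hc : ∀ i : Fin r, ∃ c : F, ∀ w, f (Pi.single i w) = c • w := by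
        intro i
        refine hρ.schur (f ∘ₗ LinearMap.single F (fun _ => V) i) ?_
        intro g w
        simp only [LinearMap.comp_apply, LinearMap.coe_single]
        rw [← hfe]
        congr 1
        funext j
        by_cases hj : j = i
        · subst hj; simp
        · simp [hj]
      choose c hc using hc
      have hfa : ∀ b : Fin r → V, f b = ∑ i, c i • b i := by
        intro b
        conv_lhs => rw [← Finset.univ_sum_single b]
        rw [map_sum]
        exact Finset.sum_congr rfl fun i _ => hc i _
      have h1 : ∀ w : V, orbitMap ρ w (Pi.single (1 : G) (1 : F)) = w := by
        intro w
        rw [orbitMap_apply, Finset.sum_eq_single 1]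
        · simp
        · intro g _ hg; simp [hg]
        · simp
      have h2 := hf (Pi.single (1 : G) (1 : F))
      rw [h1, hfa] at h2
      have h3 : ∀ i, S (Pi.single (1 : G) (1 : F)) i = v i.castSucc := fun i => h1 _
      simp only [h3] at h2
      have h4 := (linearIndependent_finSucc'.1 hv).2
      apply h4
      rw [← h2]
      exact Submodule.sum_mem _ fun i _ => Submodule.smul_mem _ _
        (Submodule.subset_span ⟨i, rfl⟩)
    · intro b
      obtain ⟨a, ha⟩ := hS (fun i => b i.castSucc)
      have : b (Fin.last r) - orbitMap ρ (v (Fin.last r)) a ∈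
          N.map (orbitMap ρ (v (Fin.last r))) := ht ▸ Submodule.mem_top
      obtain ⟨a', ha', h'⟩ := this
      have ha'' : S a' = 0 := ha'
      refine ⟨a + a', ?_⟩
      funext i
      refine Fin.lastCases ?_ (fun j => ?_) i
      · simp only [LinearMap.pi_apply, map_add, h']; abel
      · have e1 := congrFun ha j
        have e2 := congrFun ha'' j
        simp only [hSdef, LinearMap.pi_apply, Pi.zero_apply] at e1 e2
        simp only [LinearMap.pi_apply, map_add, e1, e2, add_zero]

theorem _root_.RepIrreducible.finrank_sq_le [IsAlgClosed F] [Finite G] {ρ : Representation F G V}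
    (hρ : RepIrreducible ρ) : Module.finrank F V ^ 2 ≤ Nat.card G := by
  have := hρ.finiteDimensional
  have := Fintype.ofFinite G
  have h := hρ.density _ _ (Module.finBasis F V).linearIndependent
  have := LinearMap.finrank_le_finrank_of_surjective h
  rw [Module.finrank_pi_fintype, Module.finrank_fintype_fun_eq_card] at this
  simpa [sq, Nat.card_eq_fintype_card] using this

/-- If a nonzero line is stable under a subgroup, the dimension is at most its index. -/
theorem _root_.RepIrreducible.finrank_le_index [Finite G] {ρ : Representation F G V}
    (hρ : RepIrreducible ρ) (H : Subgroup G) {v : V} (hv : v ≠ 0)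
    (hH : ∀ h ∈ H, ∃ c : F, ρ h v = c • v) : Module.finrank F V ≤ H.index := by
  classical
  have := Fintype.ofFinite G
  have := Fintype.ofFinite (G ⧸ H)
  have : Submodule.span F (Set.range fun q : G ⧸ H => ρ q.out v) = ⊤ := by
    rw [eq_top_iff, ← RepIrreducible.span_orbit hρ hv, Submodule.span_le]
    rintro _ ⟨g, rfl⟩
    obtain ⟨h, hh⟩ := QuotientGroup.mk_out_eq_mul H g
    obtain ⟨c, hc⟩ := hH (h : G)⁻¹ (H.inv_mem h.2)
    have : ρ g v = c • ρ (QuotientGroup.mk g : G ⧸ H).out v := by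
      rw [hh, ← map_smul, ← hc, ← Module.End.mul_apply, ← map_mul]; simp
    simp only [this]
    exact Submodule.smul_mem _ _ (Submodule.subset_span ⟨_, rfl⟩)
  have h2 := finrank_range_le_card (R := F) (fun q : G ⧸ H => ρ q.out v)
  rw [Set.finrank, this, finrank_top] at h2
  rwa [Subgroup.index, Nat.card_eq_fintype_card]

end General

end AltRestriction

namespace AltRestriction

set_option linter.unusedSectionVars false
open Equiv

section CommonEigenvector

variable {F V ι : Type*} [Field F] [IsAlgClosed F] [AddCommGroup V] [Module F V]
  [FiniteDimensional F V]

lemma exists_common_eigenvector (T : ι → Module.End F V)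
    (hT : ∀ i j, Commute (T i) (T j)) (d : ℕ) (U : Submodule F V) (hd : Module.finrank F U ≤ d)
    (hU : U ≠ ⊥) (hTU : ∀ i, ∀ u ∈ U, T i u ∈ U) :
    ∃ u ∈ U, u ≠ 0 ∧ ∃ χ : ι → F, ∀ i, T i u = χ i • u := by
  induction d generalizing U with
  | zero => exact absurd (Submodule.finrank_eq_zero.1 (Nat.le_zero.1 hd)) hU
  | succ d ih =>
    have : Nontrivial U := Submodule.nontrivial_iff_ne_bot.2 hU
    by_cases hs : ∀ i, ∃ c : F, ∀ u ∈ U, T i u = c • u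
    · choose χ hχ using hs
      obtain ⟨u, hu, hu0⟩ := Submodule.exists_mem_ne_zero_of_ne_bot hU
      exact ⟨u, hu, hu0, χ, fun i => hχ i u hu⟩
    · push Not at hs
      obtain ⟨i, hi⟩ := hs
      obtain ⟨c, hc⟩ := Module.End.exists_eigenvalue ((T i).restrict (hTU i))
      obtain ⟨x, hx⟩ := hc.exists_hasEigenvector
      have hx1 : T i x = c • (x : V) := congrArg Subtype.val hx.apply_eq_smul
      have hx0 : (x : V) ≠ 0 := fun h => hx.2 (Subtype.ext h)
      obtain ⟨y, hyU, hy⟩ := hi c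
      have hlt : U ⊓ Module.End.eigenspace (T i) c < U := by
        refine lt_of_le_of_ne inf_le_left fun h => hy ?_
        rw [← h] at hyU
        exact Module.End.mem_eigenspace_iff.1 hyU.2
      obtain ⟨u, hu, h⟩ := ih (U ⊓ Module.End.eigenspace (T i) c)
        (Nat.lt_succ_iff.1 ((Submodule.finrank_lt_finrank_of_lt hlt).trans_le hd))
        (fun h => hx0 (by
          have : (x : V) ∈ U ⊓ Module.End.eigenspace (T i) c :=
            ⟨x.2, Module.End.mem_eigenspace_iff.2 hx1⟩
          rw [h] at this
          exact this))
        (fun j u hu => ⟨hTU j u hu.1, by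
          have h1 := Module.End.mem_eigenspace_iff.1 hu.2
          refine Module.End.mem_eigenspace_iff.2 ?_
          rw [← Module.End.mul_apply, (hT i j).eq, Module.End.mul_apply, h1, map_smul]⟩)
      exact ⟨u, hu.1, h⟩

lemma card_weights_le (T : ι → Module.End F V) (hT : ∀ i j, Commute (T i) (T j))
    {α : Type*} [Fintype α] (S : Finset α) (χ : α → ι → F) (hχ : Function.Injective χ)
    (h : ∀ a ∈ S, ∃ v : V, v ≠ 0 ∧ ∀ i, T i v = χ a i • v) :
    S.card ≤ Module.finrank F V := by
  classical
  have hind := (Module.End.independent_iInf_maxGenEigenspace_of_forall_mapsTo T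
    (fun i j φ => Module.End.mapsTo_maxGenEigenspace_of_comm (hT j i) φ)).comp hχ
  refine le_trans ?_ hind.subtype_ne_bot_le_finrank
  rw [Fintype.card_subtype]
  refine Finset.card_le_card fun a ha => Finset.mem_filter.2 ⟨Finset.mem_univ _, fun h0 => ?_⟩
  obtain ⟨v, hv0, hv⟩ := h a ha
  apply hv0
  rw [← Submodule.mem_bot F, ← h0]
  simp only [Function.comp_apply, Submodule.mem_iInf]
  intro i
  rw [Module.End.mem_maxGenEigenspace]
  exact ⟨1, by simp [hv i]⟩

end CommonEigenvector

lemma card_support_eq {ι E : Type*} [Fintype ι] [DecidableEq ι] [Fintype E] [DecidableEq E]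
    [One E] (s : ℕ) :
    (Finset.univ.filter fun a : ι → E => (Finset.univ.filter fun i => a i ≠ 1).card = s).card =
      (Fintype.card E - 1) ^ s * (Fintype.card ι).choose s := by
  have h : (Finset.univ.filter fun a : ι → E =>
      (Finset.univ.filter fun i => a i ≠ 1).card = s) =
      (Finset.powersetCard s (Finset.univ : Finset ι)).biUnion fun S =>
        Fintype.piFinset fun i => if i ∈ S then Finset.univ.erase (1 : E) else {1} := by
    ext a
    simp only [Finset.mem_filter, Finset.mem_univ, true_and, Finset.mem_biUnion,
      Finset.mem_powersetCard, Finset.subset_univ, Fintype.mem_piFinset]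
    constructor
    · intro h
      refine ⟨_, h, fun i => ?_⟩
      by_cases hi : a i = 1 <;> simp [hi]
    · rintro ⟨S, rfl, h⟩
      congr 1
      ext i
      have := h i
      by_cases hi : i ∈ S <;> simp_all
  rw [h, Finset.card_biUnion]
  · have : ∀ S ∈ Finset.powersetCard s (Finset.univ : Finset ι),
        (Fintype.piFinset fun i => if i ∈ S then Finset.univ.erase (1 : E) else {1}).card =
          (Fintype.card E - 1) ^ s := by
      intro S hS
      rw [Fintype.card_piFinset, ← (Finset.mem_powersetCard.1 hS).2]
      have : ∀ i, (if i ∈ S then Finset.univ.erase (1 : E) else {1}).card =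
          if i ∈ S then Fintype.card E - 1 else 1 := by
        intro i; split_ifs <;> simp
      simp only [this]
      rw [Finset.prod_ite_mem, Finset.univ_inter, Finset.prod_const]
    rw [Finset.sum_congr rfl this, Finset.sum_const, Finset.card_powersetCard, Finset.card_univ,
      smul_eq_mul, mul_comm]
  · intro S _ S' _ hne
    refine Finset.disjoint_left.2 fun a ha ha' => hne ?_
    rw [Fintype.mem_piFinset] at ha ha'
    ext i
    have h1 := ha i
    have h2 := ha' i
    by_cases hi : i ∈ S <;> by_cases hi' : i ∈ S' <;> simp_all

section Blocks

variable {ι B : Type*} [Fintype ι] [DecidableEq ι] [Fintype B] [DecidableEq B]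

/-- Permute the blocks by `τ` and act by `π i` inside block `i`. -/
def blockPerm (τ : Perm ι) (π : ι → Perm B) : Perm (ι × B) :=
  prodCongrLeft (fun _ : B => τ) * prodCongrRight π

@[simp] lemma blockPerm_apply (τ : Perm ι) (π : ι → Perm B) (x : ι × B) :
    blockPerm τ π x = (τ x.1, π x.1 x.2) := rfl

lemma sign_blockPerm (τ : Perm ι) (π : ι → Perm B) :
    Perm.sign (blockPerm τ π) = Perm.sign τ ^ Fintype.card B * ∏ i, Perm.sign (π i) := by
  rw [blockPerm, Perm.sign_mul, Perm.sign_prodCongrLeft, Perm.sign_prodCongrRight]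
  simp

lemma blockPerm_mul (τ τ' : Perm ι) (π π' : ι → Perm B) :
    blockPerm τ' π' * blockPerm τ π = blockPerm (τ' * τ) (fun i => π' (τ i) * π i) := by
  ext x <;> simp

variable (E : Subgroup (Perm B)) (hE : E ≤ alternatingGroup B)

/-- The embedding of `E` as acting on block `i` only. -/
def blockHom (i : ι) : E →* alternatingGroup (ι × B) where
  toFun e := ⟨blockPerm 1 (Pi.mulSingle i (e : Perm B)), by
    have : ∏ j, Perm.sign ((Pi.mulSingle i (e : Perm B) : ι → Perm B) j) = 1 := by
      refine Finset.prod_eq_one fun j _ => ?_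
      by_cases hj : j = i
      · subst hj; simpa using Perm.mem_alternatingGroup.1 (hE e.2)
      · simp [hj]
    rw [Perm.mem_alternatingGroup, sign_blockPerm, this]; simp⟩
  map_one' := by ext x <;> simp
  map_mul' e e' := by
    ext x
    · simp
    · by_cases hj : x.1 = i
      · simp [hj]
      · simp [hj]

lemma coe_blockHom (i : ι) (e : E) :
    (blockHom E hE i e : Perm (ι × B)) = blockPerm 1 (Pi.mulSingle i (e : Perm B)) := rfl

lemma blockHom_commute_of_ne {i j : ι} (hij : i ≠ j) (e e' : E) :
    Commute (blockHom E hE i e) (blockHom E hE j e') := by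
  refine Subtype.ext ?_
  simp only [Subgroup.coe_mul, coe_blockHom, blockPerm_mul]
  congr 1
  funext l
  by_cases hi : l = i
  · subst hi; simp [hij]
  · simp [hi]

lemma conj_blockHom [E.Normal] (i : ι) (e : E) (τ : Perm ι) (π : ι → Perm B) :
    blockPerm τ π * blockHom E hE i e =
      blockHom E hE (τ i) (MulAut.conjNormal (π i) e) * blockPerm τ π := by
  rw [coe_blockHom, coe_blockHom, blockPerm_mul, blockPerm_mul]
  congr 1
  funext l
  by_cases hi : l = i
  · subst hi; simp [MulAut.conjNormal_apply]
  · simp [hi]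

end Blocks

section Weights

variable {F V ι B : Type*} [Fintype ι] [DecidableEq ι] [Fintype B] [DecidableEq B]
  [Field F] [IsAlgClosed F] [AddCommGroup V] [Module F V] [FiniteDimensional F V]

variable (E : Subgroup (Perm B)) [E.Normal] (hE : E ≤ alternatingGroup B)
  (β : E → E → F) (ρ : Representation F (alternatingGroup (ι × B)) V)

/-- `a` occurs as a simultaneous eigencharacter (through the pairing `β`). -/
def IsWeight (a : ι → E) : Prop :=
  ∃ v : V, v ≠ 0 ∧ ∀ i e, ρ (blockHom E hE i e) v = β (a i) e • v

variable {E β ρ}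

lemma IsWeight.move (hβ : ∀ (π : Perm B) q e,
      β (MulAut.conjNormal π q) (MulAut.conjNormal π e) = β q e)
    {a a' : ι → E} (ha : IsWeight E hE β ρ a) (τ : Perm ι) (π : ι → Perm B)
    (hs : Perm.sign (blockPerm τ π) = 1)
    (h : ∀ i, a' (τ i) = MulAut.conjNormal (π i) (a i)) : IsWeight E hE β ρ a' := by
  obtain ⟨v, hv, hv'⟩ := ha
  set σ : alternatingGroup (ι × B) := ⟨blockPerm τ π, Perm.mem_alternatingGroup.2 hs⟩ with hσ
  refine ⟨ρ σ v, fun h0 => hv ?_, fun i e => ?_⟩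
  · have := congrArg (ρ σ⁻¹) h0
    rwa [← Module.End.mul_apply, ← map_mul, inv_mul_cancel, map_one, map_zero] at this
  · obtain ⟨j, rfl⟩ := τ.surjective i
    obtain ⟨e', rfl⟩ := (MulAut.conjNormal (H := E) (π j)).surjective e
    have : σ * blockHom E hE j e' = blockHom E hE (τ j) (MulAut.conjNormal (π j) e') * σ :=
      Subtype.ext (conj_blockHom E hE j e' τ π)
    rw [← Module.End.mul_apply, ← map_mul, ← this, map_mul, Module.End.mul_apply, hv', map_smul,
      h, hβ]

theorem IsWeight.le_finrank
    (hcomm : ∀ e e' : E, Commute e e')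
    (hβ : ∀ (π : Perm B) q e, β (MulAut.conjNormal π q) (MulAut.conjNormal π e) = β q e)
    (hβi : Function.Injective β)
    (hconj : ∀ q q' : E, q ≠ 1 → q' ≠ 1 → ∃ π : Perm B, MulAut.conjNormal π q = q')
    (hodd : ∀ a : ι → E, ∃ (τ : Perm ι) (π : ι → Perm B), Perm.sign (blockPerm τ π) = -1 ∧
      ∀ i, a (τ i) = MulAut.conjNormal (π i) (a i))
    [Fintype E] [DecidableEq E] {a : ι → E} (ha : IsWeight E hE β ρ a) (s : ℕ)
    (hs : (Finset.univ.filter fun i => a i ≠ 1).card = s) :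
    (Fintype.card E - 1) ^ s * (Fintype.card ι).choose s ≤ Module.finrank F V := by
  have key : ∀ a' : ι → E, (Finset.univ.filter fun i => a' i ≠ 1).card = s →
      IsWeight E hE β ρ a' := by
    intro a' hs'
    have hcard : Fintype.card {i // a i ≠ 1} = Fintype.card {i // a' i ≠ 1} := by
      rw [Fintype.card_subtype, Fintype.card_subtype, hs, hs']
    let τ : Perm ι := (Fintype.equivOfCardEq hcard).extendSubtype
    have hex : ∀ i, ∃ π : Perm B, MulAut.conjNormal π (a i) = a' (τ i) := by
      intro i
      by_cases hi : a i = 1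
      · have : ¬ a' (τ i) ≠ 1 :=
          (Fintype.equivOfCardEq hcard).extendSubtype_not_mem i (by simpa using hi)
        exact ⟨1, by rw [hi, not_not.1 this, map_one]⟩
      · exact hconj _ _ hi ((Fintype.equivOfCardEq hcard).extendSubtype_mem i hi)
    choose π hπ using hex
    rcases Int.units_eq_one_or (Perm.sign (blockPerm τ π)) with h1 | h1
    · exact ha.move hE hβ τ π h1 fun i => (hπ i).symm
    · obtain ⟨τ', π', h2, h3⟩ := hodd a
      refine ha.move hE hβ (τ * τ') (fun i => π (τ' i) * π' i) ?_ fun i => ?_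
      · rw [← blockPerm_mul, Perm.sign_mul, h1, h2]; rfl
      · rw [Perm.mul_apply, ← hπ, h3, map_mul, MulAut.mul_apply]
  rw [← card_support_eq s]
  refine card_weights_le (fun x : ι × E => ρ (blockHom E hE x.1 x.2)) ?_ _
    (fun a x => β (a x.1) x.2) ?_ ?_
  · rintro ⟨i, e⟩ ⟨j, e'⟩
    rw [Commute, SemiconjBy, ← map_mul, ← map_mul]
    congr 1
    by_cases hij : i = j
    · subst hij
      rw [← map_mul, ← map_mul, (hcomm e e').eq]
    · exact blockHom_commute_of_ne E hE hij e e'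
  · intro a a' h
    funext i
    apply hβi
    funext e
    exact congrFun h (i, e)
  · intro a' ha'
    obtain ⟨v, hv, hv'⟩ := key a' (Finset.mem_filter.1 ha').2
    exact ⟨v, hv, fun x => hv' x.1 x.2⟩

/-- A nonzero element in the image of `1 - c_i` for each `i ∈ I` yields a weight whose support
contains `I`. -/
theorem exists_weight
    (hcomm : ∀ e e' : E, Commute e e')
    (hchar : ∀ χ : E →* F, ∃ q, ∀ e, χ e = β q e)
    (hβ1 : ∀ e, β 1 e = 1)
    (c : E) (hc : (orderOf c : F) ≠ 0)
    (I : Finset ι) (u : V) (hu : u ≠ 0)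
    (hI : ∀ i ∈ I, ∃ y, y - ρ (blockHom E hE i c) y = u) :
    ∃ a : ι → E, IsWeight E hE β ρ a ∧ ∀ i ∈ I, a i ≠ 1 := by
  have hblock : ∀ (i j : ι) (e e' : E), Commute (blockHom E hE i e) (blockHom E hE j e') := by
    intro i j e e'
    by_cases hij : i = j
    · subst hij
      rw [Commute, SemiconjBy, ← map_mul, ← map_mul, (hcomm e e').eq]
    · exact blockHom_commute_of_ne E hE hij e e'
  set U : Submodule F V :=
    ⨅ i ∈ I, LinearMap.range (1 - ρ (blockHom E hE i c) : Module.End F V) with hU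
  have huU : u ∈ U := by
    simp only [hU, Submodule.mem_iInf]
    intro i hi
    obtain ⟨y, hy⟩ := hI i hi
    exact ⟨y, hy⟩
  have hUinv : ∀ i e, ∀ u ∈ U, ρ (blockHom E hE i e) u ∈ U := by
    intro i e u hu
    simp only [hU, Submodule.mem_iInf] at hu ⊢
    intro j hj
    obtain ⟨y, rfl⟩ := hu j hj
    refine ⟨ρ (blockHom E hE i e) y, ?_⟩
    simp only [LinearMap.sub_apply, Module.End.one_apply, map_sub]
    rw [← Module.End.mul_apply, ← Module.End.mul_apply, ← map_mul, ← map_mul,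
      (hblock i j e c).eq]
  obtain ⟨w, hwU, hw0, χ, hχ⟩ := exists_common_eigenvector
    (fun x : ι × E => ρ (blockHom E hE x.1 x.2)) (by
      rintro ⟨i, e⟩ ⟨j, e'⟩
      rw [Commute, SemiconjBy, ← map_mul, ← map_mul]
      exact congrArg ρ (hblock i j e e')) _ U le_rfl
    (fun h => hu (by rw [h] at huU; exact huU)) (fun x u hu => hUinv x.1 x.2 u hu)
  have hq : ∀ i, ∃ q, ∀ e, χ (i, e) = β q e := by
    intro i
    refine hchar { toFun := fun e => χ (i, e), map_one' := ?_, map_mul' := ?_ }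
    · have := hχ (i, 1)
      rw [map_one, map_one, Module.End.one_apply] at this
      exact (smul_left_injective F hw0 (by simpa using this)).symm
    · intro e e'
      have := hχ (i, e * e')
      simp only [map_mul, Module.End.mul_apply] at this
      rw [hχ (i, e'), map_smul, hχ (i, e), smul_smul] at this
      exact (smul_left_injective F hw0 (by simpa [mul_comm] using this)).symm
  choose a ha using hq
  refine ⟨a, ⟨w, hw0, fun i e => by rw [← ha]; exact hχ (i, e)⟩, fun i hi hai => hw0 ?_⟩
  obtain ⟨y, hy⟩ : w ∈ LinearMap.range (1 - ρ (blockHom E hE i c) : Module.End F V) := by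
    simp only [hU, Submodule.mem_iInf] at hwU
    exact hwU i hi
  replace hy : w = y - ρ (blockHom E hE i c) y := hy.symm
  have hfix : ρ (blockHom E hE i c) w = w := by
    have := hχ (i, c)
    rwa [ha, hai, hβ1, one_smul] at this
  have hpow : ∀ r : ℕ, ρ (blockHom E hE i (c ^ r)) y = y - (r : F) • w := by
    intro r
    induction r with
    | zero => simp
    | succ r ih =>
      rw [pow_succ', map_mul, map_mul, Module.End.mul_apply, ih, map_sub, map_smul, hfix]
      have : ρ (blockHom E hE i c) y = y - w := by rw [hy]; abel
      rw [this]; push_cast; module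
  have := hpow (orderOf c)
  rw [pow_orderOf_eq_one, map_one, map_one, Module.End.one_apply] at this
  have h0 : (orderOf c : F) • w = 0 := by
    have := sub_eq_self.1 this.symm; exact this
  exact (smul_eq_zero.1 h0).resolve_left hc

end Weights

end AltRestriction

namespace AltRestriction
open Equiv

section Embeddings

variable {Ω B : Type*} [Fintype Ω] [DecidableEq Ω] [Fintype B] [DecidableEq B]

lemma exists_perm_comp_eq {J : Type*} [Fintype J] (y z : J ↪ Ω) :
    ∃ σ : Perm Ω, ∀ j, σ (y j) = z j := by
  classical
  let e : {x // x ∈ Set.range y} ≃ {x // x ∈ Set.range z} :=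
    (Equiv.ofInjective y y.injective).symm.trans (Equiv.ofInjective z z.injective)
  refine ⟨e.extendSubtype, fun j => ?_⟩
  rw [e.extendSubtype_apply_of_mem (y j) ⟨j, rfl⟩]
  simp [e]

/-- The action of an even permutation of `B` on the image of an embedding. -/
def altEmb (x : B ↪ Ω) : alternatingGroup B →* alternatingGroup Ω where
  toFun c := ⟨(c : Perm B).viaFintypeEmbedding x, by
    rw [Perm.mem_alternatingGroup, Perm.viaFintypeEmbedding_sign]
    exact Perm.mem_alternatingGroup.1 c.2⟩
  map_one' := by
    ext y
    by_cases hy : y ∈ Set.range x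
    · obtain ⟨b, rfl⟩ := hy
      simp [Perm.viaFintypeEmbedding_apply_image]
    · simp [Perm.viaFintypeEmbedding_apply_notMem_range _ _ hy]
  map_mul' c c' := by
    ext y
    by_cases hy : y ∈ Set.range x
    · obtain ⟨b, rfl⟩ := hy
      simp [Perm.viaFintypeEmbedding_apply_image]
    · simp [Perm.viaFintypeEmbedding_apply_notMem_range _ _ hy]

@[simp] lemma altEmb_apply (x : B ↪ Ω) (c : alternatingGroup B) (b : B) :
    (altEmb x c : Perm Ω) (x b) = x ((c : Perm B) b) :=
  Perm.viaFintypeEmbedding_apply_image _ _ _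

lemma altEmb_apply_of_notMem (x : B ↪ Ω) (c : alternatingGroup B) {y : Ω}
    (hy : y ∉ Set.range x) : (altEmb x c : Perm Ω) y = y :=
  Perm.viaFintypeEmbedding_apply_notMem_range _ _ hy

lemma eq_altEmb (x : B ↪ Ω) (c : alternatingGroup B) (g : alternatingGroup Ω)
    (h1 : ∀ b, (g : Perm Ω) (x b) = x ((c : Perm B) b))
    (h2 : ∀ y ∉ Set.range x, (g : Perm Ω) y = y) : g = altEmb x c := by
  ext y
  by_cases hy : y ∈ Set.range x
  · obtain ⟨b, rfl⟩ := hy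
    rw [h1, altEmb_apply]
  · rw [h2 y hy, altEmb_apply_of_notMem _ _ hy]

lemma altEmb_trans {C : Type*} [Fintype C] [DecidableEq C] (x : B ↪ C) (y : C ↪ Ω)
    (c : alternatingGroup B) : altEmb y (altEmb x c) = altEmb (x.trans y) c := by
  refine eq_altEmb _ _ _ (fun b => ?_) fun z hz => ?_
  · simp
  · by_cases hy : z ∈ Set.range y
    · obtain ⟨w, rfl⟩ := hy
      rw [altEmb_apply, altEmb_apply_of_notMem]
      rintro ⟨b, rfl⟩
      exact hz ⟨b, rfl⟩
    · exact altEmb_apply_of_notMem _ _ hy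

lemma altEmb_block {ι : Type*} [Fintype ι] [DecidableEq ι] (f : ι × B ↪ Ω)
    (E : Subgroup (Perm B)) (hE : E ≤ alternatingGroup B) (i : ι) (e : E) :
    altEmb f (blockHom E hE i e) =
      altEmb ((Function.Embedding.sectR i B).trans f) ⟨e, hE e.2⟩ := by
  rw [← altEmb_trans]
  congr 1
  refine eq_altEmb _ _ _ (fun b => ?_) fun z hz => ?_
  · change (i, (Pi.mulSingle i (e : Perm B) : ι → Perm B) i b) = (i, (e : Perm B) b)
    rw [Pi.mulSingle_eq_same]
  · have : z.1 ≠ i := fun h => hz ⟨z.2, by rw [← h]; rfl⟩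
    rw [coe_blockHom]
    simp [this]

end Embeddings

section Torus

variable {F V Ω B : Type*} [Fintype Ω] [DecidableEq Ω] [Fintype B] [DecidableEq B]
  [Field F] [IsAlgClosed F] [AddCommGroup V] [Module F V] [FiniteDimensional F V]

theorem le_finrank_of_disjoint_blocks
    (E : Subgroup (Perm B)) [E.Normal] (hE : E ≤ alternatingGroup B)
    (β : E → E → F) (ρ : Representation F (alternatingGroup Ω) V)
    (hcomm : ∀ e e' : E, Commute e e')
    (hchar : ∀ χ : E →* F, ∃ q, ∀ e, χ e = β q e)
    (hβ1 : ∀ e, β 1 e = 1)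
    (hβ : ∀ (π : Perm B) q e, β (MulAut.conjNormal π q) (MulAut.conjNormal π e) = β q e)
    (hβi : Function.Injective β)
    (hconj : ∀ q q' : E, q ≠ 1 → q' ≠ 1 → ∃ π : Perm B, MulAut.conjNormal π q = q')
    (k ℓ : ℕ)
    (hodd : ∀ a : Fin k → E, ∃ (τ : Perm (Fin k)) (π : Fin k → Perm B),
      Perm.sign (blockPerm τ π) = -1 ∧ ∀ i, a (τ i) = MulAut.conjNormal (π i) (a i))
    [Fintype E] [DecidableEq E]
    (hk : k * Fintype.card B ≤ Fintype.card Ω) (hℓ : ℓ ≤ k)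
    (c : E) (hc : (orderOf c : F) ≠ 0) (x : Fin ℓ × B ↪ Ω) (u : V) (hu : u ≠ 0)
    (hx : ∀ i, ∃ y, y - ρ (altEmb ((Function.Embedding.sectR i B).trans x) ⟨c, hE c.2⟩) y = u) :
    ∃ s, ℓ ≤ s ∧ s ≤ k ∧ (Fintype.card E - 1) ^ s * k.choose s ≤ Module.finrank F V := by
  obtain ⟨f₀⟩ : Nonempty (Fin k × B ↪ Ω) :=
    Function.Embedding.nonempty_of_card_le (by simpa using hk)
  let j : Fin ℓ × B ↪ Fin k × B :=
    Function.Embedding.prodMap (Fin.castLEEmb hℓ) (Function.Embedding.refl B)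
  obtain ⟨σ, hσ⟩ := exists_perm_comp_eq (j.trans f₀) x
  let f : Fin k × B ↪ Ω := f₀.trans σ.toEmbedding
  have hf : ∀ i b, f (Fin.castLE hℓ i, b) = x (i, b) := fun i b => hσ (i, b)
  obtain ⟨a, ha, haI⟩ := exists_weight hE (β := β) (ρ := ρ.comp (altEmb f)) hcomm hchar hβ1 c hc
    (Finset.univ.map (Fin.castLEEmb hℓ)) u hu (by
      intro i hi
      obtain ⟨i, -, rfl⟩ := Finset.mem_map.1 hi
      obtain ⟨y, hy⟩ := hx i
      refine ⟨y, ?_⟩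
      have h2 : (Function.Embedding.sectR (Fin.castLE hℓ i) B).trans f =
          (Function.Embedding.sectR i B).trans x := by
        ext b; exact hf i b
      rw [← hy]
      change y - ρ (altEmb f (blockHom E hE (Fin.castLE hℓ i) c)) y = _
      rw [altEmb_block, h2])
  have := ha.le_finrank hE hcomm hβ hβi hconj hodd _ rfl
  rw [Fintype.card_fin] at this
  refine ⟨_, ?_, ?_, this⟩
  · have := Finset.card_le_card (s := Finset.univ.map (Fin.castLEEmb hℓ))
      (t := Finset.univ.filter fun i => a i ≠ 1) fun i hi => by simpa using haI i hi
    simpa using this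
  · simpa using Finset.card_le_univ (Finset.univ.filter fun i => a i ≠ 1)

end Torus
end AltRestriction

namespace AltRestriction
open Equiv

section Generation

variable {Ω : Type*} [Fintype Ω] [DecidableEq Ω]

/-- Every even permutation supported in `S` lies in `H`. -/
def AltLE (S : Finset Ω) (H : Subgroup (alternatingGroup Ω)) : Prop :=
  ∀ g : alternatingGroup Ω, (∀ x ∉ S, (g : Perm Ω) x = x) → g ∈ H

lemma AltLE.mono {S T : Finset Ω} {H : Subgroup (alternatingGroup Ω)} (h : AltLE T H)
    (hST : S ⊆ T) : AltLE S H :=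
  fun g hg => h g fun x hx => hg x fun h' => hx (hST h')

lemma exists_alt_map (S : Finset Ω) {J : Type*} [Fintype J] (y z : J → Ω)
    (hy : Function.Injective y) (hz : Function.Injective z) (hyS : ∀ j, y j ∈ S)
    (hzS : ∀ j, z j ∈ S) (hJ : Fintype.card J + 2 ≤ S.card) :
    ∃ g : alternatingGroup Ω, (∀ w ∉ S, (g : Perm Ω) w = w) ∧ ∀ j, (g : Perm Ω) (y j) = z j := by
  obtain ⟨σ, hσ⟩ := exists_perm_comp_eq (Ω := S) ⟨fun j => ⟨y j, hyS j⟩, fun a b h => hy (by simpa using h)⟩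
    ⟨fun j => ⟨z j, hzS j⟩, fun a b h => hz (by simpa using h)⟩
  have hσ' : ∀ j, Perm.ofSubtype σ (y j) = z j := by
    intro j
    rw [Perm.ofSubtype_apply_of_mem _ (hyS j)]
    exact congrArg Subtype.val (hσ j)
  have hσS : ∀ w ∉ S, Perm.ofSubtype σ w = w := fun w hw =>
    Perm.ofSubtype_apply_of_not_mem _ hw
  rcases Int.units_eq_one_or (Perm.sign (Perm.ofSubtype σ)) with h | h
  · exact ⟨⟨_, Perm.mem_alternatingGroup.2 h⟩, hσS, hσ'⟩
  · have hcard : 1 < (S \ Finset.univ.image z).card := by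
      have h1 := Finset.le_card_sdiff (Finset.univ.image z) S
      have h2 : (Finset.univ.image z).card ≤ Fintype.card J := Finset.card_image_le
      omega
    obtain ⟨p, hp, q, hq, hpq⟩ := Finset.one_lt_card.1 hcard
    simp only [Finset.mem_sdiff, Finset.mem_image, Finset.mem_univ, true_and, not_exists] at hp hq
    refine ⟨⟨swap p q * Perm.ofSubtype σ, Perm.mem_alternatingGroup.2 ?_⟩, fun w hw => ?_,
      fun j => ?_⟩
    · rw [Perm.sign_mul, h, Perm.sign_swap hpq]; rfl
    · rw [Perm.mul_apply, hσS w hw]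
      exact swap_apply_of_ne_of_ne (fun h => hw (h ▸ hp.1)) fun h => hw (h ▸ hq.1)
    · rw [Perm.mul_apply, hσ' j]
      exact swap_apply_of_ne_of_ne (hp.2 j) (hq.2 j)

lemma exists_alt_apply_eq (S : Finset Ω) (hS : 3 ≤ S.card) {y z : Ω} (hy : y ∈ S) (hz : z ∈ S) :
    ∃ g : alternatingGroup Ω, (∀ w ∉ S, (g : Perm Ω) w = w) ∧ (g : Perm Ω) y = z := by
  obtain ⟨g, hg, h⟩ := exists_alt_map S (J := Unit) (fun _ => y) (fun _ => z)
    (Function.injective_of_subsingleton _) (Function.injective_of_subsingleton _)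
    (fun _ => hy) (fun _ => hz) (by simpa using hS)
  exact ⟨g, hg, h ()⟩

lemma AltLE.insert {S : Finset Ω} {H : Subgroup (alternatingGroup Ω)} (h : AltLE S H)
    (hS : 3 ≤ S.card) {x : Ω} (k : alternatingGroup Ω) (hk : k ∈ H)
    (hkS : ∀ y ∉ insert x S, (k : Perm Ω) y = y) (hkx : (k : Perm Ω) x ≠ x) :
    AltLE (insert x S) H := by
  have hmaps : ∀ g : alternatingGroup Ω, (∀ y ∉ Insert.insert x S, (g : Perm Ω) y = y) →
      (g : Perm Ω) x ≠ x → (g : Perm Ω) x ∈ S := by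
    intro g hg hgx
    by_contra hn
    have : (g : Perm Ω) x ∉ Insert.insert x S := by
      simp only [Finset.mem_insert, not_or]; exact ⟨hgx, hn⟩
    exact hgx ((g : Perm Ω).injective (hg _ this))
  intro g hg
  by_cases hgx : (g : Perm Ω) x = x
  · refine h g fun y hy => ?_
    by_cases hyx : y = x
    · rw [hyx, hgx]
    · exact hg y (by simp [hyx, hy])
  · obtain ⟨a, haS, ha⟩ := exists_alt_apply_eq S hS (hmaps k hkS hkx) (hmaps g hg hgx)
    have haH := h a haS
    have hxS : x ∉ S ∨ x ∈ S := (em _).symm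
    have : (a * k)⁻¹ * g ∈ H := by
      refine h _ fun y hy => ?_
      have hk1 : ∀ z, (k : Perm Ω) z = (k : Perm Ω) y → z = y := fun z hz => (k : Perm Ω).injective hz
      simp only [Subgroup.coe_mul, Subgroup.coe_inv, Perm.mul_apply]
      rw [Perm.inv_eq_iff_eq, Perm.mul_apply]
      by_cases hyx : y = x
      · rw [hyx, ha]
      · have hy' : y ∉ Insert.insert x S := by simp [hyx, hy]
        rw [hg y hy', hkS y hy', haS y hy]
    have h2 : g = (a * k) * ((a * k)⁻¹ * g) := by group
    rw [h2]
    exact H.mul_mem (H.mul_mem haH hk) this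

lemma AltLE.union {S T : Finset Ω} {H : Subgroup (alternatingGroup Ω)} (hS : AltLE S H)
    (hT : AltLE T H) (hST : 2 ≤ (S ∩ T).card) (hS3 : 3 ≤ S.card) : AltLE (S ∪ T) H := by
  suffices ∀ U ⊆ T, AltLE (S ∪ U) H from this T subset_rfl
  intro U
  induction U using Finset.induction_on with
  | empty => intro _; simpa using hS
  | insert x U hx ih =>
    intro hU
    have ih' := ih ((Finset.subset_insert _ _).trans hU)
    have hxT : x ∈ T := hU (Finset.mem_insert_self _ _)
    by_cases hxS : x ∈ S ∪ U
    · rwa [Finset.union_insert, Finset.insert_eq_of_mem hxS]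
    · have hxS' : x ∉ S := fun h => hxS (Finset.mem_union_left _ h)
      have hsub : Insert.insert x (S ∩ T) ⊆ T := by
        intro y hy
        rcases Finset.mem_insert.1 hy with rfl | hy
        · exact hxT
        · exact (Finset.mem_inter.1 hy).2
      obtain ⟨y, hy⟩ : (S ∩ T).Nonempty := Finset.card_pos.1 (by omega)
      obtain ⟨k, hk, hkx⟩ := exists_alt_apply_eq (Insert.insert x (S ∩ T)) (by
        rw [Finset.card_insert_of_notMem (by simp [hxS'])]; omega)
        (Finset.mem_insert_self _ _) (Finset.mem_insert_of_mem hy)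
      rw [Finset.union_insert]
      refine ih'.insert (hS3.trans (Finset.card_le_card Finset.subset_union_left)) k
        (hT k fun w hw => hk w fun h => hw (hsub h)) (fun w hw => hk w fun h => hw ?_) ?_
      · rcases Finset.mem_insert.1 h with rfl | h
        · exact Finset.mem_insert_self _ _
        · exact Finset.mem_insert_of_mem (Finset.mem_union_left _ (Finset.mem_inter.1 h).1)
      · rw [hkx]; rintro rfl; exact hxS' (Finset.mem_inter.1 hy).1

/-- The standard 3-cycle. -/
def threeRot : alternatingGroup (Fin 3) := 
  ⟨finRotate 3, Perm.mem_alternatingGroup.2 (by decide)⟩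

lemma coe_altEmb_trans_perm {B : Type*} [Fintype B] [DecidableEq B] (x : B ↪ Ω) (σ : Perm Ω)
    (c : alternatingGroup B) :
    (altEmb (x.trans σ.toEmbedding) c : Perm Ω) = σ * altEmb x c * σ⁻¹ := by
  ext y
  obtain ⟨y, rfl⟩ := σ.surjective y
  have hσ : σ⁻¹ (σ y) = y := σ.symm_apply_apply y
  rw [Perm.mul_apply, Perm.mul_apply, hσ]
  by_cases hy : y ∈ Set.range x
  · obtain ⟨b, rfl⟩ := hy
    rw [altEmb_apply]
    exact altEmb_apply (x.trans σ.toEmbedding) c b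
  · rw [altEmb_apply_of_notMem _ _ hy, altEmb_apply_of_notMem]
    rintro ⟨b, hb⟩
    exact hy ⟨b, σ.injective hb⟩

lemma isThreeCycle_altEmb (x : Fin 3 ↪ Ω) : (altEmb x threeRot : Perm Ω).IsThreeCycle := by
  have h : (threeRot : Perm (Fin 3)).IsThreeCycle := by
    rw [← card_support_eq_three_iff]; decide
  have : (altEmb x threeRot : Perm Ω) = (threeRot : Perm (Fin 3)).viaFintypeEmbedding x := rfl
  rw [Perm.IsThreeCycle, this, Perm.viaFintypeEmbedding, Perm.cycleType_extendDomain]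
  exact h

lemma exists_eq_altEmb_threeRot {t : Perm Ω} (ht : t.IsThreeCycle) :
    ∃ x : Fin 3 ↪ Ω, t = altEmb x threeRot := by
  obtain ⟨x₀⟩ : Nonempty (Fin 3 ↪ Ω) := Function.Embedding.nonempty_of_card_le (by
    rw [Fintype.card_fin, ← ht.card_support]; exact Finset.card_le_univ _)
  obtain ⟨σ, hσ⟩ := isConj_iff.1 (Perm.isConj_iff_cycleType_eq.2
    ((isThreeCycle_altEmb x₀).cycleType.trans ht.cycleType.symm))
  exact ⟨x₀.trans σ.toEmbedding, by rw [coe_altEmb_trans_perm, hσ]⟩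

lemma altLE_of_threeCycles {S : Finset Ω} {H : Subgroup (alternatingGroup Ω)}
    (h : ∀ x : Fin 3 ↪ Ω, (∀ i, x i ∈ S) → altEmb x threeRot ∈ H) : AltLE S H := by
  intro g hg
  let K : Subgroup (Perm Ω) := H.map (alternatingGroup Ω).subtype
  have hgS : ∀ x, x ∈ S ↔ (g : Perm Ω) x ∈ S := by
    intro x
    by_cases hx : (g : Perm Ω) x = x
    · rw [hx]
    · refine ⟨fun _ => ?_, fun _ => ?_⟩ <;> by_contra hn
      · exact hx ((g : Perm Ω).injective (hg _ hn))
      · exact hx (hg x hn)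
  let g' : Perm S := (g : Perm Ω).subtypePerm fun x => (hgS x).symm
  have hg' : Perm.ofSubtype g' = (g : Perm Ω) :=
    Perm.ofSubtype_subtypePerm _ fun x hx => by by_contra hn; exact hx (hg x hn)
  have hle : alternatingGroup S ≤ K.comap (Perm.ofSubtype (p := (· ∈ S))) := by
    rw [← Perm.closure_three_cycles_eq_alternating, Subgroup.closure_le]
    intro t ht
    obtain ⟨x, rfl⟩ := exists_eq_altEmb_threeRot ht
    let y : Fin 3 ↪ Ω := x.trans (Function.Embedding.subtype _)
    refine ⟨altEmb y threeRot, h y fun i => (x i).2, ?_⟩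
    ext w
    by_cases hw : w ∈ S
    · rw [Perm.ofSubtype_apply_of_mem _ hw]
      by_cases hx : (⟨w, hw⟩ : S) ∈ Set.range x
      · obtain ⟨b, hb⟩ := hx
        have : w = y b := (congrArg Subtype.val hb).symm
        subst this
        rw [← hb, altEmb_apply]
        exact altEmb_apply y _ b
      · rw [altEmb_apply_of_notMem _ _ hx]
        refine altEmb_apply_of_notMem _ _ ?_
        rintro ⟨b, rfl⟩
        exact hx ⟨b, rfl⟩
    · rw [Perm.ofSubtype_apply_of_not_mem _ hw]
      refine altEmb_apply_of_notMem _ _ ?_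
      rintro ⟨b, rfl⟩
      exact hw (x b).2
  have hmem : g' ∈ alternatingGroup S := by
    rw [Perm.mem_alternatingGroup, ← Perm.sign_ofSubtype, hg']
    exact Perm.mem_alternatingGroup.1 g.2
  obtain ⟨k, hk, hkg⟩ := hle hmem
  rw [hg'] at hkg
  have : k = g := Subtype.ext hkg
  exact this ▸ hk

end Generation
end AltRestriction

namespace AltRestriction
open Equiv

universe u v

/-- A permutation `c` of a block of size `b` such that disjoint copies of `c` give many
simultaneous eigencharacters over `F`, and that generates large alternating groups. -/
structure IsBlockType (F : Type u) [Field F] (V : Type v) [AddCommGroup V] [Module F V] (b : ℕ)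
    (c : alternatingGroup (Fin b)) : Prop where
  orderOf_ne : (orderOf c : F) ≠ 0
  gen : ∀ {n : ℕ} (S : Finset (Fin n)) (H : Subgroup (alternatingGroup (Fin n))), 5 ≤ S.card →
    (∀ x : Fin b ↪ Fin n, (∀ i, x i ∈ S) → altEmb x c ∈ H) → AltLE S H
  bound : ∀ {n : ℕ} (ρ : Representation F (alternatingGroup (Fin n)) V) (k ℓ : ℕ), 2 ≤ k →
    k * b ≤ n → ℓ ≤ k → ∀ (x : Fin ℓ × Fin b ↪ Fin n) (u : V), u ≠ 0 →
    (∀ i, ∃ y, y - ρ (altEmb ((Function.Embedding.sectR i (Fin b)).trans x) c) y = u) →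
    ∃ s, ℓ ≤ s ∧ s ≤ k ∧ (b - 1) ^ s * k.choose s ≤ Module.finrank F V

section Three

lemma val_apply_zero_conj : ∀ π q e : Perm (Fin 3), Perm.sign q = 1 → Perm.sign e = 1 →
    ((π * q * π⁻¹) 0).val * ((π * e * π⁻¹) 0).val % 3 = (q 0).val * (e 0).val % 3 := by
  decide +kernel

lemma eq_threeRot_pow : ∀ e : Perm (Fin 3), Perm.sign e = 1 →
    e = (finRotate 3) ^ (e 0).val := by
  decide +kernel

lemma conj_of_ne_one_three : ∀ q q' : Perm (Fin 3), Perm.sign q = 1 → Perm.sign q' = 1 →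
    q ≠ 1 → q' ≠ 1 → ∃ π : Perm (Fin 3), π * q * π⁻¹ = q' := by
  decide +kernel

theorem isBlockType_three (F : Type u) [Field F] [IsAlgClosed F] (V : Type v) [AddCommGroup V]
    [Module F V] [FiniteDimensional F V] (h3 : (3 : F) ≠ 0) : IsBlockType F V 3 threeRot := by
  have h3' : orderOf threeRot = 3 :=
    orderOf_eq_prime (Subtype.ext (by decide +kernel)) fun h =>
      absurd (congrArg Subtype.val h) (by decide +kernel)
  refine ⟨by rw [h3']; exact_mod_cast h3, fun S H _ h => altLE_of_threeCycles h, ?_⟩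
  intro n ρ k ℓ hk hkn hℓ x u hu hx
  have : NeZero ((3 : ℕ) : F) := ⟨by exact_mod_cast h3⟩
  obtain ⟨ζ, hζ⟩ := HasEnoughRootsOfUnity.exists_primitiveRoot F 3
  have hmem : ∀ e : alternatingGroup (Fin 3), Perm.sign (e : Perm (Fin 3)) = 1 :=
    fun e => Perm.mem_alternatingGroup.1 e.2
  have hpow : ∀ e : alternatingGroup (Fin 3), e = threeRot ^ ((e : Perm (Fin 3)) 0).val :=
    fun e => Subtype.ext (eq_threeRot_pow e (hmem e))
  have hconj : ∀ q q' : alternatingGroup (Fin 3), q ≠ 1 → q' ≠ 1 →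
      ∃ π : Perm (Fin 3), MulAut.conjNormal π q = q' := by
    intro q q' hq hq'
    obtain ⟨π, hπ⟩ := conj_of_ne_one_three q q' (hmem q) (hmem q')
      (fun h => hq (Subtype.ext h)) (fun h => hq' (Subtype.ext h))
    exact ⟨π, Subtype.ext hπ⟩
  have hcard : Fintype.card (alternatingGroup (Fin 3)) = 3 := by decide +kernel
  have := le_finrank_of_disjoint_blocks (alternatingGroup (Fin 3)) le_rfl
    (fun q e => ζ ^ (((q : Perm (Fin 3)) 0).val * ((e : Perm (Fin 3)) 0).val)) ρ
    (fun e e' => by rw [hpow e, hpow e']; exact Commute.pow_pow (Commute.refl _) _ _)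
    (fun χ => by
      have h1 : χ threeRot ^ 3 = 1 := by
        have : threeRot ^ 3 = 1 := orderOf_dvd_iff_pow_eq_one.1 h3'.dvd
        rw [← map_pow, this, map_one]
      obtain ⟨i, hi, hi'⟩ := hζ.eq_pow_of_pow_eq_one h1
      refine ⟨threeRot ^ i, fun e => ?_⟩
      have h2 : (((threeRot ^ i : alternatingGroup (Fin 3)) : Perm (Fin 3)) 0).val = i := by
        interval_cases i <;> decide +kernel
      rw [congrArg χ (hpow e), map_pow, ← hi', ← pow_mul, h2])
    (fun e => by simp)
    (fun π q e => by
      have h := val_apply_zero_conj π q e (hmem q) (hmem e)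
      have h2 : ∀ N : ℕ, ζ ^ N = ζ ^ (N % 3) := fun N => pow_eq_pow_mod N hζ.pow_eq_one
      rw [h2, h2 (_ * _ : ℕ)]
      exact congrArg _ h)
    (fun q q' h => by
      have h1 := congrFun h threeRot
      have h2 : (((threeRot : Perm (Fin 3)) 0 : Fin 3) : ℕ) = 1 := by decide +kernel
      simp only [h2, mul_one] at h1
      have := hζ.pow_inj (Fin.is_lt _) (Fin.is_lt _) h1
      rw [hpow q, hpow q', this])
    hconj k ℓ
    (fun a => by
      by_cases ha : ∃ i, a i = 1
      · obtain ⟨i, hi⟩ := ha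
        refine ⟨1, Pi.mulSingle i (swap 0 1), ?_, fun j => ?_⟩
        · rw [sign_blockPerm, Finset.prod_eq_single i]
          · simp
          · intro j _ hj; simp [hj]
          · simp
        · by_cases hj : j = i
          · subst hj; simp [hi]
          · simp [hj]
      · push Not at ha
        let i : Fin k := ⟨0, by omega⟩
        let j : Fin k := ⟨1, by omega⟩
        have hij : i ≠ j := by simp [i, j]
        obtain ⟨π, hπ⟩ := hconj _ _ (ha i) (ha j)
        refine ⟨swap i j, Pi.mulSingle i π * Pi.mulSingle j π⁻¹, ?_, fun l => ?_⟩
        · have h1 : ∀ (i : Fin k) (π : Perm (Fin 3)),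
              ∏ l, Perm.sign ((Pi.mulSingle i π : Fin k → Perm (Fin 3)) l) = Perm.sign π := by
            intro i π
            rw [Finset.prod_eq_single i]
            · simp
            · intro j _ hj; simp [hj]
            · simp
          rw [sign_blockPerm]
          simp only [Pi.mul_apply, Perm.sign_mul, Finset.prod_mul_distrib, h1,
            Perm.sign_swap hij, Perm.sign_inv, Int.units_mul_self, Fintype.card_fin]
          rfl
        · by_cases hi : l = i
          · subst hi; simp [hij, hπ]
          · by_cases hj : l = j
            · subst hj
              have : π⁻¹ = (π : Perm (Fin 3))⁻¹ := rfl
              simp [hij.symm, ← hπ, map_inv]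
            · rw [swap_apply_of_ne_of_ne hi hj]
              simp [hi, hj])
    (by simpa using hkn) hℓ threeRot (by rw [h3']; exact_mod_cast h3) x u hu hx
  rwa [hcard] at this

end Three

section Four

/-- The normal four-group of degree four. -/
def fourGroup : Subgroup (Perm (Fin 4)) where
  carrier := {e | (∀ x, e (e x) = x) ∧ Perm.sign e = 1}
  one_mem' := by simp
  mul_mem' := by
    have : ∀ a b : Perm (Fin 4), ((∀ x, a (a x) = x) ∧ Perm.sign a = 1) →
        ((∀ x, b (b x) = x) ∧ Perm.sign b = 1) → (∀ x, (a * b) ((a * b) x) = x) := by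
      decide +kernel
    rintro a b ha hb
    exact ⟨this a b ha hb, by simp [ha.2, hb.2]⟩
  inv_mem' := by
    rintro a ⟨h1, h2⟩
    have : a⁻¹ = a := inv_eq_of_mul_eq_one_left (by ext x; simp [h1])
    rw [this]; exact ⟨h1, h2⟩

instance : DecidablePred (· ∈ fourGroup) := fun e =>
  inferInstanceAs (Decidable ((∀ x, e (e x) = x) ∧ Perm.sign e = 1))

lemma fourGroup_le : fourGroup ≤ alternatingGroup (Fin 4) :=
  fun _ he => Perm.mem_alternatingGroup.2 he.2

instance : fourGroup.Normal := ⟨by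
  rintro e ⟨h1, h2⟩ π
  refine ⟨fun x => ?_, by simp [h2, mul_comm]⟩
  have h : ∀ y, π⁻¹ (π y) = y := fun y => π.symm_apply_apply y
  have h' : π (π⁻¹ x) = x := π.apply_symm_apply x
  simp only [Perm.mul_apply, h, h1, h']⟩

lemma fourGroup_comm : ∀ a b : Perm (Fin 4), a ∈ fourGroup → b ∈ fourGroup → a * b = b * a := by
  decide +kernel

lemma fourGroup_conj : ∀ a b : Perm (Fin 4), a ∈ fourGroup → b ∈ fourGroup → a ≠ 1 → b ≠ 1 →
    ∃ π : Perm (Fin 4), π * a * π⁻¹ = b := by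
  decide +kernel

lemma fourGroup_odd : ∀ a : Perm (Fin 4), a ∈ fourGroup →
    ∃ π : Perm (Fin 4), Perm.sign π = -1 ∧ a = π * a * π⁻¹ := by
  decide +kernel

lemma fourGroup_separates : ∀ q q' : Perm (Fin 4), q ∈ fourGroup → q' ∈ fourGroup → q ≠ q' →
    ∃ e : Perm (Fin 4), e ∈ fourGroup ∧
      ((q = 1 ∨ e = 1 ∨ q = e) ↔ ¬ (q' = 1 ∨ e = 1 ∨ q' = e)) := by
  decide +kernel

/-- A double transposition. -/
def doubleSwap : alternatingGroup (Fin 4) :=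
  ⟨swap 0 1 * swap 2 3, Perm.mem_alternatingGroup.2 (by decide)⟩

lemma fourGroup_cases : ∀ e : fourGroup, e = 1 ∨
    e = ⟨swap 0 1 * swap 2 3, by decide⟩ ∨ e = ⟨swap 0 2 * swap 1 3, by decide⟩ ∨
    e = ⟨swap 0 1 * swap 2 3, by decide⟩ * ⟨swap 0 2 * swap 1 3, by decide⟩ := by
  decide +kernel

lemma threeRot_eq_mul : ∃ y z : Fin 4 ↪ Fin 5,
    altEmb (Fin.castLEEmb (by norm_num : 3 ≤ 5)) threeRot =
      altEmb y doubleSwap * altEmb z doubleSwap := by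
  refine ⟨⟨![0, 1, 3, 4], by decide⟩, ⟨![1, 2, 3, 4], by decide⟩, Eq.symm (eq_altEmb _ _ _ ?_ ?_)⟩
  · decide +kernel
  · decide +kernel

lemma exists_embedding_extending {n : ℕ} (S : Finset (Fin n)) (hS : 5 ≤ S.card)
    (x : Fin 3 ↪ Fin n) (hx : ∀ i, x i ∈ S) :
    ∃ f : Fin 5 ↪ Fin n, (∀ i, f i ∈ S) ∧ (Fin.castLEEmb (by norm_num : 3 ≤ 5)).trans f = x := by
  obtain ⟨y⟩ : Nonempty (Fin 5 ↪ S) :=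
    Function.Embedding.nonempty_of_card_le (by simpa using hS)
  obtain ⟨σ, hσ⟩ := exists_perm_comp_eq ((Fin.castLEEmb (by norm_num : 3 ≤ 5)).trans y)
    (⟨fun j => ⟨x j, hx j⟩, fun a b h => x.injective (by simpa using h)⟩ : Fin 3 ↪ S)
  refine ⟨(y.trans σ.toEmbedding).trans (Function.Embedding.subtype _), fun i => by simp, ?_⟩
  ext j
  have := congrArg (fun z : S => (z : Fin n).val) (hσ j)
  exact this

/-- The pairing of the four-group with itself identifying it with its character group. -/
def fourPairing (F : Type*) [Field F] (q e : fourGroup) : F :=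
  if q = 1 ∨ e = 1 ∨ q = e then 1 else -1

theorem isBlockType_four (F : Type u) [Field F] [IsAlgClosed F] (V : Type v) [AddCommGroup V]
    [Module F V] [FiniteDimensional F V] (h2 : (2 : F) ≠ 0) : IsBlockType F V 4 doubleSwap := by
  have h2' : orderOf doubleSwap = 2 :=
    orderOf_eq_prime (Subtype.ext (by decide +kernel)) fun h =>
      absurd (congrArg Subtype.val h) (by decide +kernel)
  have hne : (1 : F) ≠ -1 := fun h => h2 (by linear_combination h)
  have hcard : Fintype.card fourGroup = 4 := by decide +kernel
  have hsq : ∀ e : fourGroup, e * e = 1 := by decide +kernel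
  refine ⟨by rw [h2']; exact_mod_cast h2, fun S H hS h => altLE_of_threeCycles fun x hx => ?_, ?_⟩
  · obtain ⟨f, hf, rfl⟩ := exists_embedding_extending S hS x hx
    obtain ⟨y, z, hyz⟩ := threeRot_eq_mul
    rw [← altEmb_trans, hyz, map_mul, altEmb_trans, altEmb_trans]
    exact mul_mem (h _ fun i => hf _) (h _ fun i => hf _)
  intro n ρ k ℓ hk hkn hℓ x u hu hx
  have h0 : ∀ (π : Perm (Fin 4)) (q : fourGroup), MulAut.conjNormal π q = 1 ↔ q = 1 :=
    fun π q => map_eq_one_iff _ (MulAut.conjNormal π).injective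
  have := le_finrank_of_disjoint_blocks fourGroup fourGroup_le (fourPairing F) ρ
    (fun e e' => Subtype.ext (fourGroup_comm e e' e.2 e'.2))
    (fun χ => by
      have hχ : ∀ e, χ e = 1 ∨ χ e = -1 := fun e => by
        rw [← mul_self_eq_one_iff, ← map_mul, hsq, map_one]
      let e₁ : fourGroup := ⟨swap 0 1 * swap 2 3, by decide⟩
      let e₂ : fourGroup := ⟨swap 0 2 * swap 1 3, by decide⟩
      have hd : e₁ ≠ 1 ∧ e₂ ≠ 1 ∧ e₁ ≠ e₂ ∧ e₁ * e₂ ≠ 1 ∧ e₁ * e₂ ≠ e₁ ∧ e₁ * e₂ ≠ e₂ := by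
        decide +kernel
      obtain ⟨hd1, hd2, hd3, hd4, hd5, hd6⟩ := hd
      suffices ∃ q, χ e₁ = fourPairing F q e₁ ∧ χ e₂ = fourPairing F q e₂ ∧
          χ e₁ * χ e₂ = fourPairing F q (e₁ * e₂) by
        obtain ⟨q, hq1, hq2, hq3⟩ := this
        refine ⟨q, fun e => ?_⟩
        rcases fourGroup_cases e with h | h | h | h
        · rw [h, map_one]; simp [fourPairing]
        · rw [h]; exact hq1
        · rw [h]; exact hq2
        · rw [h, map_mul]; exact hq3
      rcases hχ e₁ with h1 | h1 <;> rcases hχ e₂ with h2 | h2 <;> rw [h1, h2]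
      · exact ⟨1, by simp [fourPairing]⟩
      · exact ⟨e₁, by simp [fourPairing, hd1, hd2, hd3, hd4, hd5.symm]⟩
      · exact ⟨e₂, by simp [fourPairing, hd1, hd2, hd3.symm, hd4, hd6.symm]⟩
      · exact ⟨e₁ * e₂, by simp only [fourPairing, hd1, hd2, hd4, hd5, hd6]; simp⟩)
    (fun e => by simp [fourPairing])
    (fun π q e => by simp only [fourPairing, h0, (MulAut.conjNormal π).injective.eq_iff])
    (fun q q' h => by
      by_contra hn
      obtain ⟨e, he, h1⟩ := fourGroup_separates q q' q.2 q'.2 fun h => hn (Subtype.ext h)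
      have := congrFun h ⟨e, he⟩
      have h3 : ∀ q : fourGroup, (q = 1 ∨ (⟨e, he⟩ : fourGroup) = 1 ∨ q = ⟨e, he⟩) ↔
          ((q : Perm (Fin 4)) = 1 ∨ e = 1 ∨ (q : Perm (Fin 4)) = e) := fun q =>
        Subtype.ext_iff.or (Subtype.ext_iff.or Subtype.ext_iff)
      simp only [fourPairing, h3] at this
      by_cases h4 : ((q : Perm (Fin 4)) = 1 ∨ e = 1 ∨ (q : Perm (Fin 4)) = e)
      · rw [if_pos h4, if_neg (h1.1 h4)] at this
        exact hne this
      · rw [if_neg h4, if_pos (not_not.1 fun h5 => h4 (h1.2 h5))] at this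
        exact hne this.symm)
    (fun q q' hq hq' => by
      obtain ⟨π, hπ⟩ := fourGroup_conj q q' q.2 q'.2 (fun h => hq (Subtype.ext h))
        fun h => hq' (Subtype.ext h)
      exact ⟨π, Subtype.ext hπ⟩) k ℓ
    (fun a => by
      let i : Fin k := ⟨0, by omega⟩
      obtain ⟨π, hπ, ha⟩ := fourGroup_odd (a i) (a i).2
      refine ⟨1, Pi.mulSingle i π, ?_, fun j => ?_⟩
      · rw [sign_blockPerm, Finset.prod_eq_single i]
        · simp [hπ]
        · intro j _ hj; simp [hj]
        · simp
      · by_cases hj : j = i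
        · subst hj
          rw [Pi.mulSingle_eq_same]
          exact Subtype.ext ha
        · simp [hj])
    (by simpa using hkn) hℓ ⟨doubleSwap, by decide⟩ (by
      have : orderOf (⟨doubleSwap, by decide⟩ : fourGroup) = 2 :=
        orderOf_eq_prime (by rw [sq]; exact hsq _) (by decide)
      rw [this]; exact_mod_cast h2) x u hu hx
  rwa [hcard] at this

end Four

theorem exists_isBlockType (F : Type u) [Field F] [IsAlgClosed F] (V : Type v) [AddCommGroup V]
    [Module F V] [FiniteDimensional F V] : ∃ b c, (b = 3 ∨ b = 4) ∧ IsBlockType F V b c := by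
  by_cases h3 : (3 : F) = 0
  · refine ⟨4, doubleSwap, Or.inr rfl, isBlockType_four F V fun h2 => one_ne_zero (α := F) ?_⟩
    linear_combination h3 - h2
  · exact ⟨3, threeRot, Or.inl rfl, isBlockType_three F V h3⟩

end AltRestriction

namespace AltRestriction
open Equiv

section Commutators
variable {F G V : Type*} [Field F] [Group G] [AddCommGroup V] [Module F V]

/-- The operator `1 - g`. -/
def augOp (ρ : Representation F G V) (g : G) : Module.End F V := 1 - ρ g

@[simp] lemma augOp_apply (ρ : Representation F G V) (g : G) (v : V) :
    augOp ρ g v = v - ρ g v := rfl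

lemma augOp_commute (ρ : Representation F G V) {g h : G} (hgh : Commute g h) :
    Commute (augOp ρ g) (augOp ρ h) := by
  have : Commute (ρ g) (ρ h) := by
    rw [Commute, SemiconjBy, ← map_mul, ← map_mul, hgh.eq]
  exact (((Commute.one_left _).sub_left ((Commute.one_right _).sub_right this)))

/-- The subgroup fixing every vector in the range of an operator. -/
def rangeFixer (ρ : Representation F G V) (f : Module.End F V) : Subgroup G where
  carrier := {g | ρ g * f = f}
  one_mem' := by simp
  mul_mem' := by
    intro a b (ha : ρ a * f = f) (hb : ρ b * f = f)
    change ρ (a * b) * f = f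
    rw [map_mul, mul_assoc, hb, ha]
  inv_mem' := by
    intro a (ha : ρ a * f = f)
    change ρ a⁻¹ * f = f
    conv_lhs => rw [← ha]
    rw [← mul_assoc, ← map_mul, inv_mul_cancel, map_one, one_mul]

/-- The subgroup fixing a vector. -/
def vecFixer (ρ : Representation F G V) (u : V) : Subgroup G where
  carrier := {g | ρ g u = u}
  one_mem' := by simp
  mul_mem' := by
    intro a b (ha : ρ a u = u) (hb : ρ b u = u)
    change ρ (a * b) u = u
    rw [map_mul, Module.End.mul_apply, hb, ha]
  inv_mem' := by
    intro a (ha : ρ a u = u)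
    change ρ a⁻¹ u = u
    conv_lhs => rw [← ha]
    rw [← Module.End.mul_apply, ← map_mul, inv_mul_cancel, map_one, Module.End.one_apply]

lemma mem_vecFixer {ρ : Representation F G V} {u : V} {g : G} :
    g ∈ vecFixer ρ u ↔ ρ g u = u := Iff.rfl

lemma mem_rangeFixer_iff {ρ : Representation F G V} {f : Module.End F V} {g : G} :
    g ∈ rangeFixer ρ f ↔ augOp ρ g * f = 0 := by
  change ρ g * f = f ↔ _
  rw [augOp, sub_mul, one_mul, sub_eq_zero, eq_comm]

lemma rangeFixer_le (ρ : Representation F G V) (f : Module.End F V) (v : V) :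
    rangeFixer ρ f ≤ vecFixer ρ (f v) :=
  fun _ hg => LinearMap.congr_fun hg v

/-- If the order of `g` is invertible, then `g` has no unipotent part. -/
lemma eq_zero_of_fixed_augOp (ρ : Representation F G V) {g : G} (hg : (orderOf g : F) ≠ 0) (v : V)
    (h : ρ g (augOp ρ g v) = augOp ρ g v) : augOp ρ g v = 0 := by
  have key : ∀ k : ℕ, ρ (g ^ k) v = v - (k : F) • augOp ρ g v := by
    intro k
    induction k with
    | zero => simp
    | succ k ih =>
      rw [pow_succ', map_mul, Module.End.mul_apply, ih, map_sub, map_smul, h]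
      push_cast
      rw [add_smul, one_smul, augOp_apply]
      abel
  have := key (orderOf g)
  rw [pow_orderOf_eq_one, map_one, Module.End.one_apply, eq_comm, sub_eq_self,
    smul_eq_zero] at this
  exact this.resolve_left hg

end Commutators

section Levels

lemma alt_commute {Ω : Type*} [Fintype Ω] [DecidableEq Ω] {g h : alternatingGroup Ω}
    (T : Finset Ω) (hg : ∀ x ∉ T, (g : Perm Ω) x = x) (hh : ∀ x ∈ T, (h : Perm Ω) x = x) :
    Commute g h := by
  have : Perm.Disjoint (g : Perm Ω) (h : Perm Ω) := fun x => by
    by_cases hx : x ∈ T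
    · exact Or.inr (hh x hx)
    · exact Or.inl (hg x hx)
  exact Subtype.ext this.commute.eq

variable {F V : Type*} [Field F] [AddCommGroup V] [Module F V] {n b : ℕ}
  {c : alternatingGroup (Fin b)} (hc : IsBlockType F V b c)
  (ρ : Representation F (alternatingGroup (Fin n)) V)

/-- The image of an embedding of a block. -/
def blockImage {n b : ℕ} (x : Fin b ↪ Fin n) : Finset (Fin n) := Finset.univ.map x

lemma card_blockImage {n b : ℕ} (x : Fin b ↪ Fin n) : (blockImage x).card = b := by
  simp [blockImage]

lemma mem_blockImage {n b : ℕ} (x : Fin b ↪ Fin n) (i : Fin b) : x i ∈ blockImage x := by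
  simp [blockImage]

lemma altEmb_apply_of_notMem_blockImage {n b : ℕ} (x : Fin b ↪ Fin n)
    (c : alternatingGroup (Fin b)) : ∀ y ∉ blockImage x, (altEmb x c : Perm (Fin n)) y = y := by
  intro y hy
  refine altEmb_apply_of_notMem x c ?_
  rintro ⟨i, rfl⟩
  exact hy (mem_blockImage x i)


include hc in
lemma two_level (k : ℕ) (hk : 2 ≤ k) (hkn : k * b ≤ n)
    (hlow : ∀ s, 2 ≤ s → s ≤ k → Module.finrank F V < (b - 1) ^ s * k.choose s)
    (x y : Fin b ↪ Fin n) (hxy : Disjoint (blockImage x) (blockImage y)) :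
    augOp ρ (altEmb y c) * augOp ρ (altEmb x c) = 0 := by
  have hcomm : Commute (augOp ρ (altEmb y c)) (augOp ρ (altEmb x c)) :=
    augOp_commute ρ (alt_commute (blockImage y) (altEmb_apply_of_notMem_blockImage y c)
      fun z hz => altEmb_apply_of_notMem_blockImage x c z (Finset.disjoint_right.1 hxy hz))
  by_contra hn
  obtain ⟨v, hv⟩ : ∃ v, (augOp ρ (altEmb y c) * augOp ρ (altEmb x c)) v ≠ 0 := by
    by_contra! h
    exact hn (LinearMap.ext h)
  have hinj : Function.Injective fun p : Fin 2 × Fin b => ![x, y] p.1 p.2 := by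
    have hd : ∀ i j, x i ≠ y j := fun i j h =>
      Finset.disjoint_left.1 hxy (mem_blockImage x i) (h ▸ mem_blockImage y j)
    rintro ⟨p, i⟩ ⟨q, j⟩ h
    fin_cases p <;> fin_cases q <;> simp_all [(hd _ _).symm]
  obtain ⟨s, hs, hsk, hle⟩ := hc.bound ρ k 2 hk hkn hk ⟨_, hinj⟩ _ hv fun p => by
    fin_cases p
    · exact ⟨augOp ρ (altEmb y c) v, (LinearMap.congr_fun hcomm.eq v).symm⟩
    · exact ⟨augOp ρ (altEmb x c) v, rfl⟩
  exact absurd (hlow s hs hsk) (not_lt.2 hle)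

include hc in
lemma three_level (k : ℕ) (hk : 3 ≤ k) (hkn : k * b ≤ n)
    (hlow : ∀ s, 3 ≤ s → s ≤ k → Module.finrank F V < (b - 1) ^ s * k.choose s)
    (x y z : Fin b ↪ Fin n) (hxy : Disjoint (blockImage x) (blockImage y))
    (hxz : Disjoint (blockImage x) (blockImage z)) (hyz : Disjoint (blockImage y) (blockImage z)) :
    augOp ρ (altEmb z c) * (augOp ρ (altEmb y c) * augOp ρ (altEmb x c)) = 0 := by
  have hcomm : ∀ x y : Fin b ↪ Fin n, Disjoint (blockImage x) (blockImage y) →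
      Commute (augOp ρ (altEmb y c)) (augOp ρ (altEmb x c)) := fun x y hxy =>
    augOp_commute ρ (alt_commute (blockImage y) (altEmb_apply_of_notMem_blockImage y c)
      fun z hz => altEmb_apply_of_notMem_blockImage x c z (Finset.disjoint_right.1 hxy hz))
  by_contra hn
  obtain ⟨v, hv⟩ : ∃ v,
      (augOp ρ (altEmb z c) * (augOp ρ (altEmb y c) * augOp ρ (altEmb x c))) v ≠ 0 := by
    by_contra! h
    exact hn (LinearMap.ext h)
  have hinj : Function.Injective fun p : Fin 3 × Fin b => ![x, y, z] p.1 p.2 := by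
    have hd : ∀ x y : Fin b ↪ Fin n, Disjoint (blockImage x) (blockImage y) →
      ∀ i j, x i ≠ y j := fun x y hxy i j h =>
      Finset.disjoint_left.1 hxy (mem_blockImage x i) (h ▸ mem_blockImage y j)
    have h1 := hd _ _ hxy
    have h2 := hd _ _ hxz
    have h3 := hd _ _ hyz
    rintro ⟨p, i⟩ ⟨q, j⟩ h
    fin_cases p <;> fin_cases q <;> simp_all [(h1 _ _).symm, (h2 _ _).symm, (h3 _ _).symm]
  obtain ⟨s, hs, hsk, hle⟩ := hc.bound ρ k 3 (by omega) hkn hk ⟨_, hinj⟩ _ hv fun p => by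
    fin_cases p
    · have h : augOp ρ (altEmb x c) * (augOp ρ (altEmb z c) * augOp ρ (altEmb y c)) =
          augOp ρ (altEmb z c) * (augOp ρ (altEmb y c) * augOp ρ (altEmb x c)) := by
        rw [← ((hcomm _ _ hxz).mul_left (hcomm _ _ hxy)).eq, mul_assoc]
      exact ⟨(augOp ρ (altEmb z c) * augOp ρ (altEmb y c)) v, LinearMap.congr_fun h v⟩
    · have h : augOp ρ (altEmb y c) * (augOp ρ (altEmb z c) * augOp ρ (altEmb x c)) =
          augOp ρ (altEmb z c) * (augOp ρ (altEmb y c) * augOp ρ (altEmb x c)) := by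
        rw [← mul_assoc, ← mul_assoc, (hcomm _ _ hyz).eq]
      exact ⟨(augOp ρ (altEmb z c) * augOp ρ (altEmb x c)) v, LinearMap.congr_fun h v⟩
    · exact ⟨(augOp ρ (altEmb y c) * augOp ρ (altEmb x c)) v, rfl⟩
  exact absurd (hlow s hs hsk) (not_lt.2 hle)

/-- Elements supported on `T` have displaced vectors fixed by the alternating group on `Tᶜ`. -/
def LevelOne (ρ : Representation F (alternatingGroup (Fin n)) V) : Prop :=
  ∀ (T : Finset (Fin n)) (h : alternatingGroup (Fin n)), 5 ≤ Tᶜ.card →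
    (∀ x ∉ T, (h : Perm (Fin n)) x = x) → AltLE Tᶜ (rangeFixer ρ (augOp ρ h))

/-- The analogue of `LevelOne` for products of two commuting elements of small support. -/
def LevelTwo (ρ : Representation F (alternatingGroup (Fin n)) V) : Prop :=
  ∀ (S T : Finset (Fin n)) (g h : alternatingGroup (Fin n)), S.card ≤ 4 → T.card ≤ 4 →
    Disjoint S T → (∀ x ∉ S, (g : Perm (Fin n)) x = x) → (∀ x ∉ T, (h : Perm (Fin n)) x = x) →
    AltLE (S ∪ T)ᶜ (rangeFixer ρ (augOp ρ h * augOp ρ g))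

include hc in
theorem levelOne_of_vanishing (hn : b + 5 ≤ n)
    (hvan : ∀ x y : Fin b ↪ Fin n, Disjoint (blockImage x) (blockImage y) →
      augOp ρ (altEmb y c) * augOp ρ (altEmb x c) = 0) : LevelOne ρ := by
  have h1 : ∀ x : Fin b ↪ Fin n,
      AltLE (blockImage x)ᶜ (rangeFixer ρ (augOp ρ (altEmb x c))) := fun x => by
    refine hc.gen _ _ (by rw [Finset.card_compl, card_blockImage, Fintype.card_fin]; omega)
      fun y hy => mem_rangeFixer_iff.2 (hvan x y ?_)
    rw [Finset.disjoint_right]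
    intro z hz
    obtain ⟨i, -, rfl⟩ := Finset.mem_map.1 hz
    exact Finset.mem_compl.1 (hy i)
  intro T h hT hh
  refine hc.gen _ _ hT fun x hx => mem_rangeFixer_iff.2 ?_
  have hd : ∀ z ∈ blockImage x, z ∉ T := by
    intro z hz
    obtain ⟨i, -, rfl⟩ := Finset.mem_map.1 hz
    exact Finset.mem_compl.1 (hx i)
  rw [(augOp_commute ρ (alt_commute (blockImage x) (altEmb_apply_of_notMem_blockImage x c)
    fun z hz => hh z (hd z hz))).eq]
  exact mem_rangeFixer_iff.1 (h1 x h fun z hz => hh z fun hz' =>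
    hz (Finset.mem_compl.2 fun hz2 => hd z hz2 hz'))

include hc in
theorem levelTwo_of_vanishing (hb : b ≤ 4) (hn : 13 ≤ n)
    (hvan : ∀ x y z : Fin b ↪ Fin n, Disjoint (blockImage x) (blockImage y) →
      Disjoint (blockImage x) (blockImage z) → Disjoint (blockImage y) (blockImage z) →
      augOp ρ (altEmb z c) * (augOp ρ (altEmb y c) * augOp ρ (altEmb x c)) = 0) :
    LevelTwo ρ := by
  have hd : ∀ (S : Finset (Fin n)) (x : Fin b ↪ Fin n), (∀ i, x i ∈ Sᶜ) →
      ∀ z ∈ blockImage x, z ∉ S := by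
    intro S x hx z hz
    obtain ⟨i, -, rfl⟩ := Finset.mem_map.1 hz
    exact Finset.mem_compl.1 (hx i)
  have hcard : ∀ S T : Finset (Fin n), S.card ≤ 4 → T.card ≤ 4 → 5 ≤ (S ∪ T)ᶜ.card := by
    intro S T hS hT
    have := Finset.card_union_le S T
    rw [Finset.card_compl, Fintype.card_fin]
    omega
  have hcb : ∀ x : Fin b ↪ Fin n, (blockImage x).card ≤ 4 := fun x => (card_blockImage x).trans_le hb
  have hcomm : ∀ (x : Fin b ↪ Fin n) (S : Finset (Fin n)) (h : alternatingGroup (Fin n)),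
      (∀ z ∈ blockImage x, z ∉ S) → (∀ z ∉ S, (h : Perm (Fin n)) z = z) →
      Commute (augOp ρ (altEmb x c)) (augOp ρ h) := fun x S h hx hh =>
    augOp_commute ρ (alt_commute (blockImage x) (altEmb_apply_of_notMem_blockImage x c)
      fun z hz => hh z (hx z hz))
  have h1 : ∀ x y : Fin b ↪ Fin n, Disjoint (blockImage x) (blockImage y) →
      AltLE (blockImage x ∪ blockImage y)ᶜ
        (rangeFixer ρ (augOp ρ (altEmb y c) * augOp ρ (altEmb x c))) := fun x y hxy => by
    refine hc.gen _ _ (hcard _ _ (hcb x) (hcb y)) fun z hz =>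
      mem_rangeFixer_iff.2 (hvan x y z hxy ?_ ?_)
    · exact Finset.disjoint_right.2 fun w hw h =>
        hd _ _ hz w hw (Finset.mem_union_left _ h)
    · exact Finset.disjoint_right.2 fun w hw h =>
        hd _ _ hz w hw (Finset.mem_union_right _ h)
  have h2 : ∀ (x : Fin b ↪ Fin n) (T : Finset (Fin n)) (h : alternatingGroup (Fin n)),
      T.card ≤ 4 → Disjoint (blockImage x) T → (∀ z ∉ T, (h : Perm (Fin n)) z = z) →
      AltLE (blockImage x ∪ T)ᶜ (rangeFixer ρ (augOp ρ h * augOp ρ (altEmb x c))) := by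
    intro x T h hT hxT hh
    refine hc.gen _ _ (hcard _ _ (hcb x) hT) fun y hy => mem_rangeFixer_iff.2 ?_
    have hyd := hd _ _ hy
    rw [← mul_assoc, (hcomm y T h (fun z hz hz' => hyd z hz (Finset.mem_union_right _ hz')) hh).eq,
      mul_assoc]
    refine mem_rangeFixer_iff.1 (h1 x y ?_ h fun z hz => hh z fun hz' => ?_)
    · exact Finset.disjoint_right.2 fun w hw h => hyd w hw (Finset.mem_union_left _ h)
    · rw [Finset.mem_compl, not_not, Finset.mem_union] at hz
      rcases hz with hz | hz
      · exact Finset.disjoint_left.1 hxT hz hz'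
      · exact hyd z hz (Finset.mem_union_right _ hz')
  intro S T g h hS hT hST hg hh
  refine hc.gen _ _ (hcard _ _ hS hT) fun y hy => mem_rangeFixer_iff.2 ?_
  have hyd := hd _ _ hy
  have hyS : ∀ z ∈ blockImage y, z ∉ S := fun z hz hz' => hyd z hz (Finset.mem_union_left _ hz')
  have hyT : ∀ z ∈ blockImage y, z ∉ T := fun z hz hz' => hyd z hz (Finset.mem_union_right _ hz')
  rw [((hcomm y T h hyT hh).mul_right (hcomm y S g hyS hg)).eq, mul_assoc]
  refine mem_rangeFixer_iff.1 (h2 y S g hS (Finset.disjoint_left.2 hyS) hg h fun z hz => hh z ?_)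
  intro hz'
  rw [Finset.mem_compl, not_not, Finset.mem_union] at hz
  rcases hz with hz | hz
  · exact hyT z hz hz'
  · exact Finset.disjoint_left.1 hST hz hz'

end Levels
end AltRestriction

namespace AltRestriction
open Equiv

section Rotations
variable {n : ℕ}

lemma exists_rot {x s r : Fin n} (hxs : x ≠ s) (hxr : x ≠ r) (hsr : s ≠ r) :
    ∃ t : alternatingGroup (Fin n), (t : Perm (Fin n)) x = s ∧ (t : Perm (Fin n)) s = r ∧
      (t : Perm (Fin n)) r = x ∧ ∀ y, y ≠ x → y ≠ s → y ≠ r → (t : Perm (Fin n)) y = y := by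
  refine ⟨⟨swap x s * swap s r, ?_⟩, ?_, ?_, ?_, fun y h1 h2 h3 => ?_⟩
  · rw [Perm.mem_alternatingGroup, Perm.sign_mul, Perm.sign_swap hxs, Perm.sign_swap hsr]
    rfl
  · simp [swap_apply_of_ne_of_ne hxs hxr]
  · simp [swap_apply_of_ne_of_ne hxr.symm hsr.symm]
  · simp
  · simp [swap_apply_of_ne_of_ne, h1, h2, h3]

end Rotations

section DifferenceSystem
variable {F V : Type*} [Field F] [AddCommGroup V] [Module F V] {n : ℕ}
  {ρ : Representation F (alternatingGroup (Fin n)) V}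

lemma apply_eq_of_agree {S : Finset (Fin n)} {u : V} (hu : AltLE S (vecFixer ρ u))
    (g g' : alternatingGroup (Fin n))
    (h : ∀ x ∉ S, (g : Perm (Fin n)) x = (g' : Perm (Fin n)) x) : ρ g u = ρ g' u := by
  have h1 : ρ (g⁻¹ * g') u = u := hu (g⁻¹ * g') fun x hx => by
    change (g : Perm (Fin n))⁻¹ ((g' : Perm (Fin n)) x) = x
    rw [← h x hx]
    exact (g : Perm (Fin n)).symm_apply_apply x
  conv_lhs => rw [← h1]
  rw [← Module.End.mul_apply, ← map_mul, mul_inv_cancel_left]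

lemma exists_rot_moving {S Q : Finset (Fin n)} {u : V} (hu : AltLE S (vecFixer ρ u))
    (hS : 3 ≤ S.card) (hn : ¬ AltLE (S ∪ Q) (vecFixer ρ u)) :
    ∃ x ∈ Q, x ∉ S ∧ ∀ s ∈ S, ∀ r ∈ S, s ≠ r → ∀ t : alternatingGroup (Fin n),
      (t : Perm (Fin n)) x = s → (t : Perm (Fin n)) s = r → (t : Perm (Fin n)) r = x →
      (∀ y, y ≠ x → y ≠ s → y ≠ r → (t : Perm (Fin n)) y = y) → augOp ρ t u ≠ 0 := by
  by_contra! hcon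
  apply hn
  clear hn
  induction Q using Finset.induction_on with
  | empty => simpa using hu
  | insert x Q hx ih =>
    have ih' := ih fun y hy => hcon y (Finset.mem_insert_of_mem hy)
    by_cases hxS : x ∈ S
    · rwa [Finset.union_insert, Finset.insert_eq_of_mem (Finset.mem_union_left _ hxS)]
    obtain ⟨s, hs, r, hr, hsr, t, hts, htr, htx, ht, h0⟩ := hcon x (Finset.mem_insert_self _ _) hxS
    rw [Finset.union_insert]
    refine ih'.insert (hS.trans (Finset.card_le_card Finset.subset_union_left)) t ?_ ?_ ?_
    · rw [augOp_apply, sub_eq_zero] at h0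
      exact h0.symm
    · intro y hy
      simp only [Finset.mem_insert, Finset.mem_union, not_or] at hy
      exact ht y hy.1 (fun h => hy.2.1 (h ▸ hs)) fun h => hy.2.1 (h ▸ hr)
    · rw [hts]
      rintro rfl
      exact hxS hs

/-- Vectors `w a b` indexed by pairs of points which behave like nonzero differences
`e a - e b`. -/
structure IsDifferenceSystem (ρ : Representation F (alternatingGroup (Fin n)) V)
    (w : Fin n → Fin n → V) : Prop where
  map : ∀ g a b, ρ g (w a b) = w ((g : Perm (Fin n)) a) ((g : Perm (Fin n)) b)
  add : ∀ a b e, w a b + w b e = w a e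
  ne_zero : ∀ a b, a ≠ b → w a b ≠ 0

open Classical in
theorem exists_isDifferenceSystem (hn : 10 ≤ n) (hL : LevelOne ρ) {Q : Finset (Fin n)}
    (hQ : Q.card ≤ 4) (c : alternatingGroup (Fin n)) (hc : (orderOf c : F) ≠ 0)
    (hcQ : ∀ x ∉ Q, (c : Perm (Fin n)) x = x) {v : V} (hv : augOp ρ c v ≠ 0) :
    ∃ w, IsDifferenceSystem ρ w := by
  set u := augOp ρ c v with hu_def
  have hQc : 6 ≤ Qᶜ.card := by
    rw [Finset.card_compl, Fintype.card_fin]; omega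
  have hu : AltLE Qᶜ (vecFixer ρ u) := fun g hg =>
    rangeFixer_le ρ _ v (hL Q c (by omega) hcQ g hg)
  have hnot : ¬ AltLE (Qᶜ ∪ Q) (vecFixer ρ u) := by
    intro h
    exact hv (eq_zero_of_fixed_augOp ρ hc v (h c fun x hx => by simp at hx))
  obtain ⟨x, hxQ, hxQc, hx⟩ := exists_rot_moving hu (by omega) hnot
  obtain ⟨s, hs, r, hr, hsr⟩ := Finset.one_lt_card.1 (by omega : 1 < Qᶜ.card)
  have hne : ∀ {y z : Fin n}, y ∈ Q → z ∈ Qᶜ → y ≠ z := fun hy hz h =>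
    Finset.mem_compl.1 hz (h ▸ hy)
  obtain ⟨t, hts, htr, htx, ht⟩ := exists_rot (hne hxQ hs) (hne hxQ hr) hsr
  set w₀ := augOp ρ t u with hw₀_def
  have hw₀ : w₀ ≠ 0 := hx s hs r hr hsr t hts htr htx ht
  have hfix : AltLE {x, s}ᶜ (vecFixer ρ w₀) := by
    have key : ∀ r ∈ Qᶜ, s ≠ r → AltLE {x, s, r}ᶜ (vecFixer ρ w₀) := by
      intro r' hr' hsr'
      obtain ⟨t', hts', htr', htx', ht'⟩ := exists_rot (hne hxQ hs) (hne hxQ hr') hsr'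
      have : w₀ = augOp ρ t' u := by
        rw [hw₀_def, augOp_apply, augOp_apply, apply_eq_of_agree hu t t']
        intro y hy
        rw [Finset.mem_compl, not_not] at hy
        by_cases hyx : y = x
        · rw [hyx, hts, hts']
        · rw [ht y hyx (hne hy hs) (hne hy hr), ht' y hyx (hne hy hs) (hne hy hr')]
      rw [this]
      intro g hg
      refine rangeFixer_le ρ _ u (hL {x, s, r'} t' ?_ ?_ g hg)
      · have := Finset.card_le_three (a := x) (b := s) (c := r')
        rw [Finset.card_compl, Fintype.card_fin]; omega
      · intro y hy
        simp only [Finset.mem_insert, Finset.mem_singleton, not_or] at hy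
        exact ht' y hy.1 hy.2.1 hy.2.2
    obtain ⟨r', hr', hrr'⟩ : ∃ r' ∈ Qᶜ, r' ∉ ({s, r} : Finset (Fin n)) := by
      have := Finset.card_le_two (a := s) (b := r)
      exact Finset.exists_mem_notMem_of_card_lt_card (by omega)
    simp only [Finset.mem_insert, Finset.mem_singleton, not_or] at hrr'
    have h3 := Finset.card_le_three (a := x) (b := s) (c := r)
    have h4 := Finset.card_le_four (a := x) (b := s) (c := r) (d := r')
    have := (key r hr hsr).union (key r' hr' (Ne.symm hrr'.1)) (by
      have : ({x, s, r}ᶜ ∩ {x, s, r'}ᶜ : Finset (Fin n)) = ({x, s, r, r'} : Finset (Fin n))ᶜ := by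
        ext y; simp; tauto
      rw [this, Finset.card_compl, Fintype.card_fin]; omega)
      (by rw [Finset.card_compl, Fintype.card_fin]; omega)
    refine this.mono fun y hy => ?_
    simp only [Finset.mem_compl, Finset.mem_insert, Finset.mem_singleton, Finset.mem_union,
      not_or] at hy ⊢
    by_cases hyr : y = r
    · right; exact ⟨hy.1, hy.2, fun h => hrr'.2 (h.symm.trans hyr)⟩
    · left; exact ⟨hy.1, hy.2, hyr⟩
  have hex : ∀ a b : Fin n, a ≠ b → ∃ g : alternatingGroup (Fin n),
      (g : Perm (Fin n)) x = a ∧ (g : Perm (Fin n)) s = b := by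
    intro a b hab
    obtain ⟨g, -, hg⟩ := exists_alt_map Finset.univ ![x, s] ![a, b]
      (by rw [Function.Injective]; simp [Fin.forall_fin_two, hne hxQ hs, (hne hxQ hs).symm])
      (by rw [Function.Injective]; simp [Fin.forall_fin_two, hab, hab.symm])
      (by simp) (by simp) (by simp; omega)
    exact ⟨g, hg 0, hg 1⟩
  choose! γ hγx hγs using hex
  let w : Fin n → Fin n → V := fun a b => if a = b then 0 else ρ (γ a b) w₀
  have hw : ∀ g : alternatingGroup (Fin n), ∀ a b, (g : Perm (Fin n)) x = a →
      (g : Perm (Fin n)) s = b → w a b = ρ g w₀ := by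
    rintro g _ _ rfl rfl
    have : (g : Perm (Fin n)) x ≠ (g : Perm (Fin n)) s := fun h =>
      hne hxQ hs ((g : Perm (Fin n)).injective h)
    simp only [w, if_neg this]
    refine apply_eq_of_agree hfix _ _ fun y hy => ?_
    simp only [Finset.mem_compl, Finset.mem_insert, Finset.mem_singleton, not_not] at hy
    rcases hy with rfl | rfl
    · exact hγx _ _ this
    · exact hγs _ _ this
  have hmap : ∀ g a b, ρ g (w a b) = w ((g : Perm (Fin n)) a) ((g : Perm (Fin n)) b) := by
    intro g a b
    by_cases hab : a = b
    · simp [w, hab]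
    · have : w a b = ρ (γ a b) w₀ := by simp [w, hab]
      rw [this, ← Module.End.mul_apply, ← map_mul]
      refine (hw _ _ _ ?_ ?_).symm
      · change (g : Perm (Fin n)) ((γ a b : Perm (Fin n)) x) = _
        rw [hγx a b hab]
      · change (g : Perm (Fin n)) ((γ a b : Perm (Fin n)) s) = _
        rw [hγs a b hab]
  have h0 : w x s + w s r = w x r := by
    obtain ⟨g, hgQ, hg⟩ := exists_alt_apply_eq Qᶜ (by omega) hs hr
    have hg' : ∀ y ∈ Q, (g : Perm (Fin n)) y = y := fun y hy => hgQ y (by simpa using hy)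
    rw [hw 1 x s rfl rfl, hw t s r hts htr, hw g x r (hg' x hxQ) hg, hw₀_def, augOp_apply]
    have h1 : ρ g u = u := hu g hgQ
    have h2 : ρ (g * t) u = ρ (t * t) u := by
      refine apply_eq_of_agree hu _ _ fun y hy => ?_
      rw [Finset.mem_compl, not_not] at hy
      change (g : Perm (Fin n)) ((t : Perm (Fin n)) y) =
        (t : Perm (Fin n)) ((t : Perm (Fin n)) y)
      by_cases hyx : y = x
      · rw [hyx, hts, hg, htr]
      · rw [ht y hyx (hne hy hs) (hne hy hr), hg' y hy, ht y hyx (hne hy hs) (hne hy hr)]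
    rw [map_mul, map_mul, Module.End.mul_apply, Module.End.mul_apply] at h2
    rw [map_sub, map_sub, map_sub, h1, h2, map_one]
    simp
  have h3 : ∀ a b e : Fin n, a ≠ b → a ≠ e → b ≠ e → w a b + w b e = w a e := by
    intro a b e hab hae hbe
    have hxr := hne hxQ hr
    have hxs := hne hxQ hs
    obtain ⟨g, -, hg⟩ := exists_alt_map Finset.univ ![x, s, r] ![a, b, e]
      (by rw [Function.Injective]; simp [Fin.forall_fin_succ, hxr, hxs, hsr, hxr.symm, hxs.symm,
        hsr.symm])
      (by rw [Function.Injective]; simp [Fin.forall_fin_succ, hab, hae, hbe, hab.symm, hae.symm,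
        hbe.symm])
      (by simp) (by simp) (by simp; omega)
    have e1 : (g : Perm (Fin n)) x = a := hg 0
    have e2 : (g : Perm (Fin n)) s = b := hg 1
    have e3 : (g : Perm (Fin n)) r = e := hg 2
    have := congrArg (ρ g) h0
    rwa [map_add, hmap, hmap, hmap, e1, e2, e3] at this
  have hself : ∀ a, w a a = 0 := fun a => by simp [w]
  refine ⟨w, hmap, fun a b e => ?_, fun a b hab => ?_⟩
  · by_cases hab : a = b
    · rw [hab, hself, zero_add]
    by_cases hbe : b = e
    · rw [hbe, hself, add_zero]
    by_cases hae : a = e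
    · subst hae
      obtain ⟨z, -, hz⟩ : ∃ z ∈ Finset.univ, z ∉ ({a, b} : Finset (Fin n)) := by
        have := Finset.card_le_two (a := a) (b := b)
        exact Finset.exists_mem_notMem_of_card_lt_card (by simp; omega)
      simp only [Finset.mem_insert, Finset.mem_singleton, not_or] at hz
      have e1 := h3 a b z hab (Ne.symm hz.1) (Ne.symm hz.2)
      have e2 := h3 b a z hbe (Ne.symm hz.2) (Ne.symm hz.1)
      rw [hself, ← sub_eq_zero.2 e1, ← e2]
      abel
    · exact h3 a b e hab hae hbe
  · rw [hw (γ a b) a b (hγx a b hab) (hγs a b hab)]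
    intro h
    apply hw₀
    rw [← Module.End.one_apply (R := F) w₀, ← map_one ρ, ← inv_mul_cancel (γ a b), map_mul,
      Module.End.mul_apply, h, map_zero]

end DifferenceSystem
end AltRestriction

namespace AltRestriction
open Equiv

section
variable {F V : Type*} [Field F] [AddCommGroup V] [Module F V] {n : ℕ}
  {ρ : Representation F (alternatingGroup (Fin n)) V} {w : Fin n → Fin n → V}

/-- The map from functions to `V` attached to a difference system and a base point. -/
def differenceMap (w : Fin n → Fin n → V) (o : Fin n) : (Fin n → F) →ₗ[F] V :=
  ∑ a, (LinearMap.toSpanSingleton F V (w a o)) ∘ₗ (LinearMap.proj a)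

lemma differenceMap_apply (o : Fin n) (s : Fin n → F) :
    differenceMap w o s = ∑ a, s a • w a o := by
  simp [differenceMap]

namespace IsDifferenceSystem
variable (hw : IsDifferenceSystem ρ w)
include hw

lemma self (a : Fin n) : w a a = 0 := by simpa using hw.add a a a

lemma differenceMap_base (o o' : Fin n) (s : Fin n → F) (hs : ∑ a, s a = 0) :
    differenceMap w o s = differenceMap w o' s := by
  rw [← sub_eq_zero, differenceMap_apply, differenceMap_apply, ← Finset.sum_sub_distrib]
  have : ∀ a, s a • w a o - s a • w a o' = s a • w o' o := fun a => by
    rw [← smul_sub, ← hw.add a o' o, add_sub_cancel_left]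
  rw [Finset.sum_congr rfl fun a _ => this a, ← Finset.sum_smul, hs, zero_smul]

lemma map_differenceMap (o : Fin n) (g : alternatingGroup (Fin n)) (s : Fin n → F)
    (hs : ∑ a, s a = 0) :
    ρ g (differenceMap w o s) = differenceMap w o (s ∘ (g : Perm (Fin n)).symm) := by
  have hs' : ∑ a, (s ∘ (g : Perm (Fin n)).symm) a = 0 := by
    rw [← hs]; exact Equiv.sum_comp (g : Perm (Fin n)).symm s
  rw [hw.differenceMap_base o ((g : Perm (Fin n)) o) _ hs', differenceMap_apply,
    differenceMap_apply, map_sum]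
  refine Eq.trans ?_ (Equiv.sum_comp (g : Perm (Fin n)) _)
  exact Finset.sum_congr rfl fun a _ => by simp [hw.map]

lemma const_of_differenceMap_eq_zero (hn : 5 ≤ n) (o : Fin n) (s : Fin n → F)
    (hs : ∑ a, s a = 0) (h : differenceMap w o s = 0) (x z : Fin n) : s x = s z := by
  by_contra hxz
  have hne : x ≠ z := fun h => hxz (congrArg s h)
  obtain ⟨y, -, hy⟩ : ∃ y ∈ Finset.univ, y ∉ ({x, z} : Finset (Fin n)) := by
    have := Finset.card_le_two (a := x) (b := z)
    exact Finset.exists_mem_notMem_of_card_lt_card (by simp; omega)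
  obtain ⟨z', -, hz'⟩ : ∃ z' ∈ Finset.univ, z' ∉ ({x, y, z} : Finset (Fin n)) := by
    have := Finset.card_le_three (a := x) (b := y) (c := z)
    exact Finset.exists_mem_notMem_of_card_lt_card (by simp; omega)
  simp only [Finset.mem_insert, Finset.mem_singleton, not_or] at hy hz'
  obtain ⟨t, hxy', hyz', hzx', ht⟩ := exists_rot (Ne.symm hy.1) hne hy.2
  have hsum : ∑ a, s a • w a ((t : Perm (Fin n)) a) = 0 := by
    have h1 : ρ t (differenceMap w o s) = 0 := by rw [h, map_zero]
    rw [differenceMap_apply, map_sum] at h1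
    have h2 : ∀ a, s a • w a ((t : Perm (Fin n)) a) =
        s a • w a o + s a • w o ((t : Perm (Fin n)) o) - ρ t (s a • w a o) := fun a => by
      rw [map_smul, hw.map, ← smul_add, ← smul_sub, hw.add,
        ← hw.add a ((t : Perm (Fin n)) a) ((t : Perm (Fin n)) o), add_sub_cancel_right]
    rw [Finset.sum_congr rfl fun a _ => h2 a, Finset.sum_sub_distrib, Finset.sum_add_distrib,
      ← Finset.sum_smul, hs, h1, ← differenceMap_apply, h]
    simp
  have h3 : s x • w x y + s y • w y z + s z • w z x = 0 := by
    rw [← hsum, ← Finset.sum_subset (Finset.subset_univ {x, y, z}), Finset.sum_insert,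
      Finset.sum_insert, Finset.sum_singleton, hxy', hyz', hzx', add_assoc]
    · simpa using hy.2
    · simpa using ⟨Ne.symm hy.1, hne⟩
    · intro a _ ha
      simp only [Finset.mem_insert, Finset.mem_singleton, not_or] at ha
      rw [ht a ha.1 ha.2.1 ha.2.2, hw.self, smul_zero]
  have h4 : w z x = - w x y - w y z := by
    have e1 := hw.add x y z
    have e2 := hw.add x z x
    rw [hw.self, ← e1] at e2
    rw [eq_sub_iff_add_eq, eq_neg_iff_add_eq_zero, ← e2]
    abel
  have h5 : (s x - s z) • w x y = (s z - s y) • w y z := by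
    rw [h4, smul_sub, smul_neg] at h3
    rw [sub_smul, sub_smul, ← sub_eq_zero, ← h3]
    abel
  obtain ⟨g, -, hg⟩ := exists_alt_map Finset.univ ![x, y, z] ![x, y, z']
      (by rw [Function.Injective]; simp [Fin.forall_fin_succ, hy.1, hy.2, hne, hne.symm,
        Ne.symm hy.1, Ne.symm hy.2])
      (by rw [Function.Injective]; simp [Fin.forall_fin_succ, hy.1, Ne.symm hy.1, hz'.1, hz'.2.1,
        Ne.symm hz'.1, Ne.symm hz'.2.1])
      (by simp) (by simp) (by simp; omega)
  have e1 : (g : Perm (Fin n)) x = x := hg 0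
  have e2 : (g : Perm (Fin n)) y = y := hg 1
  have e3 : (g : Perm (Fin n)) z = z' := hg 2
  have h6 := congrArg (ρ g) h5
  rw [map_smul, map_smul, hw.map, hw.map, e1, e2, e3, h5, ← sub_eq_zero, ← smul_sub] at h6
  have h7 : w y z - w y z' = w z' z := by rw [← hw.add y z' z, add_sub_cancel_left]
  rw [h7, smul_eq_zero] at h6
  have h8 := h6.resolve_right (hw.ne_zero _ _ hz'.2.2)
  rw [h8, zero_smul, smul_eq_zero] at h5
  exact h5.elim (fun h => hxz (sub_eq_zero.1 h)) (hw.ne_zero _ _ (Ne.symm hy.1))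

/-- The space affords a difference system only if its dimension is at least `n - 2`. -/
theorem le_finrank [FiniteDimensional F V] (hn : 5 ≤ n) : n ≤ Module.finrank F V + 2 := by
  let o : Fin n := ⟨0, by omega⟩
  let o' : Fin n := ⟨1, by omega⟩
  have hoo : o' ≠ o := by simp [o, o']
  let K : Submodule F (Fin n → F) :=
    LinearMap.ker (LinearMap.proj (R := F) (φ := fun _ : Fin n => F) o) ⊓
      LinearMap.ker (LinearMap.proj (R := F) (φ := fun _ : Fin n => F) o')
  have hinj : Function.Injective ((differenceMap (F := F) w o).domRestrict K) := by
    rw [injective_iff_map_eq_zero]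
    rintro ⟨s, hs1, hs2⟩ h
    have hs1 : s o = 0 := hs1
    have hs2 : s o' = 0 := hs2
    have h : differenceMap w o s = 0 := h
    let s' : Fin n → F := Function.update s o (-∑ a, s a)
    have hs' : ∑ a, s' a = 0 := by
      rw [Finset.sum_update_of_mem (Finset.mem_univ _), ← Finset.sum_erase_add _ _ (Finset.mem_univ o),
        hs1]
      simp [Finset.sdiff_singleton_eq_erase]
    have h' : differenceMap w o s' = 0 := by
      rw [← h, differenceMap_apply, differenceMap_apply]
      refine Finset.sum_congr rfl fun a _ => ?_
      by_cases ha : a = o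
      · rw [ha, hw.self, smul_zero, smul_zero]
      · simp [s', ha]
    have hc := hw.const_of_differenceMap_eq_zero hn o s' hs' h'
    ext a
    by_cases ha : a = o
    · rw [ha]; exact hs1
    · have := hc a o'
      simp only [s', Function.update_of_ne ha, Function.update_of_ne hoo, hs2] at this
      exact this
  have h1 := LinearMap.finrank_le_finrank_of_injective hinj
  have h2 : Module.finrank F (Fin n → F) ≤ Module.finrank F K + 2 := by
    have e1 := LinearMap.finrank_range_add_finrank_ker
      ((LinearMap.proj (R := F) (φ := fun _ : Fin n => F) o).prod
        (LinearMap.proj (R := F) (φ := fun _ : Fin n => F) o'))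
    rw [LinearMap.ker_prod] at e1
    have e2 := Submodule.finrank_le (LinearMap.range
      ((LinearMap.proj (R := F) (φ := fun _ : Fin n => F) o).prod
        (LinearMap.proj (R := F) (φ := fun _ : Fin n => F) o')))
    rw [Module.finrank_prod, Module.finrank_self] at e2
    change _ ≤ Module.finrank F K + 2
    change _ + Module.finrank F K = _ at e1
    omega
  rw [Module.finrank_fin_fun] at h2
  omega

end IsDifferenceSystem
end
end AltRestriction

namespace AltRestriction
open Equiv

section
variable {F V : Type*} [Field F] [AddCommGroup V] [Module F V] {n : ℕ}
  {ρ : Representation F (alternatingGroup (Fin n)) V} {w : Fin n → Fin n → V}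

lemma exists_notMem_three (hn : 5 ≤ n) (x y z : Fin n) :
    ∃ t : Fin n, t ≠ x ∧ t ≠ y ∧ t ≠ z := by
  obtain ⟨t, -, ht⟩ : ∃ t ∈ Finset.univ, t ∉ ({x, y, z} : Finset (Fin n)) := by
    have := Finset.card_le_three (a := x) (b := y) (c := z)
    exact Finset.exists_mem_notMem_of_card_lt_card (by simp; omega)
  exact ⟨t, by simpa using ht⟩

/-- A transitive perfect group is two-transitive as soon as the orbital relation of a pair of points
is constant modulo differences. -/
theorem two_transitive_of_orbital {G : Type*} [Group G] (hn : 5 ≤ n)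
    (φ : G →* alternatingGroup (Fin n))
    (htrans : ∀ a b, ∃ g, (φ g : Perm (Fin n)) a = b) (hχ : ∀ χ : G →* ℤˣ, χ = 1)
    (R : Fin n → Fin n → Prop)
    (hinv : ∀ g x y, R ((φ g : Perm (Fin n)) x) ((φ g : Perm (Fin n)) y) ↔ R x y)
    (h : ∀ x y z z', x ≠ y → z ≠ x → z ≠ y → z' ≠ x → z' ≠ y →
      ((R x z ↔ R y z) ↔ (R x z' ↔ R y z'))) (hR : ∃ x y, x ≠ y ∧ R x y) :
    ∀ x z, x ≠ z → R x z := by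
  classical
  let E : Fin n → Fin n → Prop := fun x y => ∀ z, z ≠ x → z ≠ y → (R x z ↔ R y z)
  have hE : ∀ x y z, z ≠ x → z ≠ y → (E x y ↔ (R x z ↔ R y z)) := by
    intro x y z hx hy
    refine ⟨fun h => h z hx hy, fun h1 z' hx' hy' => ?_⟩
    by_cases hxy : x = y
    · rw [hxy]
    · exact (h x y z z' hxy hx hy hx' hy').1 h1
  have hE3 : ∀ x y z, E x z ↔ (E x y ↔ E y z) := by
    intro x y z
    obtain ⟨t, h1, h2, h3⟩ := exists_notMem_three hn x y z
    rw [hE x z t h1 h3, hE x y t h1 h2, hE y z t h2 h3]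
    tauto
  have hEinv : ∀ g x y, E ((φ g : Perm (Fin n)) x) ((φ g : Perm (Fin n)) y) ↔ E x y := by
    intro g x y
    obtain ⟨t, h1, h2, -⟩ := exists_notMem_three hn x y y
    rw [hE x y t h1 h2, hE _ _ ((φ g : Perm (Fin n)) t) (by simpa using h1) (by simpa using h2),
      hinv, hinv]
  obtain ⟨a, b, hab, hRab⟩ := hR
  let χ : G →* ℤˣ :=
    { toFun := fun g => if E a ((φ g : Perm (Fin n)) a) then 1 else -1
      map_one' := by
        rw [map_one, if_pos]
        exact fun z _ _ => Iff.rfl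
      map_mul' := by
        intro g k
        have h1 : E a ((φ (g * k) : Perm (Fin n)) a) ↔
            (E a ((φ g : Perm (Fin n)) a) ↔ E a ((φ k : Perm (Fin n)) a)) := by
          rw [hE3 a ((φ g : Perm (Fin n)) a), map_mul,
            ← hEinv g a ((φ k : Perm (Fin n)) a)]
          exact Iff.rfl
        change (if E a ((φ (g * k) : Perm (Fin n)) a) then (1 : ℤˣ) else -1) =
          (if E a ((φ g : Perm (Fin n)) a) then (1 : ℤˣ) else -1) *
            (if E a ((φ k : Perm (Fin n)) a) then (1 : ℤˣ) else -1)
        rw [if_congr h1 rfl rfl]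
        by_cases h2 : E a ((φ g : Perm (Fin n)) a) <;>
          by_cases h3 : E a ((φ k : Perm (Fin n)) a) <;> simp [h2, h3] }
  have hall : ∀ x, E a x := by
    intro x
    obtain ⟨g, rfl⟩ := htrans a x
    have h1 : χ g = 1 := by rw [hχ χ]; rfl
    by_contra hn
    change (if E a ((φ g : Perm (Fin n)) a) then (1 : ℤˣ) else -1) = 1 at h1
    rw [if_neg hn] at h1
    exact absurd h1 (by decide)
  intro x z hxz
  obtain ⟨g, hg⟩ := htrans b z
  have h1 : R ((φ g : Perm (Fin n)) a) z := by rw [← hg, hinv]; exact hRab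
  have h2 : z ≠ (φ g : Perm (Fin n)) a := by
    rw [← hg]
    intro h
    exact hab ((φ g : Perm (Fin n)).injective h).symm
  have h3 : E x ((φ g : Perm (Fin n)) a) := by
    rw [hE3 x a]
    have h4 : E x a := by
      have h5 : E x x := fun _ _ _ => Iff.rfl
      exact ((hE3 x a x).1 h5).2 (hall x)
    exact ⟨fun _ => hall _, fun _ => h4⟩
  exact (h3 z hxz.symm h2).2 h1

open Classical in
theorem IsDifferenceSystem.two_transitive [IsAlgClosed F] [FiniteDimensional F V]
    (hw : IsDifferenceSystem ρ w) (hn : 5 ≤ n)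
    {G : Type*} [Group G] (φ : G →* alternatingGroup (Fin n))
    (hirr : RepIrreducible (ρ.comp φ))
    (htrans : ∀ a b, ∃ g, (φ g : Perm (Fin n)) a = b) (hχ : ∀ χ : G →* ℤˣ, χ = 1)
    (a b : Fin n) (hab : a ≠ b) :
    ∀ x z, x ≠ z → ∃ g, (φ g : Perm (Fin n)) a = x ∧ (φ g : Perm (Fin n)) b = z := by
  let R : Fin n → Fin n → Prop :=
    fun x z => ∃ g, (φ g : Perm (Fin n)) a = x ∧ (φ g : Perm (Fin n)) b = z
  have hinv' : ∀ g x y, R x y → R ((φ g : Perm (Fin n)) x) ((φ g : Perm (Fin n)) y) := by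
    rintro g x y ⟨k, rfl, rfl⟩
    exact ⟨g * k, by rw [map_mul]; rfl, by rw [map_mul]; rfl⟩
  have hinv : ∀ g x y, R ((φ g : Perm (Fin n)) x) ((φ g : Perm (Fin n)) y) ↔ R x y := by
    intro g x y
    refine ⟨fun h => ?_, hinv' g x y⟩
    have := hinv' g⁻¹ _ _ h
    rw [map_inv] at this
    simpa using this
  let r : Fin n → Fin n → F := fun x y => if R x y then 1 else 0
  have hr : ∀ g x y, r ((φ g : Perm (Fin n)) x) ((φ g : Perm (Fin n)) y) = r x y := fun g x y => by
    simp only [r, hinv]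
  have hcol : ∀ x, ∑ y, r x y = ∑ y, r a y := by
    intro x
    obtain ⟨g, rfl⟩ := htrans a x
    rw [← Equiv.sum_comp (φ g : Perm (Fin n))]
    simp only [hr]
  have hrow : ∀ y, ∑ x, r x y = ∑ x, r x a := by
    intro x
    obtain ⟨g, rfl⟩ := htrans a x
    rw [← Equiv.sum_comp (φ g : Perm (Fin n))]
    simp only [hr]
  let M : (Fin n → F) →ₗ[F] (Fin n → F) := Matrix.mulVecLin (Matrix.of fun y x => r x y)
  have hM : ∀ s y, M s y = ∑ x, r x y * s x := fun s y => rfl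
  let σ : (Fin n → F) →ₗ[F] F := ∑ i, LinearMap.proj i
  have hσ : ∀ s, σ s = ∑ i, s i := fun s => by simp [σ]
  let Z := LinearMap.ker σ
  have hZ : ∀ s, s ∈ Z ↔ ∑ i, s i = 0 := fun s => by rw [LinearMap.mem_ker, hσ]
  have hMZ : ∀ s ∈ Z, M s ∈ Z := by
    intro s hs
    rw [hZ] at hs ⊢
    simp only [hM]
    rw [Finset.sum_comm]
    simp only [← Finset.sum_mul, hcol]
    rw [← Finset.mul_sum, hs, mul_zero]
  have hMg : ∀ g s, M (s ∘ (φ g : Perm (Fin n)).symm) = M s ∘ (φ g : Perm (Fin n)).symm := by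
    intro g s
    ext y
    obtain ⟨y, rfl⟩ := (φ g : Perm (Fin n)).surjective y
    rw [Function.comp_apply, Equiv.symm_apply_apply, hM, hM, ← Equiv.sum_comp (φ g : Perm (Fin n))]
    simp only [hr, Function.comp_apply, Equiv.symm_apply_apply]
  have hgZ : ∀ g s, s ∈ Z → s ∘ (φ g : Perm (Fin n)).symm ∈ Z := by
    intro g s hs
    rw [hZ] at hs ⊢
    rw [← hs]
    exact Equiv.sum_comp (φ g : Perm (Fin n)).symm s
  let D : (Fin n → F) →ₗ[F] V := differenceMap w a
  let S : Z →ₗ[F] V := D.domRestrict Z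
  let T : Z →ₗ[F] V := (D ∘ₗ M).domRestrict Z
  have hDg : ∀ g s, s ∈ Z → ρ (φ g) (D s) = D (s ∘ (φ g : Perm (Fin n)).symm) := fun g s hs =>
    hw.map_differenceMap a (φ g) s ((hZ s).1 hs)
  have hsing : ∀ x y : Fin n, (Pi.single x 1 - Pi.single y 1 : Fin n → F) ∈ Z := fun x y => by
    rw [hZ]; simp
  have hS : Function.Surjective S := by
    rw [← LinearMap.range_eq_top]
    refine (hirr.2 (LinearMap.range S) ?_).resolve_left ?_
    · rintro g _ ⟨⟨s, hs⟩, rfl⟩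
      exact ⟨⟨_, hgZ g s hs⟩, (hDg g s hs).symm⟩
    · intro h
      have h1 : S ⟨_, hsing b a⟩ = 0 := by
        rw [← Submodule.mem_bot F, ← h]
        exact LinearMap.mem_range_self _ _
      have h2 : S ⟨_, hsing b a⟩ = w b a := by
        change differenceMap w a (Pi.single b 1 - Pi.single a 1 : Fin n → F) = _
        rw [map_sub, differenceMap_apply, differenceMap_apply]
        simp [Pi.single_apply, hw.self]
      exact hw.ne_zero b a hab.symm (h2 ▸ h1)
  obtain ⟨f, hf⟩ := exists_factor S hS T (by
    rintro ⟨s, hs⟩ (h : D s = 0)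
    change D (M s) = 0
    have hc := hw.const_of_differenceMap_eq_zero hn a s ((hZ s).1 hs) h
    have h1 : s = s a • 1 := by
      ext x
      simp [hc x a]
    have h2 : M s = (∑ x, r x a) • s := by
      ext y
      rw [hM, ← hrow y, Pi.smul_apply, smul_eq_mul, Finset.sum_mul]
      exact Finset.sum_congr rfl fun x _ => by rw [hc x y]
    rw [h2, map_smul, h, smul_zero])
  obtain ⟨κ, hκ⟩ := hirr.schur f (by
    intro g v
    obtain ⟨⟨s, hs⟩, rfl⟩ := hS v
    have h1 : (ρ.comp φ) g (S ⟨s, hs⟩) = S ⟨_, hgZ g s hs⟩ := hDg g s hs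
    rw [h1, hf, hf]
    change D (M (s ∘ (φ g : Perm (Fin n)).symm)) = ρ (φ g) (D (M s))
    rw [hMg, hDg g _ (hMZ s hs)])
  have hconst : ∀ s ∈ Z, ∀ z z', M s z - κ * s z = M s z' - κ * s z' := by
    intro s hs z z'
    have h1 : D (M s - κ • s) = 0 := by
      rw [map_sub, map_smul]
      have h2 := hf ⟨s, hs⟩
      rw [hκ] at h2
      rw [sub_eq_zero]
      exact h2.symm
    exact hw.const_of_differenceMap_eq_zero hn a _ ((hZ _).1 (Z.sub_mem (hMZ s hs)
      (Z.smul_mem _ hs))) h1 z z'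
  refine two_transitive_of_orbital hn φ htrans hχ R hinv ?_ ⟨a, b, hab, 1, by simp, by simp⟩
  intro x y z z' hxy hzx hzy hzx' hzy'
  have h1 := hconst _ (hsing x y) z z'
  have h2 : ∀ t, M (Pi.single x 1 - Pi.single y 1) t = r x t - r y t := fun t => by
    rw [map_sub, Pi.sub_apply, hM, hM]
    simp [Pi.single_apply]
  simp only [h2, Pi.sub_apply, Pi.single_apply, if_neg hzx, if_neg hzy, if_neg hzx',
    if_neg hzy', sub_zero, mul_zero] at h1
  have h3 : ∀ t, (R x t ↔ R y t) ↔ r x t - r y t = 0 := by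
    intro t
    by_cases h4 : R x t <;> by_cases h5 : R y t <;> simp [r, h4, h5]
  rw [h3, h3, h1]

end
end AltRestriction

namespace AltRestriction
open Equiv

section
variable {F V : Type*} [Field F] [AddCommGroup V] [Module F V] {n : ℕ}
  {ρ : Representation F (alternatingGroup (Fin n)) V}

/-- Vectors indexed by quadruples of points behaving like `(e a - e b) ⊗ (e a' - e b')`. -/
structure IsDoubleDifferenceSystem (ρ : Representation F (alternatingGroup (Fin n)) V)
    (W : Fin n → Fin n → Fin n → Fin n → V) : Prop where
  map : ∀ (g : alternatingGroup (Fin n)) a b a' b', ρ g (W a b a' b') =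
    W ((g : Perm (Fin n)) a) ((g : Perm (Fin n)) b) ((g : Perm (Fin n)) a') ((g : Perm (Fin n)) b')
  add_left : ∀ a b e a' b', a ∉ ({a', b'} : Finset (Fin n)) → b ∉ ({a', b'} : Finset (Fin n)) →
    e ∉ ({a', b'} : Finset (Fin n)) → W a b a' b' + W b e a' b' = W a e a' b'
  add_right : ∀ a b a' b' e', a' ∉ ({a, b} : Finset (Fin n)) → b' ∉ ({a, b} : Finset (Fin n)) →
    e' ∉ ({a, b} : Finset (Fin n)) → W a b a' b' + W a b b' e' = W a b a' e'
  ne_zero : ∀ a b a' b', Function.Injective ![a, b, a', b'] → W a b a' b' ≠ 0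

lemma injective_four {α : Type*} {a b c d : α} :
    Function.Injective ![a, b, c, d] ↔
      a ≠ b ∧ a ≠ c ∧ a ≠ d ∧ b ≠ c ∧ b ≠ d ∧ c ≠ d := by
  rw [← List.nodup_ofFn]
  simp [List.ofFn_succ]
  tauto

lemma injective_five {α : Type*} {a b c d e : α} :
    Function.Injective ![a, b, c, d, e] ↔ (a ≠ b ∧ a ≠ c ∧ a ≠ d ∧ a ≠ e) ∧
      (b ≠ c ∧ b ≠ d ∧ b ≠ e) ∧ (c ≠ d ∧ c ≠ e) ∧ d ≠ e := by
  rw [← List.nodup_ofFn]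
  simp [List.ofFn_succ]

lemma additive_of_distinct (hn : 5 ≤ n) (p : Finset (Fin n)) (hp : p.card ≤ 2)
    (f : Fin n → Fin n → V) (h0 : ∀ a, f a a = 0)
    (h : ∀ a b e, a ∉ p → b ∉ p → e ∉ p → a ≠ b → a ≠ e → b ≠ e → f a b + f b e = f a e)
    (a b e : Fin n) (ha : a ∉ p) (hb : b ∉ p) (he : e ∉ p) : f a b + f b e = f a e := by
  by_cases hab : a = b
  · rw [hab, h0, zero_add]
  by_cases hbe : b = e
  · rw [hbe, h0, add_zero]
  by_cases hae : a = e
  · subst hae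
    obtain ⟨z, -, hz⟩ : ∃ z ∈ Finset.univ, z ∉ p ∪ {a, b} := by
      have := Finset.card_le_two (a := a) (b := b)
      have := Finset.card_union_le p {a, b}
      exact Finset.exists_mem_notMem_of_card_lt_card (by
        rw [Finset.card_univ, Fintype.card_fin]; omega)
    simp only [Finset.mem_union, Finset.mem_insert, Finset.mem_singleton, not_or] at hz
    have e1 := h a b z ha hb hz.1 hab (Ne.symm hz.2.1) (Ne.symm hz.2.2)
    have e2 := h b a z hb ha hz.1 hbe (Ne.symm hz.2.2) (Ne.symm hz.2.1)
    rw [h0, ← sub_eq_zero.2 e1, ← e2]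
    abel
  · exact h a b e ha hb he hab hae hbe

open Classical in
theorem IsDoubleDifferenceSystem.of_base (hn : 7 ≤ n) (w₀ : V) (x s x' s' r r' : Fin n)
    (hinj : Function.Injective ![x, s, x', s', r]) (hinj' : Function.Injective ![x, s, x', s', r'])
    (hfix : AltLE {x, s, x', s'}ᶜ (vecFixer ρ w₀)) (h0 : w₀ ≠ 0)
    (h1 : ∃ g g' : alternatingGroup (Fin n),
      ((g : Perm (Fin n)) x = s ∧ (g : Perm (Fin n)) s = r ∧ (g : Perm (Fin n)) x' = x' ∧
        (g : Perm (Fin n)) s' = s') ∧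
      ((g' : Perm (Fin n)) x = x ∧ (g' : Perm (Fin n)) s = r ∧ (g' : Perm (Fin n)) x' = x' ∧
        (g' : Perm (Fin n)) s' = s') ∧ w₀ + ρ g w₀ = ρ g' w₀)
    (h2 : ∃ g g' : alternatingGroup (Fin n),
      ((g : Perm (Fin n)) x = x ∧ (g : Perm (Fin n)) s = s ∧ (g : Perm (Fin n)) x' = s' ∧
        (g : Perm (Fin n)) s' = r') ∧
      ((g' : Perm (Fin n)) x = x ∧ (g' : Perm (Fin n)) s = s ∧ (g' : Perm (Fin n)) x' = x' ∧
        (g' : Perm (Fin n)) s' = r') ∧ w₀ + ρ g w₀ = ρ g' w₀) :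
    ∃ W, IsDoubleDifferenceSystem ρ W := by
  have hinj4 : Function.Injective ![x, s, x', s'] := by
    rw [injective_four]; rw [injective_five] at hinj; tauto
  have hex : ∀ a b a' b' : Fin n, Function.Injective ![a, b, a', b'] →
      ∃ g : alternatingGroup (Fin n), (g : Perm (Fin n)) x = a ∧ (g : Perm (Fin n)) s = b ∧
        (g : Perm (Fin n)) x' = a' ∧ (g : Perm (Fin n)) s' = b' := by
    intro a b a' b' hab
    obtain ⟨g, -, hg⟩ := exists_alt_map Finset.univ ![x, s, x', s'] ![a, b, a', b']
      hinj4 hab (by simp) (by simp) (by simp; omega)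
    exact ⟨g, hg 0, hg 1, hg 2, hg 3⟩
  choose! γ hγ1 hγ2 hγ3 hγ4 using hex
  let W : Fin n → Fin n → Fin n → Fin n → V := fun a b a' b' =>
    if Function.Injective ![a, b, a', b'] then ρ (γ a b a' b') w₀ else 0
  have hinjg : ∀ (g : alternatingGroup (Fin n)) (a b a' b' : Fin n),
      Function.Injective ![(g : Perm (Fin n)) a, (g : Perm (Fin n)) b, (g : Perm (Fin n)) a',
        (g : Perm (Fin n)) b'] ↔ Function.Injective ![a, b, a', b'] := by
    intro g a b a' b'
    simp only [injective_four, ne_eq, EmbeddingLike.apply_eq_iff_eq]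
  have hW : ∀ g : alternatingGroup (Fin n), W ((g : Perm (Fin n)) x) ((g : Perm (Fin n)) s)
      ((g : Perm (Fin n)) x') ((g : Perm (Fin n)) s') = ρ g w₀ := by
    intro g
    have := (hinjg g _ _ _ _).2 hinj4
    simp only [W, if_pos this]
    refine apply_eq_of_agree hfix _ _ fun y hy => ?_
    simp only [Finset.mem_compl, Finset.mem_insert, Finset.mem_singleton, not_not] at hy
    rcases hy with rfl | rfl | rfl | rfl
    · exact hγ1 _ _ _ _ this
    · exact hγ2 _ _ _ _ this
    · exact hγ3 _ _ _ _ this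
    · exact hγ4 _ _ _ _ this
  have hmap : ∀ (g : alternatingGroup (Fin n)) a b a' b', ρ g (W a b a' b') =
      W ((g : Perm (Fin n)) a) ((g : Perm (Fin n)) b) ((g : Perm (Fin n)) a')
        ((g : Perm (Fin n)) b') := by
    intro g a b a' b'
    by_cases hab : Function.Injective ![a, b, a', b']
    · have : W a b a' b' = ρ (γ a b a' b') w₀ := by simp only [W, if_pos hab]
      rw [this, ← Module.End.mul_apply, ← map_mul, ← hW]
      change W ((g : Perm (Fin n)) ((γ a b a' b' : Perm (Fin n)) x))
        ((g : Perm (Fin n)) ((γ a b a' b' : Perm (Fin n)) s))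
        ((g : Perm (Fin n)) ((γ a b a' b' : Perm (Fin n)) x'))
        ((g : Perm (Fin n)) ((γ a b a' b' : Perm (Fin n)) s')) = _
      rw [hγ1 _ _ _ _ hab, hγ2 _ _ _ _ hab, hγ3 _ _ _ _ hab, hγ4 _ _ _ _ hab]
    · simp only [W, if_neg hab, if_neg (mt (hinjg g a b a' b').1 hab), map_zero]
  have hW1 : W x s x' s' = w₀ := by simpa using hW 1
  have hex5 : ∀ (y z : Fin 5 → Fin n), Function.Injective y → Function.Injective z →
      ∃ g : alternatingGroup (Fin n), ∀ i, (g : Perm (Fin n)) (y i) = z i := by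
    intro y z hy hz
    obtain ⟨g, -, hg⟩ := exists_alt_map Finset.univ y z hy hz (by simp) (by simp) (by simp; omega)
    exact ⟨g, hg⟩
  refine ⟨W, hmap, ?_, ?_, ?_⟩
  · intro a b e a' b' ha hb he
    by_cases hab' : a' = b'
    · have : ∀ a b, W a b a' b' = 0 := fun a b => by
        simp only [W, injective_four, hab']
        simp
      simp [this]
    refine additive_of_distinct (by omega) {a', b'} Finset.card_le_two (fun a b => W a b a' b')
      (fun a => by simp [W, injective_four]) ?_ a b e ha hb he
    intro a b e ha hb he hab hae hbe
    simp only [Finset.mem_insert, Finset.mem_singleton, not_or] at ha hb he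
    obtain ⟨h, hh⟩ := hex5 _ ![a, b, a', b', e] hinj (by
      rw [injective_five]
      exact ⟨⟨hab, ha.1, ha.2, hae⟩, ⟨hb.1, hb.2, hbe⟩, ⟨hab', Ne.symm he.1⟩, Ne.symm he.2⟩)
    have k0 : (h : Perm (Fin n)) x = a := hh 0
    have k1 : (h : Perm (Fin n)) s = b := hh 1
    have k2 : (h : Perm (Fin n)) x' = a' := hh 2
    have k3 : (h : Perm (Fin n)) s' = b' := hh 3
    have k4 : (h : Perm (Fin n)) r = e := hh 4
    obtain ⟨g, g', ⟨e1, e2, e3, e4⟩, ⟨f1, f2, f3, f4⟩, heq⟩ := h1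
    have := congrArg (ρ h) heq
    rwa [map_add, ← hW g, ← hW g', ← hW1, hmap, hmap, hmap, e1, e2, e3, e4, f1, f2, f3, f4,
      k0, k1, k2, k3, k4] at this
  · intro a b a' b' e' ha hb he
    by_cases hab' : a = b
    · have : ∀ a' b', W a b a' b' = 0 := fun a' b' => by
        simp only [W, injective_four, hab']
        simp
      simp [this]
    refine additive_of_distinct (by omega) {a, b} Finset.card_le_two (fun a' b' => W a b a' b')
      (fun a => by simp [W, injective_four]) ?_ a' b' e' ha hb he
    intro a' b' e' ha hb he hab hae hbe
    simp only [Finset.mem_insert, Finset.mem_singleton, not_or] at ha hb he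
    obtain ⟨h, hh⟩ := hex5 _ ![a, b, a', b', e'] hinj' (by
      rw [injective_five]
      exact ⟨⟨hab', Ne.symm ha.1, Ne.symm hb.1, Ne.symm he.1⟩,
        ⟨Ne.symm ha.2, Ne.symm hb.2, Ne.symm he.2⟩, ⟨hab, hae⟩, hbe⟩)
    have k0 : (h : Perm (Fin n)) x = a := hh 0
    have k1 : (h : Perm (Fin n)) s = b := hh 1
    have k2 : (h : Perm (Fin n)) x' = a' := hh 2
    have k3 : (h : Perm (Fin n)) s' = b' := hh 3
    have k4 : (h : Perm (Fin n)) r' = e' := hh 4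
    obtain ⟨g, g', ⟨e1, e2, e3, e4⟩, ⟨f1, f2, f3, f4⟩, heq⟩ := h2
    have := congrArg (ρ h) heq
    rwa [map_add, ← hW g, ← hW g', ← hW1, hmap, hmap, hmap, e1, e2, e3, e4, f1, f2, f3, f4,
      k0, k1, k2, k3, k4] at this
  · intro a b a' b' hab
    simp only [W, if_pos hab]
    intro h
    apply h0
    rw [← Module.End.one_apply (R := F) w₀, ← map_one ρ, ← inv_mul_cancel (γ a b a' b'), map_mul,
      Module.End.mul_apply, h, map_zero]

end
end AltRestriction

namespace AltRestriction
open Equiv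

section
variable {F V : Type*} [Field F] [AddCommGroup V] [Module F V] {n : ℕ}
  {ρ : Representation F (alternatingGroup (Fin n)) V}

lemma augOp_congr {S : Finset (Fin n)} {u : V} (hu : AltLE S (vecFixer ρ u))
    (g g' : alternatingGroup (Fin n))
    (h : ∀ x ∉ S, (g : Perm (Fin n)) x = (g' : Perm (Fin n)) x) : augOp ρ g u = augOp ρ g' u := by
  rw [augOp_apply, augOp_apply, apply_eq_of_agree hu g g' h]

lemma cocycle_of_agree {S : Finset (Fin n)} {u : V} (hu : AltLE S (vecFixer ρ u))
    (t g : alternatingGroup (Fin n)) (hg : ∀ x ∉ S, (g : Perm (Fin n)) x = x)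
    (h : ∀ x ∉ S, (g : Perm (Fin n)) ((t : Perm (Fin n)) x) =
      (t : Perm (Fin n)) ((t : Perm (Fin n)) x)) :
    augOp ρ t u + ρ t (augOp ρ t u) = ρ g (augOp ρ t u) := by
  have h1 : ρ g u = u := hu g hg
  have h2 : ρ (g * t) u = ρ (t * t) u := apply_eq_of_agree hu _ _ h
  rw [map_mul, map_mul, Module.End.mul_apply, Module.End.mul_apply] at h2
  rw [augOp_apply, map_sub, map_sub, h1, h2]
  abel

lemma augOp_comm_apply {g h : alternatingGroup (Fin n)} (hgh : Commute g h) (v : V) :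
    augOp ρ g (augOp ρ h v) = augOp ρ h (augOp ρ g v) :=
  LinearMap.congr_fun (augOp_commute ρ hgh).eq v

lemma apply_augOp_comm {g h : alternatingGroup (Fin n)} (hgh : Commute g h) (v : V) :
    ρ g (augOp ρ h v) = augOp ρ h (ρ g v) := by
  rw [augOp_apply, augOp_apply, map_sub, ← Module.End.mul_apply, ← Module.End.mul_apply, ← map_mul,
    ← map_mul, hgh.eq]

open Classical in
theorem exists_isDoubleDifferenceSystem (hn : 24 ≤ n) (hL : LevelTwo ρ) {Q Q' : Finset (Fin n)}
    (hQ : Q.card ≤ 4) (hQ' : Q'.card ≤ 4) (hQQ' : Disjoint Q Q')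
    (c d : alternatingGroup (Fin n)) (hc : (orderOf c : F) ≠ 0) (hd : (orderOf d : F) ≠ 0)
    (hcQ : ∀ x ∉ Q, (c : Perm (Fin n)) x = x) (hdQ : ∀ x ∉ Q', (d : Perm (Fin n)) x = x) {v : V}
    (hv : augOp ρ d (augOp ρ c v) ≠ 0) :
    ∃ W, IsDoubleDifferenceSystem ρ W := by
  have hcd : Commute d c := alt_commute Q' hdQ fun z hz => hcQ z fun h =>
    Finset.disjoint_left.1 hQQ' h hz
  set u := augOp ρ d (augOp ρ c v) with hu_def
  set S := (Q ∪ Q')ᶜ with hS_def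
  have hScard : 16 ≤ S.card := by
    have := Finset.card_union_le Q Q'
    rw [Finset.card_compl, Fintype.card_fin]; omega
  have hQS : ∀ {y z}, y ∈ Q → z ∈ S → y ≠ z := by
    rintro y _ hy hz rfl
    exact Finset.mem_compl.1 hz (Finset.mem_union_left _ hy)
  have hQS' : ∀ {y z}, y ∈ Q' → z ∈ S → y ≠ z := by
    rintro y _ hy hz rfl
    exact Finset.mem_compl.1 hz (Finset.mem_union_right _ hy)
  have hQ2 : ∀ {y z}, y ∈ Q → z ∈ Q' → y ≠ z := by
    rintro y _ hy hz rfl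
    exact Finset.disjoint_left.1 hQQ' hy hz
  have hu : AltLE S (vecFixer ρ u) := fun g hg =>
    rangeFixer_le ρ (augOp ρ d * augOp ρ c) v (hL Q Q' c d hQ hQ' hQQ' hcQ hdQ g hg)
  have hnot : ¬ AltLE (S ∪ Q') (vecFixer ρ u) := fun h =>
    hv (eq_zero_of_fixed_augOp ρ hd (augOp ρ c v) (h d fun x hx => hdQ x fun hx' =>
      hx (Finset.mem_union_right _ hx')))
  obtain ⟨x', hx'Q, -, hx'⟩ := exists_rot_moving hu (by omega) hnot
  obtain ⟨p, hpS, hpcard⟩ := Finset.exists_subset_card_eq (by omega : 6 ≤ S.card)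
  obtain ⟨f⟩ : Nonempty (Fin 6 ≃ p) := ⟨(Finset.equivFinOfCardEq hpcard).symm⟩
  have hfS : ∀ i, (f i : Fin n) ∈ S := fun i => hpS (f i).2
  have hfne : ∀ i j, i ≠ j → (f i : Fin n) ≠ f j := fun i j hij h =>
    hij (f.injective (Subtype.ext h))
  obtain ⟨s, hs_def⟩ : ∃ s, s = (f 0 : Fin n) := ⟨_, rfl⟩
  obtain ⟨s', hs'_def⟩ : ∃ s, s = (f 1 : Fin n) := ⟨_, rfl⟩
  obtain ⟨r, hr_def⟩ : ∃ s, s = (f 2 : Fin n) := ⟨_, rfl⟩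
  obtain ⟨r', hr'_def⟩ : ∃ s, s = (f 3 : Fin n) := ⟨_, rfl⟩
  obtain ⟨r₂, hr₂_def⟩ : ∃ s, s = (f 4 : Fin n) := ⟨_, rfl⟩
  obtain ⟨r₂', hr₂'_def⟩ : ∃ s, s = (f 5 : Fin n) := ⟨_, rfl⟩
  have hs : s ∈ S := hs_def ▸ hfS _
  have hs' : s' ∈ S := hs'_def ▸ hfS _
  have hr : r ∈ S := hr_def ▸ hfS _
  have hr' : r' ∈ S := hr'_def ▸ hfS _
  have hr₂ : r₂ ∈ S := hr₂_def ▸ hfS _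
  have hr₂' : r₂' ∈ S := hr₂'_def ▸ hfS _
  have hss' : s ≠ s' := by rw [hs_def, hs'_def]; exact hfne _ _ (by decide)
  have hsr : s ≠ r := by rw [hs_def, hr_def]; exact hfne _ _ (by decide)
  have hsr' : s ≠ r' := by rw [hs_def, hr'_def]; exact hfne _ _ (by decide)
  have hsr₂ : s ≠ r₂ := by rw [hs_def, hr₂_def]; exact hfne _ _ (by decide)
  have hsr₂' : s ≠ r₂' := by rw [hs_def, hr₂'_def]; exact hfne _ _ (by decide)
  have hs'r : s' ≠ r := by rw [hs'_def, hr_def]; exact hfne _ _ (by decide)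
  have hsr₁ : s' ≠ r' := by rw [hs'_def, hr'_def]; exact hfne _ _ (by decide)
  have hs'r₂ : s' ≠ r₂ := by rw [hs'_def, hr₂_def]; exact hfne _ _ (by decide)
  have hs'r₂' : s' ≠ r₂' := by rw [hs'_def, hr₂'_def]; exact hfne _ _ (by decide)
  have hrr' : r ≠ r' := by rw [hr_def, hr'_def]; exact hfne _ _ (by decide)
  have hrr₂ : r ≠ r₂ := by rw [hr_def, hr₂_def]; exact hfne _ _ (by decide)
  have hrr₂' : r ≠ r₂' := by rw [hr_def, hr₂'_def]; exact hfne _ _ (by decide)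
  have hr'r₂ : r' ≠ r₂ := by rw [hr'_def, hr₂_def]; exact hfne _ _ (by decide)
  have hr'r₂' : r' ≠ r₂' := by rw [hr'_def, hr₂'_def]; exact hfne _ _ (by decide)
  have hr₂r₂' : r₂ ≠ r₂' := by rw [hr₂_def, hr₂'_def]; exact hfne _ _ (by decide)
  clear hs_def hs'_def hr_def hr'_def hr₂_def hr₂'_def
  obtain ⟨τ, hτ1, hτ2, hτ3, hτ⟩ := exists_rot (hQS' hx'Q hs') (hQS' hx'Q hr') hsr₁
  set y := augOp ρ τ u with hy_def
  have hy0 : y ≠ 0 := hx' s' hs' r' hr' hsr₁ τ hτ1 hτ2 hτ3 hτ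
  have hyτ : ∀ ζ ∈ S, s' ≠ ζ → ∀ t : alternatingGroup (Fin n), (t : Perm (Fin n)) x' = s' →
      (∀ z, z ≠ x' → z ≠ s' → z ≠ ζ → (t : Perm (Fin n)) z = z) → y = augOp ρ t u := by
    intro ζ hζ hsζ t ht1 ht
    refine augOp_congr hu _ _ fun z hz => ?_
    have h1 : ∀ w ∈ S, z ≠ w := fun w hw h => hz (h ▸ hw)
    by_cases hzx : z = x'
    · rw [hzx, hτ1, ht1]
    · rw [hτ z hzx (h1 _ hs') (h1 _ hr'), ht z hzx (h1 _ hs') (h1 _ hζ)]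
  have hyfix : ∀ ζ ∈ S, s' ≠ ζ → AltLE (Q ∪ {x', s', ζ})ᶜ (vecFixer ρ y) := by
    intro ζ hζ hsζ
    obtain ⟨t, ht1, ht2, ht3, ht⟩ := exists_rot (hQS' hx'Q hs') (hQS' hx'Q hζ) hsζ
    rw [hyτ ζ hζ hsζ t ht1 ht, hu_def, augOp_comm_apply hcd]
    intro g hg
    refine rangeFixer_le ρ (augOp ρ t * augOp ρ c) (augOp ρ d v)
      (hL Q {x', s', ζ} c t hQ (Finset.card_le_three.trans (by omega)) ?_ hcQ ?_ g hg)
    · rw [Finset.disjoint_left]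
      intro z hz
      simp only [Finset.mem_insert, Finset.mem_singleton, not_or]
      exact ⟨hQ2 hz hx'Q, hQS hz hs', hQS hz hζ⟩
    · intro z hz
      simp only [Finset.mem_insert, Finset.mem_singleton, not_or] at hz
      exact ht z hz.1 hz.2.1 hz.2.2
  set S₂ := (Q ∪ {x', s'})ᶜ with hS₂_def
  have hcQx : ∀ A : Finset (Fin n), A.card ≤ 4 → (Q ∪ A).card ≤ 8 := fun A hA =>
    (Finset.card_union_le _ _).trans (by omega)
  have hS₂card : 16 ≤ S₂.card := by
    have := hcQx {x', s'} (Finset.card_le_two.trans (by omega))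
    rw [Finset.card_compl, Fintype.card_fin]; omega
  have hy : AltLE S₂ (vecFixer ρ y) := by
    have h4 := hcQx {x', s', r, r'} Finset.card_le_four
    have h3 := hcQx {x', s', r} (Finset.card_le_three.trans (by omega))
    refine ((hyfix r hr hs'r).union (hyfix r' hr' hsr₁) ?_ ?_).mono ?_
    · have : ((Q ∪ {x', s', r})ᶜ ∩ (Q ∪ {x', s', r'})ᶜ : Finset (Fin n)) =
          (Q ∪ {x', s', r, r'} : Finset (Fin n))ᶜ := by
        ext y; simp; tauto
      rw [this, Finset.card_compl, Fintype.card_fin]; omega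
    · rw [Finset.card_compl, Fintype.card_fin]; omega
    · intro z hz
      simp only [S₂, Finset.mem_compl, Finset.mem_insert, Finset.mem_singleton, Finset.mem_union,
        not_or] at hz ⊢
      by_cases hzr : z = r
      · right; exact ⟨hz.1, hz.2.1, hz.2.2, hzr ▸ hrr'⟩
      · left; exact ⟨hz.1, hz.2.1, hz.2.2, hzr⟩
  have hcτ : Commute τ c := (alt_commute Q hcQ fun z hz =>
    hτ z (hQ2 hz hx'Q) (hQS hz hs') (hQS hz hr')).symm
  have hnot2 : ¬ AltLE (S₂ ∪ Q) (vecFixer ρ y) := by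
    intro h
    have h1 : y = augOp ρ c (augOp ρ τ (augOp ρ d v)) := by
      rw [hy_def, hu_def, augOp_comm_apply hcd, augOp_comm_apply hcτ]
    have h2 : ρ c y = y := h c fun x hx => hcQ x fun hx' => hx (Finset.mem_union_right _ hx')
    rw [h1] at h2
    exact hy0 (h1.trans (eq_zero_of_fixed_augOp ρ hc _ h2))
  obtain ⟨x, hxQ, -, hx⟩ := exists_rot_moving hy (by omega) hnot2
  have hxx' : x ≠ x' := hQ2 hxQ hx'Q
  have hmemS₂ : ∀ {z}, z ∈ S → z ≠ s' → z ∈ S₂ := by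
    intro z hz hzs
    simp only [S₂, Finset.mem_compl, Finset.mem_union, Finset.mem_insert, Finset.mem_singleton,
      not_or]
    exact ⟨fun h => hQS h hz rfl, (hQS' hx'Q hz).symm, hzs⟩
  have hnotS₂ : ∀ z ∉ S₂, z ∈ Q ∨ z = x' ∨ z = s' := fun z hz => by
    simpa [S₂, or_iff_not_imp_left] using hz
  obtain ⟨σ, hσ1, hσ2, hσ3, hσ⟩ := exists_rot (hQS hxQ hs) (hQS hxQ hr) hsr
  set w₀ := augOp ρ σ y with hw₀_def
  have hw₀ : w₀ ≠ 0 := hx s (hmemS₂ hs hss') r (hmemS₂ hr hs'r.symm) hsr σ hσ1 hσ2 hσ3 hσ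
  have hfix : ∀ ζ ∈ S, ∀ ζ' ∈ S, s ≠ ζ → s' ≠ ζ → s ≠ ζ' → s' ≠ ζ' → ζ ≠ ζ' →
      AltLE ({x', s', ζ'} ∪ {x, s, ζ})ᶜ (vecFixer ρ w₀) := by
    intro ζ hζ ζ' hζ' h1 h2 h3 h4 h5
    obtain ⟨t', ht1', ht2', ht3', ht'⟩ := exists_rot (hQS' hx'Q hs') (hQS' hx'Q hζ') h4
    obtain ⟨t, ht1, ht2, ht3, ht⟩ := exists_rot (hQS hxQ hs) (hQS hxQ hζ) h1
    have e : w₀ = (augOp ρ t * augOp ρ t') u := by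
      rw [Module.End.mul_apply, ← hyτ ζ' hζ' h4 t' ht1' ht']
      refine augOp_congr hy _ _ fun z hz => ?_
      have h6 : ∀ w, w ∈ S → w ≠ s' → z ≠ w := fun w hw hws h => hz (h ▸ hmemS₂ hw hws)
      by_cases hzx : z = x
      · rw [hzx, hσ1, ht1]
      · rw [hσ z hzx (h6 _ hs hss') (h6 _ hr hs'r.symm), ht z hzx (h6 _ hs hss') (h6 _ hζ h2.symm)]
    rw [e]
    intro g hg
    refine rangeFixer_le ρ _ u (hL {x', s', ζ'} {x, s, ζ} t' t
      (Finset.card_le_three.trans (by omega)) (Finset.card_le_three.trans (by omega)) ?_ ?_ ?_ g hg)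
    · rw [Finset.disjoint_left]
      intro z hz
      simp only [Finset.mem_insert, Finset.mem_singleton, not_or] at hz ⊢
      rcases hz with rfl | rfl | rfl
      · exact ⟨hxx'.symm, hQS' hx'Q hs, hQS' hx'Q hζ⟩
      · exact ⟨(hQS hxQ hs').symm, hss'.symm, h2⟩
      · exact ⟨(hQS hxQ hζ').symm, h3.symm, h5.symm⟩
    · intro z hz
      simp only [Finset.mem_insert, Finset.mem_singleton, not_or] at hz
      exact ht' z hz.1 hz.2.1 hz.2.2
    · intro z hz
      simp only [Finset.mem_insert, Finset.mem_singleton, not_or] at hz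
      exact ht z hz.1 hz.2.1 hz.2.2
  have hfix4 : AltLE {x, s, x', s'}ᶜ (vecFixer ρ w₀) := by
    have hc1 : ∀ A B : Finset (Fin n), A.card ≤ 4 → B.card ≤ 4 → 16 ≤ (A ∪ B)ᶜ.card := by
      intro A B hA hB
      have := Finset.card_union_le A B
      rw [Finset.card_compl, Fintype.card_fin]; omega
    refine ((hfix r hr r' hr' hsr hs'r hsr' hsr₁ hrr').union
      (hfix r₂ hr₂ r₂' hr₂' hsr₂ hs'r₂ hsr₂' hs'r₂' hr₂r₂') ?_ ?_).mono ?_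
    · have : (({x', s', r'} ∪ {x, s, r})ᶜ ∩ ({x', s', r₂'} ∪ {x, s, r₂})ᶜ : Finset (Fin n)) =
          ({x', s', r', r₂'} ∪ {x, s, r, r₂} : Finset (Fin n))ᶜ := by
        ext y; simp; tauto
      rw [this]
      have := hc1 {x', s', r', r₂'} {x, s, r, r₂} Finset.card_le_four Finset.card_le_four
      omega
    · have := hc1 {x', s', r'} {x, s, r} (Finset.card_le_three.trans (by omega))
        (Finset.card_le_three.trans (by omega))
      omega
    · intro z hz
      simp only [Finset.mem_compl, Finset.mem_insert, Finset.mem_singleton, Finset.mem_union,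
        not_or] at hz ⊢
      by_cases hzr : z = r
      · right; rw [hzr] at hz ⊢; tauto
      by_cases hzr' : z = r'
      · right; rw [hzr'] at hz ⊢; tauto
      · left; tauto
  have hστ : Commute σ τ := alt_commute {x, s, r} (fun z hz => by
      simp only [Finset.mem_insert, Finset.mem_singleton, not_or] at hz
      exact hσ z hz.1 hz.2.1 hz.2.2) (fun z hz => by
      simp only [Finset.mem_insert, Finset.mem_singleton] at hz
      rcases hz with rfl | rfl | rfl
      · exact hτ _ hxx' (hQS hxQ hs') (hQS hxQ hr')
      · exact hτ _ (hQS' hx'Q hs).symm hss' hsr'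
      · exact hτ _ (hQS' hx'Q hr).symm hs'r.symm hrr')
  refine IsDoubleDifferenceSystem.of_base (by omega) w₀ x s x' s' r r' ?_ ?_ hfix4 hw₀ ?_ ?_
  · rw [injective_five]
    exact ⟨⟨hQS hxQ hs, hxx', hQS hxQ hs', hQS hxQ hr⟩, ⟨(hQS' hx'Q hs).symm, hss', hsr⟩,
      ⟨hQS' hx'Q hs', hQS' hx'Q hr⟩, hs'r⟩
  · rw [injective_five]
    exact ⟨⟨hQS hxQ hs, hxx', hQS hxQ hs', hQS hxQ hr'⟩, ⟨(hQS' hx'Q hs).symm, hss', hsr'⟩,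
      ⟨hQS' hx'Q hs', hQS' hx'Q hr'⟩, hsr₁⟩
  · obtain ⟨g, hg1, hg⟩ := exists_alt_apply_eq S₂ (by omega) (hmemS₂ hs hss')
      (hmemS₂ hr hs'r.symm)
    have hx2 : ∀ z, z ∈ Q ∨ z = x' ∨ z = s' → z ∉ S₂ := fun z hz => by
      simpa [S₂, or_iff_not_imp_left] using hz
    refine ⟨σ, g, ⟨hσ1, hσ2, hσ _ hxx'.symm (hQS' hx'Q hs) (hQS' hx'Q hr),
      hσ _ (hQS hxQ hs').symm hss'.symm hs'r⟩,
      ⟨hg1 _ (hx2 _ (Or.inl hxQ)), hg, hg1 _ (hx2 _ (Or.inr (Or.inl rfl))),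
        hg1 _ (hx2 _ (Or.inr (Or.inr rfl)))⟩, cocycle_of_agree hy σ g hg1 fun z hz => ?_⟩
    have h6 : ∀ w, w ∈ S → w ≠ s' → z ≠ w := fun w hw hws h => hz (h ▸ hmemS₂ hw hws)
    by_cases hzx : z = x
    · rw [hzx, hσ1, hg, hσ2]
    · rw [hσ z hzx (h6 _ hs hss') (h6 _ hr hs'r.symm), hg1 z hz,
        hσ z hzx (h6 _ hs hss') (h6 _ hr hs'r.symm)]
  · have hmem : ∀ z, z ∈ S \ {s, r} ↔ z ∈ S ∧ z ≠ s ∧ z ≠ r := fun z => by simp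
    obtain ⟨g, hg1, hg⟩ := exists_alt_apply_eq (S \ {s, r}) (by
      have := Finset.le_card_sdiff {s, r} S
      have := Finset.card_le_two (a := s) (b := r)
      omega) ((hmem s').2 ⟨hs', hss'.symm, hs'r⟩) ((hmem r').2 ⟨hr', hsr'.symm, hrr'.symm⟩)
    simp only [hmem] at hg1
    have hg2 : ∀ z ∉ S, (g : Perm (Fin n)) z = z := fun z hz => hg1 z (by tauto)
    have hxg : (g : Perm (Fin n)) x = x := hg2 x fun h => hQS hxQ h rfl
    refine ⟨τ, g, ⟨hτ _ hxx' (hQS hxQ hs') (hQS hxQ hr'),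
      hτ _ (hQS' hx'Q hs).symm hss' hsr', hτ1, hτ2⟩,
      ⟨hxg, hg1 s (by tauto), hg2 x' (fun h => hQS' hx'Q h rfl), hg⟩, ?_⟩
    have hgσ : Commute g σ := (alt_commute {x, s, r} (fun z hz => by
      simp only [Finset.mem_insert, Finset.mem_singleton, not_or] at hz
      exact hσ z hz.1 hz.2.1 hz.2.2) (fun z hz => by
      simp only [Finset.mem_insert, Finset.mem_singleton] at hz
      rcases hz with rfl | rfl | rfl
      · exact hxg
      · exact hg1 _ (by tauto)
      · exact hg1 _ (by tauto))).symm
    rw [hw₀_def, apply_augOp_comm hστ.symm, apply_augOp_comm hgσ, ← map_add]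
    congr 1
    refine cocycle_of_agree hu τ g hg2 fun z hz => ?_
    have h1 : ∀ w ∈ S, z ≠ w := fun w hw h => hz (h ▸ hw)
    by_cases hzx : z = x'
    · rw [hzx, hτ1, hg, hτ2]
    · rw [hτ z hzx (h1 _ hs') (h1 _ hr'), hg2 z hz, hτ z hzx (h1 _ hs') (h1 _ hr')]

end
end AltRestriction

namespace AltRestriction
open Equiv

section
variable {F V : Type*} [Field F] [AddCommGroup V] [Module F V] {n : ℕ}
  {ρ : Representation F (alternatingGroup (Fin n)) V}

lemma exists_semiinvariant {G K : Type*} [Group G] [Group K] (ρ : Representation F G V)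
    (ψ : K →* G) (χ : K →* ℤˣ) {T : V} (hT : T ≠ 0) (h : ∀ k, χ k = 1 → ρ (ψ k) T = T) :
    ∃ v : V, v ≠ 0 ∧ ∀ k, ∃ c : F, ρ (ψ k) v = c • v := by
  have hmul : ∀ k l, ρ (ψ k) (ρ (ψ l) T) = ρ (ψ (k * l)) T := fun k l => by
    rw [map_mul, map_mul, Module.End.mul_apply]
  have hsame : ∀ k l, χ k = χ l → ρ (ψ k) T = ρ (ψ l) T := by
    intro k l hkl
    have : k = l * (l⁻¹ * k) := by group
    rw [this, ← hmul, h]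
    rw [map_mul, map_inv, hkl, inv_mul_cancel]
  by_cases htriv : ∃ s, χ s = -1
  swap
  · refine ⟨T, hT, fun k => ⟨1, ?_⟩⟩
    rw [one_smul]
    exact h k ((Int.units_eq_one_or _).resolve_right fun hk => htriv ⟨k, hk⟩)
  obtain ⟨s, hs⟩ := htriv
  have h1 : ∀ k, χ k = -1 → ρ (ψ k) T = ρ (ψ s) T := fun k hk => hsame k s (hk.trans hs.symm)
  by_cases h0 : T + ρ (ψ s) T = 0
  · refine ⟨T, hT, fun k => ?_⟩
    rcases Int.units_eq_one_or (χ k) with hk | hk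
    · exact ⟨1, by rw [one_smul, h k hk]⟩
    · exact ⟨-1, by rw [h1 k hk, neg_one_smul]; exact (neg_eq_of_add_eq_zero_right h0).symm⟩
  · refine ⟨_, h0, fun k => ⟨1, ?_⟩⟩
    rw [one_smul, map_add, hmul]
    rcases Int.units_eq_one_or (χ k) with hk | hk
    · rw [h k hk, h1 (k * s) (by rw [map_mul, hk, hs]; rfl)]
    · rw [h1 k hk, h (k * s) (by rw [map_mul, hk, hs]; rfl), add_comm]

namespace IsDoubleDifferenceSystem
variable {W : Fin n → Fin n → Fin n → Fin n → V} (hW : IsDoubleDifferenceSystem ρ W)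
include hW

lemma self_left (a a' b' : Fin n) (h1 : a ≠ a') (h2 : a ≠ b') : W a a a' b' = 0 := by
  have : a ∉ ({a', b'} : Finset (Fin n)) := by simp [h1, h2]
  simpa using hW.add_left a a a a' b' this this this

theorem sum_ne_zero {ι : Type*} [Fintype ι] (a a' : ι → Fin n)
    (ha : Function.Injective a) (ha' : Function.Injective a') (haa' : ∀ i j, a i ≠ a' j)
    (o : Fin n) (hao : ∀ i, a i ≠ o) (hao' : ∀ i, a' i ≠ o)
    (hcard : ((Fintype.card ι - 1 : ℕ) : F) ≠ 0) (hn : 2 * Fintype.card ι + 5 ≤ n) :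
    ∑ i, ∑ j, W (a i) (a j) (a' i) o ≠ 0 := by
  classical
  have hpos : 0 < Fintype.card ι := by
    rcases Nat.eq_zero_or_pos (Fintype.card ι) with h | h
    · simp [h] at hcard
    · exact h
  obtain ⟨k⟩ := Fintype.card_pos_iff.1 hpos
  set B : Finset (Fin n) := Finset.univ.image a ∪ Finset.univ.image a' ∪ {o} with hB
  have hBcard : 4 ≤ Bᶜ.card := by
    have h1 := Finset.card_image_le (s := Finset.univ) (f := a)
    have h2 := Finset.card_image_le (s := Finset.univ) (f := a')
    have h3 := Finset.card_union_le (Finset.univ.image a) (Finset.univ.image a')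
    have h4 := Finset.card_union_le (Finset.univ.image a ∪ Finset.univ.image a') {o}
    rw [Finset.card_univ] at h1 h2
    rw [Finset.card_singleton, ← hB] at h4
    rw [Finset.card_compl, Fintype.card_fin]
    omega
  obtain ⟨p, hpB, hpcard⟩ := Finset.exists_subset_card_eq hBcard
  obtain ⟨f⟩ : Nonempty (Fin 4 ≃ p) := ⟨(Finset.equivFinOfCardEq hpcard).symm⟩
  have hfne : ∀ i j, i ≠ j → (f i : Fin n) ≠ f j := fun i j hij h =>
    hij (f.injective (Subtype.ext h))
  have hfB : ∀ l, (∀ i, a i ≠ f l) ∧ (∀ i, a' i ≠ f l) ∧ o ≠ f l := by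
    intro l
    have := Finset.mem_compl.1 (hpB (f l).2)
    simp only [hB, Finset.mem_union, Finset.mem_image, Finset.mem_univ, true_and,
      Finset.mem_singleton, not_or, not_exists] at this
    exact ⟨this.1.1, this.1.2, fun h => this.2 h.symm⟩
  obtain ⟨g', hg1', hg2', hg3', hg'⟩ := exists_rot ((hfB 2).2.1 k) ((hfB 3).2.1 k)
    (hfne 2 3 (by decide))
  obtain ⟨g, hg1, hg2, hg3, hg⟩ := exists_rot ((hfB 0).1 k) ((hfB 1).1 k) (hfne 0 1 (by decide))
  have ea' : ∀ i, (g' : Perm (Fin n)) (a i) = a i := fun i =>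
    hg' _ (haa' i k) ((hfB 2).1 i) ((hfB 3).1 i)
  have ea : ∀ i, i ≠ k → (g : Perm (Fin n)) (a i) = a i := fun i hi =>
    hg _ (fun h => hi (ha h)) ((hfB 0).1 i) ((hfB 1).1 i)
  have e1 : augOp ρ g' (∑ i, ∑ j, W (a i) (a j) (a' i) o) =
      ∑ j, W (a k) (a j) (a' k) (f 2) := by
    rw [map_sum, Finset.sum_eq_single k]
    · rw [map_sum]
      refine Finset.sum_congr rfl fun j _ => ?_
      rw [augOp_apply, hW.map, ea', ea', hg1', hg' o (hao' k).symm (hfB 2).2.2 (hfB 3).2.2,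
        sub_eq_iff_eq_add]
      refine (hW.add_right _ _ _ _ _ ?_ ?_ ?_).symm <;>
        simp only [Finset.mem_insert, Finset.mem_singleton, not_or]
      · exact ⟨(haa' _ _).symm, (haa' _ _).symm⟩
      · exact ⟨((hfB 2).1 _).symm, ((hfB 2).1 _).symm⟩
      · exact ⟨(hao _).symm, (hao _).symm⟩
    · intro i _ hik
      rw [map_sum]
      refine Finset.sum_eq_zero fun j _ => ?_
      rw [augOp_apply, hW.map, ea', ea', hg' o (hao' k).symm (hfB 2).2.2 (hfB 3).2.2,
        hg' (a' i) (fun h => hik (ha' h)) ((hfB 2).2.1 i) ((hfB 3).2.1 i), sub_self]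
    · simp
  have e2 : augOp ρ g (∑ j, W (a k) (a j) (a' k) (f 2)) =
      (Fintype.card ι - 1 : ℕ) • W (a k) (f 0) (a' k) (f 2) := by
    rw [← Finset.add_sum_erase _ _ (Finset.mem_univ k),
      hW.self_left _ _ _ (haa' _ _) ((hfB 2).1 _), zero_add, map_sum,
      Finset.sum_congr rfl (g := fun _ => W (a k) (f 0) (a' k) (f 2)), Finset.sum_const,
      Finset.card_erase_of_mem (Finset.mem_univ k), Finset.card_univ]
    intro j hj
    rw [augOp_apply, hW.map, ea j (Finset.ne_of_mem_erase hj), hg1,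
      hg (a' k) (haa' _ _).symm ((hfB 0).2.1 k) ((hfB 1).2.1 k),
      hg (f 2) ((hfB 2).1 k).symm (hfne 2 0 (by decide)) (hfne 2 1 (by decide)), sub_eq_iff_eq_add]
    refine (hW.add_left _ _ _ _ _ ?_ ?_ ?_).symm <;>
      simp only [Finset.mem_insert, Finset.mem_singleton, not_or]
    · exact ⟨haa' _ _, (hfB 2).1 _⟩
    · exact ⟨((hfB 0).2.1 _).symm, hfne 0 2 (by decide)⟩
    · exact ⟨haa' _ _, (hfB 2).1 _⟩
  intro h0
  rw [h0, map_zero] at e1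
  rw [← e1, map_zero, ← Nat.cast_smul_eq_nsmul F] at e2
  refine hW.ne_zero (a k) (f 0) (a' k) (f 2) ?_ ((smul_eq_zero.1 e2.symm).resolve_left hcard)
  rw [injective_four]
  exact ⟨(hfB 0).1 k, haa' k k, (hfB 2).1 k, ((hfB 0).2.1 k).symm, hfne 0 2 (by decide),
    (hfB 2).2.1 k⟩

end IsDoubleDifferenceSystem

/-- Even permutations of `J` together with odd ones corrected by the transposition `(p q)`. -/
def evenExtension {m : ℕ} (J : Finset (Fin m)) {p q : Fin m} (hpq : p ≠ q) (hp : p ∉ J)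
    (hq : q ∉ J) : Perm J →* alternatingGroup (Fin m) where
  toFun π := ⟨Perm.ofSubtype π * (if Perm.sign π = 1 then 1 else swap p q), by
    rw [Perm.mem_alternatingGroup, Perm.sign_mul, Perm.sign_ofSubtype]
    rcases Int.units_eq_one_or (Perm.sign π) with h | h
    · simp [h]
    · rw [h, if_neg (by decide), Perm.sign_swap hpq]
      rfl⟩
  map_one' := by simp
  map_mul' π π' := by
    have hc : ∀ π : Perm J, swap p q * Perm.ofSubtype π = Perm.ofSubtype π * swap p q := by
      intro π
      have h1 := swap_mul_eq_mul_swap (Perm.ofSubtype π) p q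
      rw [mul_swap_eq_swap_mul, Perm.ofSubtype_apply_of_not_mem π hp,
        Perm.ofSubtype_apply_of_not_mem π hq]
    apply Subtype.ext
    simp only [Subgroup.coe_mul, map_mul]
    rcases Int.units_eq_one_or (Perm.sign π) with h | h <;>
      rcases Int.units_eq_one_or (Perm.sign π') with h' | h' <;>
      rw [h, h']
    · simp
    · simp [show ((-1 : ℤˣ) = 1) ↔ False by decide, mul_assoc]
    · simp [show ((-1 : ℤˣ) = 1) ↔ False by decide, mul_assoc, hc]
    · simp only [show ((-1 : ℤˣ) = 1) ↔ False by decide, if_false, neg_mul_neg, mul_one, if_true]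
      rw [mul_assoc (Perm.ofSubtype π), ← mul_assoc (swap p q), hc, mul_assoc _ (swap p q),
        swap_mul_self, mul_one]

theorem IsDoubleDifferenceSystem.finrank_mul_le {m : ℕ} (hm : 2 ≤ m)
    {W : Fin n → Fin n → Fin n → Fin n → V}
    (hW : IsDoubleDifferenceSystem ρ W)
    (φ : alternatingGroup (Fin m) →* alternatingGroup (Fin n))
    (hirr : RepIrreducible (ρ.comp φ)) (P : Fin m → Fin m → Fin n)
    (hP : ∀ g i j, i ≠ j → (φ g : Perm (Fin n)) (P i j) =
      P ((g : Perm (Fin m)) i) ((g : Perm (Fin m)) j))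
    (hinj : ∀ i j k l, i ≠ j → k ≠ l → P i j = P k l → s(i, j) = s(k, l))
    (J : Finset (Fin m)) {p q : Fin m} (hpq : p ≠ q) (hp : p ∉ J) (hq : q ∉ J)
    (hJ : ((J.card - 1 : ℕ) : F) ≠ 0) (hn : 2 * J.card + 5 ≤ n) :
    Module.finrank F V * (2 * J.card.factorial) ≤ m.factorial := by
  classical
  have hpJ : ∀ i : J, p ≠ i := fun i h => hp (h ▸ i.2)
  have hqJ : ∀ i : J, q ≠ i := fun i h => hq (h ▸ i.2)
  have hT := hW.sum_ne_zero (ι := J) (fun i => P p i) (fun i => P q i)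
    (by
      intro i j h
      have := hinj _ _ _ _ (hpJ i) (hpJ j) h
      rw [Sym2.congr_right] at this
      exact Subtype.ext this)
    (by
      intro i j h
      have := hinj _ _ _ _ (hqJ i) (hqJ j) h
      rw [Sym2.congr_right] at this
      exact Subtype.ext this)
    (by
      intro i j h
      have := hinj _ _ _ _ (hpJ i) (hqJ j) h
      rw [Sym2.eq_iff] at this
      rcases this with h | h
      · exact hpq h.1
      · exact hpJ j h.1)
    (P p q)
    (by
      intro i h
      have := hinj _ _ _ _ (hpJ i) hpq h
      rw [Sym2.congr_right] at this
      exact hqJ i this.symm)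
    (by
      intro i h
      have := hinj _ _ _ _ (hqJ i) hpq h
      rw [Sym2.eq_iff] at this
      rcases this with h | h
      · exact hpq h.1.symm
      · exact hpJ i h.2.symm)
    (by rwa [Fintype.card_coe]) (by rwa [Fintype.card_coe])
  let ψ := evenExtension J hpq hp hq
  have hψ : ∀ π, Perm.sign π = 1 → (ψ π : Perm (Fin m)) = Perm.ofSubtype π := fun π hπ => by
    simp [ψ, evenExtension, hπ]
  obtain ⟨v, hv, hvψ⟩ := exists_semiinvariant (ρ.comp φ) ψ Perm.sign hT (by
    intro π hπ
    change ρ (φ (ψ π)) _ = _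
    have h1 : ∀ i : J, (ψ π : Perm (Fin m)) i = (π i : Fin m) := fun i => by
      rw [hψ π hπ, Perm.ofSubtype_apply_coe]
    have h2 : (ψ π : Perm (Fin m)) p = p := by
      rw [hψ π hπ, Perm.ofSubtype_apply_of_not_mem _ hp]
    have h3 : (ψ π : Perm (Fin m)) q = q := by
      rw [hψ π hπ, Perm.ofSubtype_apply_of_not_mem _ hq]
    simp only [map_sum, hW.map, hP _ _ _ (hpJ _), hP _ _ _ (hqJ _), hP _ _ _ hpq, h1, h2, h3]
    rw [Equiv.sum_comp π fun i => ∑ j : J, W (P p i) (P p (π j)) (P q i) (P p q)]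
    refine Finset.sum_congr rfl fun i _ => ?_
    exact Equiv.sum_comp π fun j => W (P p i) (P p j) (P q i) (P p q))
  have hle := hirr.finrank_le_index (H := ψ.range) hv (by
    rintro _ ⟨π, rfl⟩
    exact hvψ π)
  have hψinj : Function.Injective ψ := by
    intro π π' h
    ext i
    have h1 : ∀ π, (ψ π : Perm (Fin m)) i = (π i : Fin m) := by
      intro π
      change (Perm.ofSubtype π : Perm (Fin m)) ((if Perm.sign π = 1 then 1 else swap p q) _) = _
      have : (if Perm.sign π = 1 then (1 : Perm (Fin m)) else swap p q) i = i := by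
        split_ifs
        · rfl
        · exact swap_apply_of_ne_of_ne (hpJ i).symm (hqJ i).symm
      rw [this, Perm.ofSubtype_apply_coe]
    rw [← h1, ← h1, h]
  have hcard : Nat.card ψ.range = J.card.factorial := by
    rw [← Nat.card_congr (MonoidHom.ofInjective hψinj).toEquiv, Nat.card_perm,
      Nat.card_eq_fintype_card, Fintype.card_coe]
  have : Nontrivial (Fin m) := Fin.nontrivial_iff_two_le.2 hm
  have h1 := ψ.range.card_mul_index
  have h2 := two_mul_nat_card_alternatingGroup (α := Fin m)
  rw [Nat.card_perm, Nat.card_eq_fintype_card (α := Fin m), Fintype.card_fin, ← h1, hcard] at h2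
  rw [← h2]
  nlinarith

end
end AltRestriction

namespace AltRestriction
open Equiv

/-- Any ordered pair of distinct points can be moved to any other. -/
def TwoTransitive {G : Type*} [Group G] {n : ℕ} (φ : G →* alternatingGroup (Fin n)) : Prop :=
  ∀ a b x z, a ≠ b → x ≠ z → ∃ g, (φ g : Perm (Fin n)) a = x ∧ (φ g : Perm (Fin n)) b = z

section
universe u v
variable {F : Type u} {V : Type v} [Field F] [AddCommGroup V] [Module F V] {n : ℕ}
  {ρ : Representation F (alternatingGroup (Fin n)) V}
  {G : Type*} [Group G] {φ : G →* alternatingGroup (Fin n)}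

lemma altEmb_injective {B Ω : Type*} [Fintype B] [DecidableEq B] [Fintype Ω] [DecidableEq Ω]
    (x : B ↪ Ω) : Function.Injective (altEmb x) := by
  intro c c' h
  ext b
  have h1 := congrArg (fun g : alternatingGroup Ω => (g : Perm Ω) (x b)) h
  simpa using h1

lemma exists_augOp_ne_zero [Finite G] (hirr : RepIrreducible (ρ.comp φ))
    (hd : 1 < Module.finrank F V) (hn : 5 ≤ n) {b : ℕ} {c : alternatingGroup (Fin b)}
    (hc : IsBlockType F V b c) : ∃ (x : Fin b ↪ Fin n) (v : V), augOp ρ (altEmb x c) v ≠ 0 := by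
  by_contra! h
  have h1 := hc.gen Finset.univ ρ.ker (by simpa using hn) fun x _ => by
    rw [MonoidHom.mem_ker]
    ext v
    exact (sub_eq_zero.1 (h x v)).symm
  have := Module.nontrivial_of_finrank_pos (R := F) (M := V) (by omega)
  obtain ⟨v, hv⟩ := exists_ne (0 : V)
  have h2 := hirr.finrank_le_index ⊤ hv fun g _ => ⟨1, by
    have h3 : ρ (φ g) = 1 := h1 (φ g) fun x hx => absurd (Finset.mem_univ x) hx
    rw [one_smul]
    exact LinearMap.congr_fun h3 v⟩
  rw [Subgroup.index_top] at h2
  omega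

theorem LevelOne.twoTransitive [IsAlgClosed F] [FiniteDimensional F V] [Finite G]
    (hL : LevelOne ρ) (hn : 10 ≤ n) (hirr : RepIrreducible (ρ.comp φ))
    (hd : 1 < Module.finrank F V) (htrans : ∀ a b, ∃ g, (φ g : Perm (Fin n)) a = b)
    (hχ : ∀ χ : G →* ℤˣ, χ = 1) {b : ℕ} (hb : b ≤ 4) {c : alternatingGroup (Fin b)}
    (hc : IsBlockType F V b c) : TwoTransitive φ ∧ n ≤ Module.finrank F V + 2 := by
  obtain ⟨x, v, hv⟩ := exists_augOp_ne_zero hirr hd (by omega) hc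
  obtain ⟨w, hw⟩ := exists_isDifferenceSystem hn hL ((card_blockImage x).trans_le hb)
    (altEmb x c) (by rw [orderOf_injective _ (altEmb_injective x)]; exact hc.orderOf_ne)
    (altEmb_apply_of_notMem_blockImage x c) hv
  exact ⟨fun a b x z hab => hw.two_transitive (by omega) φ hirr htrans hχ a b hab x z,
    hw.le_finrank (by omega)⟩

theorem twoTransitive_of_finrank_le [IsAlgClosed F] [FiniteDimensional F V] [Finite G]
    (hn : 10 ≤ n) (hirr : RepIrreducible (ρ.comp φ))
    (hd : 1 < Module.finrank F V) (htrans : ∀ a b, ∃ g, (φ g : Perm (Fin n)) a = b)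
    (hχ : ∀ χ : G →* ℤˣ, χ = 1) (D k₃ k₄ : ℕ) (hk₃ : 2 ≤ k₃) (hk₄ : 2 ≤ k₄) (hkn₃ : k₃ * 3 ≤ n)
    (hkn₄ : k₄ * 4 ≤ n)
    (h₃ : ∀ s ∈ Finset.Icc 2 k₃, D < 2 ^ s * k₃.choose s)
    (h₄ : ∀ s ∈ Finset.Icc 2 k₄, D < 3 ^ s * k₄.choose s) (hD : Module.finrank F V ≤ D) :
    TwoTransitive φ ∧ n ≤ Module.finrank F V + 2 := by
  obtain ⟨b, c, hb, hc⟩ := exists_isBlockType F V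
  refine LevelOne.twoTransitive (levelOne_of_vanishing hc ρ (by omega) ?_) hn hirr hd
    htrans hχ (by omega) hc
  rcases hb with rfl | rfl
  · exact two_level hc ρ k₃ hk₃ hkn₃ fun s h2 hs =>
      hD.trans_lt (h₃ s (Finset.mem_Icc.2 ⟨h2, hs⟩))
  · exact two_level hc ρ k₄ hk₄ hkn₄ fun s h2 hs =>
      hD.trans_lt (h₄ s (Finset.mem_Icc.2 ⟨h2, hs⟩))

theorem twoTransitive_or_isDoubleDifferenceSystem [IsAlgClosed F] [FiniteDimensional F V]
    [Finite G] (hn : 24 ≤ n) (hirr : RepIrreducible (ρ.comp φ))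
    (hd : 1 < Module.finrank F V) (htrans : ∀ a b, ∃ g, (φ g : Perm (Fin n)) a = b)
    (hχ : ∀ χ : G →* ℤˣ, χ = 1) (D k₃ k₄ : ℕ) (hk₃ : 3 ≤ k₃) (hk₄ : 3 ≤ k₄) (hkn₃ : k₃ * 3 ≤ n)
    (hkn₄ : k₄ * 4 ≤ n)
    (h₃ : ∀ s ∈ Finset.Icc 3 k₃, D < 2 ^ s * k₃.choose s)
    (h₄ : ∀ s ∈ Finset.Icc 3 k₄, D < 3 ^ s * k₄.choose s) (hD : Module.finrank F V ≤ D) :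
    (TwoTransitive φ ∧ n ≤ Module.finrank F V + 2) ∨ ∃ W, IsDoubleDifferenceSystem ρ W := by
  obtain ⟨b, c, hb, hc⟩ := exists_isBlockType F V
  have hb4 : b ≤ 4 := by omega
  by_cases hvan : ∀ x y : Fin b ↪ Fin n, Disjoint (blockImage x) (blockImage y) →
      augOp ρ (altEmb y c) * augOp ρ (altEmb x c) = 0
  · exact Or.inl (LevelOne.twoTransitive (levelOne_of_vanishing hc ρ (by omega) hvan)
      (by omega) hirr hd htrans hχ hb4 hc)
  right
  push Not at hvan
  obtain ⟨x, y, hxy, h0⟩ := hvan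
  obtain ⟨v, hv⟩ : ∃ v, (augOp ρ (altEmb y c) * augOp ρ (altEmb x c)) v ≠ 0 := by
    by_contra! h
    exact h0 (LinearMap.ext h)
  have horder : ∀ x : Fin b ↪ Fin n, (orderOf (altEmb x c) : F) ≠ 0 := fun x => by
    rw [orderOf_injective _ (altEmb_injective x)]; exact hc.orderOf_ne
  refine exists_isDoubleDifferenceSystem hn (levelTwo_of_vanishing hc ρ hb4 (by omega) ?_)
    ((card_blockImage x).trans_le hb4) ((card_blockImage y).trans_le hb4) hxy _ _ (horder x)
    (horder y) (altEmb_apply_of_notMem_blockImage x c) (altEmb_apply_of_notMem_blockImage y c) hv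
  rcases hb with rfl | rfl
  · exact three_level hc ρ k₃ hk₃ hkn₃ fun s h2 hs =>
      hD.trans_lt (h₃ s (Finset.mem_Icc.2 ⟨h2, hs⟩))
  · exact three_level hc ρ k₄ hk₄ hkn₄ fun s h2 hs =>
      hD.trans_lt (h₄ s (Finset.mem_Icc.2 ⟨h2, hs⟩))

end
end AltRestriction

namespace AltRestriction
open Equiv MulAction
open scoped Pointwise

section
variable {G : Type*} [Group G]

lemma exists_conj_mem [Finite G] (H : Subgroup G) {p : ℕ} [hp : Fact p.Prime] (hH : ¬ p ∣ H.index) {g : G}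
    {k : ℕ} (hg : g ^ p ^ k = 1) : ∃ a, a⁻¹ * g * a ∈ H := by
  have hP : IsPGroup p (Subgroup.zpowers g) := by
    obtain ⟨j, -, hj⟩ := (Nat.dvd_prime_pow hp.out).1 (orderOf_dvd_of_pow_eq_one hg)
    exact IsPGroup.of_card (n := j) (by rw [Nat.card_zpowers, hj])
  obtain ⟨x, hx⟩ := hP.nonempty_fixed_point_of_prime_not_dvd_card (G ⧸ H) hH
  obtain ⟨a, rfl⟩ := QuotientGroup.mk_surjective x
  have h1 : ((g * a : G) : G ⧸ H) = a := hx ⟨g, Subgroup.mem_zpowers g⟩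
  refine ⟨a, ?_⟩
  rw [mul_assoc]
  exact QuotientGroup.eq.1 h1.symm

lemma index_dvd_relIndex_mul_index (H S : Subgroup G) : S.index ∣ S.relIndex H * H.index := by
  rw [← Subgroup.inf_relIndex_left, Subgroup.relIndex_mul_index inf_le_left]
  exact Subgroup.index_dvd_of_le inf_le_right

lemma exists_even_stabilizer [Finite G] {X : Type*} [Finite X] [MulAction G X] {k : ℕ}
    (hG : 2 ^ k ∣ Nat.card G) (hX : ¬ 2 ^ k ∣ Nat.card X) :
    ∃ x : X, ∃ t ∈ stabilizer G x, orderOf t = 2 := by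
  by_contra! h
  apply hX
  have := Fintype.ofFinite X
  have := Fintype.ofFinite (Quotient (orbitRel G X))
  classical
  rw [Nat.card_congr (selfEquivSigmaOrbits G X), Nat.card_sigma]
  refine Finset.dvd_sum fun x _ => ?_
  rw [Nat.card_coe_set_eq, ← index_stabilizer]
  have h1 : Nat.Coprime (2 ^ k) (Nat.card (stabilizer G x.out)) := by
    refine Nat.Coprime.pow_left _ ((Nat.Prime.coprime_iff_not_dvd Nat.prime_two).2 fun h2 => ?_)
    obtain ⟨t, ht⟩ := exists_prime_orderOf_dvd_card' 2 h2
    exact h x.out t t.2 (by rw [← ht, Subgroup.orderOf_coe])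
  rw [← (stabilizer G x.out).card_mul_index] at hG
  exact h1.dvd_of_dvd_mul_left hG

lemma index_ge_of_ne_top {B : Type*} [Fintype B] [DecidableEq B] (hB : 5 ≤ Fintype.card B)
    {K : Subgroup (alternatingGroup B)} (hK : K ≠ ⊤) : Fintype.card B ≤ K.index := by
  have : Nontrivial B := Fintype.one_lt_card_iff_nontrivial.1 (by omega)
  have hs := alternatingGroup.isSimpleGroup (α := B) (by rwa [Nat.card_eq_fintype_card])
  have hN : K.normalCore = ⊥ := (K.normalCore_normal.eq_bot_or_eq_top).resolve_right fun h =>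
    hK (top_le_iff.1 (h ▸ K.normalCore_le))
  rw [Subgroup.normalCore_eq_ker] at hN
  have h1 := Nat.card_le_card_of_injective _ ((MonoidHom.ker_eq_bot_iff _).1 hN)
  have h2 := two_mul_nat_card_alternatingGroup (α := B)
  rw [Nat.card_perm] at h1 h2
  rw [Nat.card_eq_fintype_card (α := B)] at h2
  by_contra! h
  have h3 : Nat.card (alternatingGroup B ⧸ K) ≤ Fintype.card B - 1 := by
    have : K.index = Nat.card (alternatingGroup B ⧸ K) := rfl
    omega
  have h4 := Nat.factorial_le h3
  obtain ⟨c, hc⟩ : ∃ c, Fintype.card B = c + 1 := ⟨Fintype.card B - 1, by omega⟩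
  rw [hc, Nat.add_sub_cancel] at h4
  rw [hc, Nat.factorial_succ] at h2
  have h5 := Nat.factorial_pos c
  nlinarith

end

section
variable {m : ℕ} (H : Subgroup (alternatingGroup (Fin m)))

lemma index_stabilizer_powersetCard (hm : 3 ≤ m) {a : ℕ} (s : Set.powersetCard (Fin m) a) :
    (stabilizer (alternatingGroup (Fin m)) s).index = m.choose a := by
  have := Set.powersetCard.isPretransitive_alternatingGroup (α := Fin m) (n := a) (by simpa using hm)
  rw [index_stabilizer_of_transitive, Set.powersetCard.card, Nat.card_fin]

lemma exists_invariant_of_not_isPretransitive (hH : ¬ IsPretransitive H (Fin m)) :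
    ∃ a, 1 ≤ a ∧ 2 * a ≤ m ∧ ∃ s : Set.powersetCard (Fin m) a,
      H ≤ stabilizer (alternatingGroup (Fin m)) s := by
  have key : ∀ B : Finset (Fin m), B.Nonempty → 2 * B.card ≤ m → (∀ g ∈ H, g • B = B) →
      ∃ a, 1 ≤ a ∧ 2 * a ≤ m ∧ ∃ s : Set.powersetCard (Fin m) a,
      H ≤ stabilizer (alternatingGroup (Fin m)) s := fun B hB h1 h2 =>
    ⟨B.card, hB.card_pos, h1, ⟨B, rfl⟩, fun g hg => by
      rw [mem_stabilizer_iff]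
      exact Subtype.ext (h2 g hg)⟩
  have hx : ∃ x y : Fin m, y ∉ orbit H x := by
    by_contra! h
    exact hH ⟨fun x y => h x y⟩
  obtain ⟨x, y, hxy⟩ := hx
  set B : Finset (Fin m) := (orbit H x).toFinite.toFinset with hB
  have hmem : ∀ z, z ∈ B ↔ z ∈ orbit H x := fun z => Set.Finite.mem_toFinset _
  have hsm : ∀ g ∈ H, ∀ z, g⁻¹ • z ∈ orbit H x ↔ z ∈ orbit H x := fun g hg z => by
    rw [← orbit_eq_iff, ← orbit_eq_iff (a := z), ← orbit_smul (⟨g⁻¹, inv_mem hg⟩ : H) z]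
    rfl
  have hinv : ∀ g ∈ H, g • B = B := fun g hg => by
    ext z
    rw [← Finset.inv_smul_mem_iff, hmem, hmem]
    exact hsm g hg z
  by_cases h : 2 * B.card ≤ m
  · exact key B ⟨x, (hmem x).2 (mem_orbit_self x)⟩ h hinv
  · refine key Bᶜ ⟨y, by simpa [hmem] using hxy⟩ ?_ fun g hg => ?_
    · rw [Finset.card_compl, Fintype.card_fin]; omega
    · ext z
      rw [← Finset.inv_smul_mem_iff, Finset.mem_compl, Finset.mem_compl, hmem, hmem]
      exact not_congr (hsm g hg z)

lemma le_index_of_le_stabilizer {k : ℕ} {H : Subgroup (alternatingGroup (Fin (k + 1)))}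
    (hk : 5 ≤ k) (x : Fin (k + 1)) (hH : H ≤ stabilizer (alternatingGroup (Fin (k + 1))) x)
    (hi : H.index ≠ k + 1) : (k + 1) * k ≤ H.index := by
  set S := stabilizer (alternatingGroup (Fin (k + 1))) x
  have hS : S.index = k + 1 := by
    have : IsPretransitive (alternatingGroup (Fin (k + 1))) (Fin (k + 1)) := ⟨fun a b => by
      obtain ⟨g, -, hg⟩ := exists_alt_apply_eq Finset.univ (by simp; omega) (Finset.mem_univ a)
        (Finset.mem_univ b)
      exact ⟨g, hg⟩⟩
    rw [index_stabilizer_of_transitive, Nat.card_fin]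
  have h1 := Subgroup.relIndex_mul_index hH
  set e : Fin k ↪ Fin (k + 1) := x.succAboveEmb
  have he : (altEmb e).range ≤ S := by
    rintro _ ⟨c, rfl⟩
    rw [mem_stabilizer_iff]
    exact altEmb_apply_of_notMem_blockImage e c x (by simp [blockImage, e, Fin.succAbove_ne])
  have h2 : (H.comap (altEmb e)).index ≤ H.relIndex S := by
    rw [Subgroup.index_comap]
    exact Subgroup.relIndex_le_of_le_right he Subgroup.index_ne_zero_of_finite
  have h3 : H.comap (altEmb e) ≠ ⊤ := by
    intro h
    have h5 := Nat.card_le_card_of_injective (fun c => (⟨altEmb e c, by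
      rw [← Subgroup.mem_comap, h]; trivial⟩ : H))
      fun c c' hc => altEmb_injective e (congrArg Subtype.val hc)
    have h6 := H.card_mul_index
    have : Nontrivial (Fin k) := Fin.nontrivial_iff_two_le.2 (by omega)
    have : Nontrivial (Fin (k + 1)) := Fin.nontrivial_iff_two_le.2 (by omega)
    have h7 := two_mul_nat_card_alternatingGroup (α := Fin k)
    have h8 := two_mul_nat_card_alternatingGroup (α := Fin (k + 1))
    rw [Nat.card_perm, Nat.card_fin] at h7 h8
    rw [Nat.factorial_succ] at h8
    rw [hS] at h1
    have h9 : 1 < H.relIndex S := by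
      have : H.index ≠ 0 := Subgroup.index_ne_zero_of_finite
      rcases hr : H.relIndex S with _ | _ | r
      · simp [hr] at h1; omega
      · simp [hr] at h1; omega
      · omega
    have := Nat.factorial_pos k
    rw [← h1] at h6
    nlinarith [Nat.mul_le_mul h5 h9]
  have h4 := index_ge_of_ne_top (by simpa using hk) h3
  rw [Fintype.card_fin] at h4
  rw [← h1, hS, mul_comm]
  exact Nat.mul_le_mul_right _ (h4.trans h2)

end
end AltRestriction

namespace AltRestriction
open Equiv MulAction
open scoped Pointwise

lemma isThreeCycle_commutator {α : Type*} [Fintype α] [DecidableEq α] {g h : Perm α} {x : α}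
    (hg : g x ≠ x) (hh : h x ≠ x) (hgh : ∀ y, y ≠ x → g y = y ∨ h y = y) :
    (g * h * g⁻¹ * h⁻¹).IsThreeCycle := by
  have hgm : ∀ y, g y ≠ y → y ≠ x → h y = y := fun y h1 h2 => (hgh y h2).resolve_left h1
  have hhm : ∀ y, h y ≠ y → y ≠ x → g y = y := fun y h1 h2 => (hgh y h2).resolve_right h1
  have hσ : ∀ a, (g * h * g⁻¹ * h⁻¹) (h (g a)) = g (h a) := fun a => by simp [Perm.mul_apply]
  have hne : g x ≠ h x := fun he => hh (h.injective (by
    rw [← he]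
    exact hgm _ (fun h1 => hg (g.injective h1)) hg))
  have h1 : (g * h * g⁻¹ * h⁻¹) (g x) = h x := by
    have := hσ x
    rwa [hgm _ (fun h1 => hg (g.injective h1)) hg, hhm _ (fun h1 => hh (h.injective h1)) hh] at this
  have h2 : (g * h * g⁻¹ * h⁻¹) (h x) = x := by
    obtain ⟨a, ha⟩ := g.surjective x
    have hax : a ≠ x := fun hax => hg (by rwa [hax] at ha)
    have := hσ a
    rwa [ha, hgm a (by rw [ha]; exact hax.symm) hax, ha] at this
  have h3 : (g * h * g⁻¹ * h⁻¹) x = g x := by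
    obtain ⟨b, hb⟩ := h.surjective x
    have hbx : b ≠ x := fun hbx => hh (by rwa [hbx] at hb)
    have := hσ b
    rwa [hhm b (by rw [hb]; exact hbx.symm) hbx, hb] at this
  have h4 : ∀ y, y ≠ x → y ≠ g x → y ≠ h x → (g * h * g⁻¹ * h⁻¹) y = y := by
    intro y y1 y2 y3
    obtain ⟨z, rfl⟩ := h.surjective y
    have hzx : z ≠ x := fun hz => y3 (by rw [hz])
    by_cases hz : h z = z
    · obtain ⟨w, rfl⟩ := g.surjective z
      have hwx : w ≠ x := fun h5 => y2 (by rw [hz, h5])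
      have e1 : h w = w := by
        by_cases h5 : g w = w
        · rwa [h5] at hz
        · exact hgm w h5 hwx
      rw [hσ w, e1, hz]
    · have := hσ z
      rwa [hhm z hz hzx, hhm _ (fun h5 => hz (h.injective h5)) y1] at this
  rw [← card_support_eq_three_iff]
  have : (g * h * g⁻¹ * h⁻¹).support = {x, g x, h x} := by
    ext y
    rw [Perm.mem_support, Finset.mem_insert, Finset.mem_insert, Finset.mem_singleton]
    constructor
    · intro h5
      by_contra! h6
      exact h5 (h4 y h6.1 h6.2.1 h6.2.2)
    · rintro (rfl | rfl | rfl)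
      · rwa [h3]
      · rw [h1]; exact hne.symm
      · rw [h2]; exact hh.symm
  rw [this, Finset.card_eq_three]
  exact ⟨_, _, _, hg.symm, hh.symm, hne, rfl⟩

section
variable {m : ℕ} {H : Subgroup (alternatingGroup (Fin m))}

lemma exists_isCycle_mem {p : ℕ} (hp : p.Prime) (h2 : p ≠ 2) (hpm : p ≤ m)
    (hH : ¬ p ∣ H.index) : ∃ g ∈ H, (g : Perm (Fin m)).IsCycle ∧
      (g : Perm (Fin m)).support.card = p := by
  have : Fact p.Prime := ⟨hp⟩
  obtain ⟨σ, hσ⟩ := (Perm.exists_with_cycleType_iff (Fin m) (m := {p})).2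
    ⟨by simpa using hpm, by simpa using hp.two_le⟩
  have hc : σ.IsCycle := Perm.card_cycleType_eq_one.1 (by simp [hσ])
  have hs : σ.support.card = p := by simpa [hσ] using σ.sum_cycleType.symm
  have hsign : Perm.sign σ = 1 := by
    rw [hc.sign, hs, (hp.odd_of_ne_two h2).neg_one_pow, neg_neg]
  obtain ⟨a, ha⟩ := exists_conj_mem H hH (g := ⟨σ, hsign⟩) (k := 1) (by
    rw [pow_one, ← hs, ← hc.orderOf]
    exact Subtype.ext (pow_orderOf_eq_one σ))
  have h3 : ((a⁻¹ * ⟨σ, hsign⟩ * a : alternatingGroup (Fin m)) : Perm (Fin m)).cycleType = {p} := by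
    rw [← hσ]
    simpa using Perm.cycleType_conj (σ := σ) (τ := (a : Perm (Fin m))⁻¹)
  refine ⟨_, ha, Perm.card_cycleType_eq_one.1 (by rw [h3]; simp), ?_⟩
  rw [← Perm.sum_cycleType, h3, Multiset.sum_singleton]

lemma IsBlock.card_le_one_of_isCycle_mem [IsPretransitive H (Fin m)] {B : Set (Fin m)}
    (hB : IsBlock H B) {p : ℕ} (hp : p.Prime) (hBp : B.ncard < p)
    {g : alternatingGroup (Fin m)} (hg : g ∈ H) (hc : (g : Perm (Fin m)).IsCycle)
    (hs : (g : Perm (Fin m)).support.card = p) : B.ncard ≤ 1 := by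
  by_contra! hB1
  obtain ⟨y, hy, hyc⟩ := hc
  obtain ⟨b, hb⟩ : B.Nonempty := Set.nonempty_of_ncard_ne_zero (by omega)
  obtain ⟨h, hh⟩ := exists_smul_eq H b y
  have hC := hB.translate h
  set C := h • B
  have hCcard : C.ncard = B.ncard := Set.ncard_smul_set h B
  have hyC : y ∈ C := hh ▸ Set.smul_mem_smul_set hb
  set γ : H := ⟨g, hg⟩ with hγ
  have key : γ • C ≠ C := by
    intro heq
    have h1 : ∀ i : ℤ, γ ^ i • C = C := fun i =>
      mem_stabilizer_iff.1 (zpow_mem (mem_stabilizer_iff.2 heq : γ ∈ stabilizer H C) i)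
    have h2 : ((g : Perm (Fin m)).support : Set (Fin m)) ⊆ C := by
      intro z hz
      obtain ⟨i, hi⟩ := hyc (Perm.mem_support.1 hz)
      rw [← h1 i, ← hi]
      exact ⟨y, hyC, by simp [hγ, Subgroup.smul_def, Perm.smul_def]⟩
    have := Set.ncard_le_ncard h2
    rw [Set.ncard_coe_finset] at this
    omega
  have hfix : ∀ z ∈ C, (g : Perm (Fin m)) z ≠ z := fun z hz hgz =>
    key (hC.smul_eq_of_nonempty ⟨z, ⟨z, hz, hgz⟩, hz⟩)
  obtain ⟨z, hz, hzy⟩ := Set.exists_ne_of_one_lt_ncard (hCcard ▸ hB1) y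
  obtain ⟨i, hi⟩ := Perm.SameCycle.exists_pow_eq'' (hyc (hfix z hz))
  obtain ⟨hi0, hin, hi⟩ := hi
  have ho : orderOf γ = p := by
    rw [hγ, Subgroup.orderOf_mk, ← Subgroup.orderOf_coe, Perm.IsCycle.orderOf ⟨y, hy, hyc⟩, hs]
  have hγi : γ ^ i • C = C := hC.smul_eq_of_nonempty
    ⟨z, ⟨y, hyC, by simpa [hγ, Subgroup.smul_def, Perm.smul_def] using hi⟩, hz⟩
  have hcop : i.Coprime (orderOf γ) := by
    rw [ho]
    refine ((Nat.Prime.coprime_iff_not_dvd hp).2 fun hd => hzy ?_).symm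
    rw [← hi, orderOf_dvd_iff_pow_eq_one.1 (by rwa [Perm.IsCycle.orderOf ⟨y, hy, hyc⟩, hs]),
      Perm.one_apply]
  obtain ⟨j, hj⟩ := exists_pow_eq_self_of_coprime hcop
  exact key (mem_stabilizer_iff.1 (hj ▸ pow_mem (mem_stabilizer_iff.2 hγi) j))

lemma four_dvd_card_support {t : alternatingGroup (Fin m)} (ht : orderOf t = 2) :
    4 ∣ (t : Perm (Fin m)).support.card := by
  rw [← Subgroup.orderOf_coe] at ht
  obtain ⟨k, hk⟩ := Perm.cycleType_prime_order (σ := (t : Perm (Fin m))) (by rw [ht]; exact Nat.prime_two)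
  rw [ht] at hk
  have h1 := Perm.sign_of_cycleType (t : Perm (Fin m))
  rw [Perm.mem_alternatingGroup.1 t.2, hk, ← pow_zero (-1)] at h1
  rw [← Perm.sum_cycleType, hk]
  simp only [Multiset.sum_replicate, Multiset.card_replicate, smul_eq_mul] at h1 ⊢
  have h2 : Even ((k + 1) * 2 + (k + 1)) := by
    rw [← neg_one_pow_eq_one_iff_even (R := ℤˣ) (by decide)]
    simpa using h1.symm
  obtain ⟨r, hr⟩ := h2
  omega

lemma isPreprimitive_map [IsPreprimitive H (Fin m)] :
    IsPreprimitive (H.map (alternatingGroup (Fin m)).subtype) (Fin m) := by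
  let f : H →* H.map (alternatingGroup (Fin m)).subtype :=
    (alternatingGroup (Fin m)).subtype.subgroupMap H
  let j : Fin m →ₑ[f] Fin m := ⟨id, fun _ _ => rfl⟩
  exact IsPreprimitive.of_surjective (f := j) Function.surjective_id

lemma no_isThreeCycle_mem [hprim : IsPreprimitive H (Fin m)] (hH : H ≠ ⊤)
    {g : alternatingGroup (Fin m)} (hg : g ∈ H) : ¬ (g : Perm (Fin m)).IsThreeCycle := by
  intro h3
  have h4 := Perm.alternatingGroup_le_of_isPreprimitive_of_isThreeCycle_mem isPreprimitive_map h3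
    (Subgroup.mem_map_of_mem (alternatingGroup (Fin m)).subtype hg)
  apply hH
  rw [eq_top_iff]
  intro a _
  obtain ⟨b, hb, hba⟩ := h4 a.2
  rwa [← Subtype.ext hba]

/-- A permutation group without three-cycles has a base containing at most half of the points. -/
lemma exists_base (h3 : ∀ g ∈ H, ¬ (g : Perm (Fin m)).IsThreeCycle) :
    ∃ Δ : Finset (Fin m), 2 * Δ.card ≤ m ∧
      ∀ g ∈ H, (∀ x ∈ Δ, (g : Perm (Fin m)) x = x) → g = 1 := by
  classical
  have hex : ∃ k, ∃ Δ : Finset (Fin m), Δ.card = k ∧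
      ∀ g ∈ H, (∀ x ∈ Δ, (g : Perm (Fin m)) x = x) → g = 1 :=
    ⟨_, Finset.univ, rfl, fun g _ h => Subtype.ext (Perm.ext fun x => h x (Finset.mem_univ x))⟩
  obtain ⟨Δ, hΔ, hbase⟩ := Nat.find_spec hex
  have hmin : ∀ Γ : Finset (Fin m), Γ.card < Δ.card →
      ∃ g ∈ H, (∀ x ∈ Γ, (g : Perm (Fin m)) x = x) ∧ g ≠ 1 := fun Γ hΓ => by
    have := Nat.find_min hex (hΔ ▸ hΓ)
    push Not at this
    exact this Γ rfl
  refine ⟨Δ, ?_, hbase⟩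
  by_contra! hm
  obtain ⟨g, hg, hgΔ, hg1⟩ := hmin Δᶜ (by rw [Finset.card_compl, Fintype.card_fin]; omega)
  obtain ⟨x, hx⟩ : ∃ x, (g : Perm (Fin m)) x ≠ x := by
    by_contra! h
    exact hg1 (Subtype.ext (Perm.ext h))
  have hxΔ : x ∈ Δ := by
    by_contra h
    exact hx (hgΔ x (Finset.mem_compl.2 h))
  obtain ⟨h, hh, hhΔ, hh1⟩ := hmin (Δ.erase x) (Finset.card_erase_lt_of_mem hxΔ)
  have hhx : (h : Perm (Fin m)) x ≠ x := fun hx' => hh1 (hbase h hh fun y hy => by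
    by_cases hyx : y = x
    · rw [hyx, hx']
    · exact hhΔ y (Finset.mem_erase.2 ⟨hyx, hy⟩))
  refine h3 (g * h * g⁻¹ * h⁻¹) (mul_mem (mul_mem (mul_mem hg hh) (inv_mem hg)) (inv_mem hh)) ?_
  refine isThreeCycle_commutator (g := (g : Perm (Fin m))) (h := (h : Perm (Fin m))) hx hhx
    fun y hyx => ?_
  by_cases hy : y ∈ Δ
  · exact Or.inr (hhΔ y (Finset.mem_erase.2 ⟨hyx, hy⟩))
  · exact Or.inl (hgΔ y (Finset.mem_compl.2 hy))

end
end AltRestriction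

namespace AltRestriction
open Equiv MulAction
open scoped Pointwise

section
variable {m : ℕ} {H : Subgroup (alternatingGroup (Fin m))}

lemma descFactorial_dvd_card_of_isCycle_mem [IsPreprimitive H (Fin m)] {p : ℕ} (hp : p.Prime)
    (hpm : p < m) {g : alternatingGroup (Fin m)} (hg : g ∈ H)
    (hc : (g : Perm (Fin m)).IsCycle) (hs : (g : Perm (Fin m)).support.card = p) :
    m.descFactorial (m - p + 1) ∣ Nat.card H := by
  set K := H.map (alternatingGroup (Fin m)).subtype with hK
  have hgK : (g : Perm (Fin m)) ∈ K := Subgroup.mem_map_of_mem (alternatingGroup (Fin m)).subtype hg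
  have hcard : Nat.card K = Nat.card H :=
    Nat.card_congr (H.equivMapOfInjective _ (Subgroup.subtype_injective _)).toEquiv.symm
  obtain ⟨r, hr⟩ : ∃ r, m - p = r + 1 := ⟨m - p - 1, by omega⟩
  have hfix : IsPreprimitive (fixingSubgroup K ((g : Perm (Fin m)).support : Set (Fin m))ᶜ)
      (SubMulAction.ofFixingSubgroup K ((g : Perm (Fin m)).support : Set (Fin m))ᶜ) := by
    have := Perm.isPretransitive_of_isCycle_mem hc hgK
    apply IsPreprimitive.of_prime_card
    convert! hp
    classical
    rw [Nat.card_eq_fintype_card, Fintype.card_subtype, ← hs]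
    apply congr_arg
    ext x
    simp [SubMulAction.mem_ofFixingSubgroup_iff]
  have := (isPreprimitive_map (H := H)).isMultiplyPreprimitive (n := r)
    (s := ((g : Perm (Fin m)).support : Set (Fin m))ᶜ)
    (by rw [Set.ncard_compl, Set.ncard_coe_finset, hs, Nat.card_fin]; exact hr)
    (by rw [Nat.card_fin]; have := hp.two_le; omega) hfix
  have h1 := IsMultiplyPreprimitive.isMultiplyPretransitive K (Fin m) (r + 2)
  have h2 : Nonempty (Fin (r + 2) ↪ Fin m) := ⟨Fin.castLEEmb (by have := hp.two_le; omega)⟩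
  have h3 := @index_stabilizer_of_transitive K _ _ _ h2.some h1
  rw [Nat.card_eq_fintype_card, Fintype.card_embedding_eq, Fintype.card_fin, Fintype.card_fin] at h3
  rw [hr, ← hcard, ← h3]
  exact Subgroup.index_dvd_card _

lemma card_le_descFactorial_of_base {Δ : Finset (Fin m)}
    (hΔ : ∀ g ∈ H, (∀ x ∈ Δ, (g : Perm (Fin m)) x = x) → g = 1) :
    Nat.card H ≤ m.descFactorial Δ.card ∧ ∀ t ∈ H, t ≠ 1 →
      (t : Perm (Fin m)).support.card + Δ.card ≤ m → Nat.card H ≠ m.descFactorial Δ.card := by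
  set f : H → (Δ ↪ Fin m) := fun h =>
    (Function.Embedding.subtype _).trans (h : Perm (Fin m)).toEmbedding with hf
  have hfa : ∀ (h : H) (x : Δ), f h x = (h : Perm (Fin m)) x := fun h x => rfl
  have hinj : Function.Injective f := by
    intro g h hgh
    have h1 := hΔ (g⁻¹ * h : H) (g⁻¹ * h : H).2 fun x hx => by
      have := DFunLike.congr_fun hgh ⟨x, hx⟩
      rw [hfa, hfa] at this
      simpa [Perm.mul_apply, Equiv.symm_apply_eq] using this.symm
    exact (inv_mul_eq_one.1 (Subtype.ext h1))
  have hcard : Nat.card (Δ ↪ Fin m) = m.descFactorial Δ.card := by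
    rw [Nat.card_eq_fintype_card, Fintype.card_embedding_eq, Fintype.card_fin, Fintype.card_coe]
  refine ⟨hcard ▸ Nat.card_le_card_of_injective f hinj, fun t ht ht1 hts heq => ht1 ?_⟩
  have hbij := (Nat.bijective_iff_injective_and_card f).2 ⟨hinj, by rw [hcard, heq]⟩
  obtain ⟨y⟩ : Nonempty (Δ ↪ ((t : Perm (Fin m)).supportᶜ : Finset (Fin m))) :=
    Function.Embedding.nonempty_of_card_le (by
      rw [Fintype.card_coe, Fintype.card_coe, Finset.card_compl, Fintype.card_fin]; omega)
  obtain ⟨h, hh⟩ := hbij.2 (y.trans (Function.Embedding.subtype _))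
  have h2 : (⟨t, ht⟩ : H) * h = h := hinj (by
    ext x
    have h3 : (h : Perm (Fin m)) x = y x := by rw [← hfa, hh]; rfl
    have h4 : (t : Perm (Fin m)) (y x) = y x :=
      Perm.notMem_support.1 (Finset.mem_compl.1 (y x).2)
    rw [hfa, hfa]
    congr 1
    simp only [Subgroup.coe_mul, Perm.mul_apply, h3, h4])
  simpa using h2

theorem index_cases_of_isPretransitive [IsPretransitive H (Fin m)] (hm : 3 < m) (hH : H ≠ ⊤) :
    (∃ b, 1 < b ∧ b < m ∧ b ∣ m ∧ (∀ p, p.Prime → p ≠ 2 → b < p → p ≤ m → p ∣ H.index) ∧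
      m.choose b ∣ m / b * H.index) ∨
    (3 ∣ H.index ∧ Nat.card H ≤ m.descFactorial (m / 2) ∧
      (∀ p, p.Prime → p ≠ 2 → p < m → ¬ p ∣ H.index →
        m.descFactorial (m - p + 1) ∣ Nat.card H) ∧
      ∀ j k, 2 ^ k ∣ Nat.card H → ¬ 2 ^ k ∣ m.descFactorial j → m < 8 + j → m / 2 + 4 ≤ m →
        Nat.card H ≠ m.descFactorial (m / 2)) := by
  by_cases hprim : IsPreprimitive H (Fin m)
  · right
    have h3 : ∀ g ∈ H, ¬ (g : Perm (Fin m)).IsThreeCycle := fun g hg => no_isThreeCycle_mem hH hg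
    obtain ⟨Δ, hΔm, hΔ⟩ := exists_base h3
    obtain ⟨hle, hne⟩ := card_le_descFactorial_of_base hΔ
    have hmono : m.descFactorial Δ.card ≤ m.descFactorial (m / 2) := by
      rw [← Nat.descFactorial_mul_descFactorial (show Δ.card ≤ m / 2 by omega)]
      exact Nat.le_mul_of_pos_left _ (Nat.pos_of_ne_zero fun h => by
        rw [Nat.descFactorial_eq_zero_iff_lt] at h
        omega)
    refine ⟨?_, hle.trans hmono, ?_, ?_⟩
    · by_contra h
      obtain ⟨g, hg, -, hs⟩ := exists_isCycle_mem Nat.prime_three (by norm_num) (by omega) h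
      exact h3 g hg (card_support_eq_three_iff.1 hs)
    · intro p hp hp2 hpm hpi
      obtain ⟨g, hg, hc, hs⟩ := exists_isCycle_mem hp hp2 hpm.le hpi
      exact descFactorial_dvd_card_of_isCycle_mem hp hpm hg hc hs
    · intro j k hk hj hmj hm4 heq
      obtain ⟨x, t, ht, hto⟩ := exists_even_stabilizer (G := H) (X := Fin j ↪ Fin m) hk (by
        rwa [Nat.card_eq_fintype_card, Fintype.card_embedding_eq, Fintype.card_fin, Fintype.card_fin])
      have hto' : orderOf (t : alternatingGroup (Fin m)) = 2 := by rw [Subgroup.orderOf_coe, hto]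
      have h4 := four_dvd_card_support hto'
      have h5 : ((t : alternatingGroup (Fin m)) : Perm (Fin m)).support ⊆
          (Finset.univ.map x)ᶜ := by
        intro z hz
        rw [Finset.mem_compl, Finset.mem_map]
        rintro ⟨i, -, rfl⟩
        exact Perm.mem_support.1 hz (DFunLike.congr_fun (mem_stabilizer_iff.1 ht) i)
      have h6 := Finset.card_le_card h5
      rw [Finset.card_compl, Finset.card_map, Finset.card_univ, Fintype.card_fin,
        Fintype.card_fin] at h6
      refine hne t t.2 (fun h => ?_) (by omega) (le_antisymm hle (heq ▸ hmono))
      rw [h, orderOf_one] at hto'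
      omega
  · left
    obtain ⟨B, hB, hBt⟩ : ∃ B : Set (Fin m), IsBlock H B ∧ ¬ IsTrivialBlock B := by
      by_contra! h
      exact hprim { isTrivialBlock_of_isBlock := fun hB => h _ hB }
    rw [IsTrivialBlock, not_or] at hBt
    have hB1 : 1 < B.ncard := by
      by_contra! h
      exact hBt.1 (Set.ncard_le_one_iff_subsingleton.1 h)
    have hBm : B.ncard < m := by
      have := Set.ncard_lt_card hBt.2
      rwa [Nat.card_fin] at this
    have hne : B.Nonempty := Set.nonempty_of_ncard_ne_zero (by omega)
    have hmul := hB.ncard_block_mul_ncard_orbit_eq hne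
    rw [Nat.card_fin] at hmul
    refine ⟨B.ncard, hB1, hBm, ⟨_, hmul.symm⟩, ?_, ?_⟩
    · intro p hp hp2 hBp hpm
      by_contra h
      obtain ⟨g, hg, hc, hs⟩ := exists_isCycle_mem hp hp2 hpm h
      have := IsBlock.card_le_one_of_isCycle_mem hB hp hBp hg hc hs
      omega
    · obtain ⟨s, hs⟩ : ∃ s : Set.powersetCard (Fin m) B.ncard, ((s : Finset (Fin m)) : Set (Fin m)) = B :=
        ⟨⟨B.toFinite.toFinset, (Set.ncard_eq_toFinset_card B _).symm⟩, B.toFinite.coe_toFinset⟩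
      have h1 := index_dvd_relIndex_mul_index H (stabilizer (alternatingGroup (Fin m)) s)
      rw [index_stabilizer_powersetCard (by omega)] at h1
      convert! h1 using 2
      have h2 : (stabilizer (alternatingGroup (Fin m)) s).subgroupOf H = stabilizer H B := by
        ext h
        have h3 : (((h : alternatingGroup (Fin m)) • s : Set.powersetCard (Fin m) B.ncard) :
            Finset (Fin m)) = (h : alternatingGroup (Fin m)) • (s : Finset (Fin m)) := rfl
        rw [Subgroup.mem_subgroupOf, mem_stabilizer_iff, mem_stabilizer_iff, ← Subtype.coe_inj,
          ← Finset.coe_inj, h3, Finset.coe_smul_finset, hs]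
        rfl
      rw [Subgroup.relIndex, h2, index_stabilizer]
      exact Nat.div_eq_of_eq_mul_right (by omega) hmul.symm

end
end AltRestriction

namespace AltRestriction
open Equiv MulAction
open scoped Pointwise

section
variable {G : Type*} [Group G] {n : ℕ} {φ : G →* alternatingGroup (Fin n)}

theorem TwoTransitive.exists_fix_smul_eq (hφ : TwoTransitive φ) {Δ : Type*} [Finite Δ]
    [MulAction G Δ] [IsPretransitive G Δ] (hn : 2 ≤ n) (hΔ : Nat.card Δ < n) (ω : Fin n)
    (δ δ' : Δ) : ∃ g, (φ g : Perm (Fin n)) ω = ω ∧ g • δ = δ' := by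
  classical
  have := Fintype.ofFinite Δ
  set N : Fin n → Δ → Prop := fun x d => ∃ g, (φ g : Perm (Fin n)) ω = x ∧ g • δ = d with hN
  have hequi : ∀ h x d, N ((φ h : Perm (Fin n)) x) (h • d) ↔ N x d := by
    intro h x d
    constructor
    · rintro ⟨g, h1, h2⟩
      refine ⟨h⁻¹ * g, ?_, ?_⟩
      · simp [Perm.mul_apply, h1]
      · rw [mul_smul, h2, inv_smul_smul]
    · rintro ⟨g, rfl, rfl⟩
      exact ⟨h * g, by simp [Perm.mul_apply], mul_smul _ _ _⟩
  set f : Fin n → Δ → ℚ := fun x d => if N x d then 1 else 0 with hf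
  have hff : ∀ x d, f x d * f x d = f x d := fun x d => by simp only [hf]; split_ifs <;> simp
  have hf0 : ∀ x d, 0 ≤ f x d := fun x d => by simp only [hf]; split_ifs <;> simp
  have hf1 : ∀ x d, f x d ≤ 1 := fun x d => by simp only [hf]; split_ifs <;> simp
  set S : Fin n → Fin n → ℚ := fun x y => ∑ d, f x d * f y d with hS
  have hSe : ∀ h x y, S ((φ h : Perm (Fin n)) x) ((φ h : Perm (Fin n)) y) = S x y := by
    intro h x y
    simp only [hS]
    rw [← Equiv.sum_comp (MulAction.toPerm h : Perm Δ)]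
    refine Finset.sum_congr rfl fun d _ => ?_
    simp only [hf, MulAction.toPerm_apply, hequi]
  obtain ⟨ω', hω⟩ : ∃ ω', ω ≠ ω' := by
    have : Nontrivial (Fin n) := Fin.nontrivial_iff_two_le.2 hn
    obtain ⟨y, hy⟩ := exists_ne ω
    exact ⟨y, hy.symm⟩
  have hoff : ∀ x y, x ≠ y → S x y = S ω ω' := by
    intro x y hxy
    obtain ⟨g, rfl, rfl⟩ := hφ _ _ _ _ hω hxy
    exact hSe g _ _
  have hdiag : ∀ x, S x x = S ω ω := by
    intro x
    have : Nontrivial (Fin n) := Fin.nontrivial_iff_two_le.2 hn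
    obtain ⟨y, hy⟩ := exists_ne x
    obtain ⟨g, rfl, -⟩ := hφ _ _ _ _ hω hy.symm
    exact hSe g _ _
  have hle : S ω ω' ≤ S ω ω := Finset.sum_le_sum fun d _ => by
    rw [hff]
    exact mul_le_of_le_one_right (hf0 _ _) (hf1 _ _)
  have hpos : 0 ≤ S ω ω' := Finset.sum_nonneg fun d _ => mul_nonneg (hf0 _ _) (hf0 _ _)
  obtain ⟨a, ha, i, hi⟩ := Fintype.not_linearIndependent_iff.1 (fun h : LinearIndependent ℚ f => by
    have := h.fintype_card_le_finrank
    rw [Module.finrank_fintype_fun_eq_card, Fintype.card_fin, ← Nat.card_eq_fintype_card] at this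
    omega)
  have hsum : (S ω ω - S ω ω') * ∑ x, a x ^ 2 + S ω ω' * (∑ x, a x) ^ 2 = 0 := by
    have h1 : ∑ d, (∑ x, a x * f x d) * (∑ y, a y * f y d) = 0 :=
      Finset.sum_eq_zero fun d _ => by
        have := congrFun ha d
        simp only [Finset.sum_apply, Pi.smul_apply, smul_eq_mul, Pi.zero_apply] at this
        rw [this, zero_mul]
    have h2 : ∑ d, (∑ x, a x * f x d) * (∑ y, a y * f y d) = ∑ x, ∑ y, a x * a y * S x y := by
      simp_rw [Finset.sum_mul_sum, hS, Finset.mul_sum]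
      rw [Finset.sum_comm]
      refine Finset.sum_congr rfl fun x _ => ?_
      rw [Finset.sum_comm]
      exact Finset.sum_congr rfl fun y _ => Finset.sum_congr rfl fun d _ => by ring
    have h3 : ∀ x y, a x * a y * S x y =
        (if x = y then (S ω ω - S ω ω') * a x ^ 2 else 0) + S ω ω' * (a x * a y) := by
      intro x y
      split_ifs with h
      · subst h
        rw [hdiag]
        ring
      · rw [hoff x y h]
        ring
    rw [← h1, h2, pow_two (∑ x, a x), Finset.sum_mul_sum, Finset.mul_sum, Finset.mul_sum,
      ← Finset.sum_add_distrib]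
    refine Finset.sum_congr rfl fun x _ => ?_
    simp only [h3, Finset.sum_add_distrib, Finset.sum_ite_eq, Finset.mem_univ, if_true,
      Finset.mul_sum]
  have hsq : 0 < ∑ x, a x ^ 2 :=
    Finset.sum_pos' (fun x _ => sq_nonneg _) ⟨i, Finset.mem_univ i, by positivity⟩
  have heq : S ω ω = S ω ω' := by
    nlinarith [mul_nonneg hpos (sq_nonneg (∑ x, a x)), mul_nonneg (sub_nonneg.2 hle) hsq.le]
  have hsub : ∀ x y, x ≠ y → ∀ d, N x d → N y d := by
    intro x y hxy d hd
    have h1 : ∑ d, (f x d * f x d - f x d * f y d) = 0 := by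
      rw [Finset.sum_sub_distrib, sub_eq_zero]
      exact (hdiag x).trans (heq.trans (hoff x y hxy).symm)
    have h2 := (Finset.sum_eq_zero_iff_of_nonneg fun d _ => by
      rw [hff, sub_nonneg]
      exact mul_le_of_le_one_right (hf0 _ _) (hf1 _ _)).1 h1 d (Finset.mem_univ d)
    by_contra h
    simp [hf, hd, h] at h2
  obtain ⟨g, hg⟩ := exists_smul_eq G δ δ'
  by_cases h : (φ g : Perm (Fin n)) ω = ω
  · exact ⟨g, h, hg⟩
  · exact hsub _ ω h _ ⟨g, rfl, hg⟩

end
end AltRestriction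

namespace AltRestriction
open Equiv MulAction
open scoped Pointwise

section
variable {m : ℕ} {H : Subgroup (alternatingGroup (Fin m))}

lemma two_mul_card_mul_index (hm : 2 ≤ m) : 2 * (Nat.card H * H.index) = m.factorial := by
  have : Nontrivial (Fin m) := Fin.nontrivial_iff_two_le.2 hm
  rw [Subgroup.card_mul_index, two_mul_nat_card_alternatingGroup, Nat.card_perm, Nat.card_fin]

lemma dvd_card_of_isPretransitive [NeZero m] [IsPretransitive H (Fin m)] : m ∣ Nat.card H := by
  have := Subgroup.index_dvd_card (stabilizer H (0 : Fin m))
  rwa [index_stabilizer_of_transitive, Nat.card_fin] at this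

lemma choose_dvd_index_of_not_isPretransitive (hm : 5 ≤ m) (hH : ¬ IsPretransitive H (Fin m))
    (hi : m < H.index) : (6 ≤ m ∧ m * (m - 1) ≤ H.index) ∨
    ∃ a, (2 ≤ a ∨ m = 5) ∧ 2 * a ≤ m ∧ m.choose a ∣ H.index ∧
      ∃ s : Set.powersetCard (Fin m) a, H ≤ stabilizer (alternatingGroup (Fin m)) s := by
  obtain ⟨a, ha, ham, s, hs⟩ := exists_invariant_of_not_isPretransitive H hH
  have hdvd : m.choose a ∣ H.index := by
    rw [← index_stabilizer_powersetCard (by omega) s]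
    exact Subgroup.index_dvd_of_le hs
  by_cases h : 2 ≤ a ∨ m = 5
  · exact Or.inr ⟨a, h, ham, hdvd, s, hs⟩
  · left
    push Not at h
    obtain rfl : a = 1 := by omega
    obtain ⟨k, rfl⟩ : ∃ k, m = k + 1 := ⟨m - 1, by omega⟩
    obtain ⟨x, hx⟩ := Finset.card_eq_one.1 (show (s : Finset (Fin (k + 1))).card = 1 from s.2)
    refine ⟨by omega, le_index_of_le_stabilizer (by omega) x (fun g hg => ?_) (by omega)⟩
    have h1 := congrArg Subtype.val (mem_stabilizer_iff.1 (hs hg))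
    have h2 : g • (s : Finset (Fin (k + 1))) = s := h1
    rw [hx, Finset.smul_finset_singleton, Finset.singleton_inj] at h2
    exact mem_stabilizer_iff.2 h2

end

lemma index_ne_twelve {H : Subgroup (alternatingGroup (Fin 6))} [IsPretransitive H (Fin 6)] :
    H.index ≠ 12 := by
  intro h
  have hc := two_mul_card_mul_index (H := H) (by norm_num)
  rw [h, show Nat.factorial 6 = 720 from rfl] at hc
  have hc : Nat.card H = 30 := by omega
  have := Fact.mk Nat.prime_two
  obtain ⟨t, ht⟩ := exists_prime_orderOf_dvd_card' (G := H) 2 (by rw [hc]; norm_num)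
  have ht' : orderOf (t : alternatingGroup (Fin 6)) = 2 := by rw [Subgroup.orderOf_coe, ht]
  have h4 := four_dvd_card_support ht'
  obtain ⟨x, hx⟩ : ∃ x, ((t : alternatingGroup (Fin 6)) : Perm (Fin 6)) x = x := by
    by_contra! h
    have h5 : ((t : alternatingGroup (Fin 6)) : Perm (Fin 6)).support = Finset.univ :=
      Finset.eq_univ_iff_forall.2 fun x => Perm.mem_support.2 (h x)
    rw [h5] at h4
    revert h4
    decide
  have h6 := Subgroup.card_mul_index (stabilizer H x)
  rw [index_stabilizer_of_transitive, Nat.card_fin, hc] at h6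
  have h7 : orderOf (⟨t, hx⟩ : stabilizer H x) = 2 := by rw [← ht, ← Subgroup.orderOf_coe]
  have h8 := orderOf_dvd_natCard (⟨t, hx⟩ : stabilizer H x)
  rw [h7] at h8
  omega

lemma index_eq_of_lt_fifteen {H : Subgroup (alternatingGroup (Fin 6))} (h6 : 6 < H.index)
    (hn : H.index < 15) : H.index = 10 := by
  have hc := two_mul_card_mul_index (H := H) (by norm_num)
  rw [show Nat.factorial 6 = 720 from rfl] at hc
  by_cases hH : IsPretransitive H (Fin 6)
  · have h12 := index_ne_twelve (H := H)
    have hd := dvd_card_of_isPretransitive (H := H)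
    generalize H.index = n at *
    interval_cases n <;> omega
  · rcases choose_dvd_index_of_not_isPretransitive (by norm_num) hH h6 with h | ⟨a, h2, h3, h4, -⟩
    · omega
    · obtain ⟨h5, h6⟩ : 2 ≤ a ∧ a ≤ 3 := by omega
      interval_cases a <;> simp [Nat.choose] at h4 <;> omega

lemma index_eq_of_lt_eighteen {H : Subgroup (alternatingGroup (Fin 7))} (h7 : 7 < H.index)
    (hn : H.index < 18) : H.index = 15 := by
  have hc := two_mul_card_mul_index (H := H) (by norm_num)
  rw [show Nat.factorial 7 = 5040 from rfl] at hc
  by_cases hH : IsPretransitive H (Fin 7)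
  · rcases index_cases_of_isPretransitive (H := H) (by norm_num) (by
      rintro rfl
      simp at h7) with ⟨b, hb, hb7, hbd, -⟩ | ⟨h3, hle, -, hjk⟩
    · interval_cases b <;> omega
    · replace hjk := hjk 0 1
      simp only [Nat.descFactorial, Nat.reduceDiv, Nat.reduceSub, Nat.reduceMul, Nat.reducePow] at hle hjk
      generalize H.index = n at *
      interval_cases n <;> omega
  · rcases choose_dvd_index_of_not_isPretransitive (by norm_num) hH h7 with h | ⟨a, h2, h3, h4, -⟩
    · omega
    · obtain ⟨h5, h6⟩ : 2 ≤ a ∧ a ≤ 3 := by omega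
      interval_cases a <;> simp [Nat.choose] at h4 <;> omega

lemma index_eq_fifteen_of_isPretransitive {H : Subgroup (alternatingGroup (Fin 8))}
    [IsPretransitive H (Fin 8)] (h8 : 8 < H.index)
    (hn : H.index < 28 ∨ H.index = 36 ∨ H.index = 64) : H.index = 15 := by
  have hc := two_mul_card_mul_index (H := H) (by norm_num)
  rw [show Nat.factorial 8 = 40320 from rfl] at hc
  rcases index_cases_of_isPretransitive (H := H) (by norm_num) (by
    rintro rfl
    simp at h8) with ⟨b, hb, hb8, hbd, hp, -⟩ | ⟨h3, hle, hp, hjk⟩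
  · have hp5 := hp 5 (by norm_num) (by norm_num)
    have hp7 := hp 7 (by norm_num) (by norm_num)
    have hb4 : b < 5 := by
      obtain ⟨k, hk⟩ := hbd
      by_contra! h
      interval_cases b <;> omega
    have := hp5 hb4 (by norm_num)
    have := hp7 (by omega) (by norm_num)
    omega
  · replace hjk := hjk 1 4
    have hp5 := hp 5 (by norm_num) (by norm_num)
    simp only [Nat.descFactorial, Nat.reduceDiv, Nat.reduceSub, Nat.reduceMul, Nat.reducePow,
      Nat.reduceAdd] at hle hjk hp5
    generalize H.index = n at *
    rcases hn with hn | rfl | rfl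
    · interval_cases n <;> omega
    all_goals omega

lemma index_eq_of_lt_twentyEight {H : Subgroup (alternatingGroup (Fin 8))} (h8 : 8 < H.index)
    (hn : H.index < 28) : H.index = 15 := by
  by_cases hH : IsPretransitive H (Fin 8)
  · exact index_eq_fifteen_of_isPretransitive h8 (Or.inl hn)
  · rcases choose_dvd_index_of_not_isPretransitive (by norm_num) hH h8 with h | ⟨a, h2, h3, h4, -⟩
    · omega
    · obtain ⟨h5, h6⟩ : 2 ≤ a ∧ a ≤ 4 := by omega
      interval_cases a <;> simp [Nat.choose] at h4 <;> omega

lemma index_ne_of_isPretransitive_nine {H : Subgroup (alternatingGroup (Fin 9))}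
    [IsPretransitive H (Fin 9)] (h9 : 9 < H.index)
    (hn : H.index < 48 ∨ H.index = 64 ∨ H.index = 81) : False := by
  have hc := two_mul_card_mul_index (H := H) (by norm_num)
  rw [show Nat.factorial 9 = 362880 from rfl] at hc
  rcases index_cases_of_isPretransitive (H := H) (by norm_num) (by
    rintro rfl
    simp at h9) with ⟨b, hb, hb8, hbd, hp, hch⟩ | ⟨h3, hle, hp, -⟩
  · have hp5 := hp 5 (by norm_num) (by norm_num)
    have hp7 := hp 7 (by norm_num) (by norm_num)
    obtain rfl : b = 3 := by interval_cases b <;> omega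
    simp [Nat.choose] at hch
    omega
  · have hp5 := hp 5 (by norm_num) (by norm_num)
    simp only [Nat.descFactorial, Nat.reduceDiv, Nat.reduceSub, Nat.reduceMul]
      at hle hp5
    generalize H.index = n at *
    rcases hn with hn | rfl | rfl
    · interval_cases n <;> omega
    all_goals omega

lemma index_ne_of_isPretransitive_ten {H : Subgroup (alternatingGroup (Fin 10))}
    [IsPretransitive H (Fin 10)] (h10 : 10 < H.index)
    (hn : H.index ≤ 81 ∨ H.index = 225) : False := by
  have hc := two_mul_card_mul_index (H := H) (by norm_num)
  rw [show Nat.factorial 10 = 3628800 from rfl] at hc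
  rcases index_cases_of_isPretransitive (H := H) (by norm_num) (by
    rintro rfl
    simp at h10) with ⟨b, hb, hb8, hbd, hp, hch⟩ | ⟨h3, hle, hp, hjk⟩
  · have hp5 := hp 5 (by norm_num) (by norm_num)
    have hp7 := hp 7 (by norm_num) (by norm_num)
    have hp3 := hp 3 (by norm_num) (by norm_num)
    have hb' : b = 2 ∨ b = 5 := by interval_cases b <;> omega
    rcases hb' with rfl | rfl <;> simp [Nat.choose] at hch <;> omega
  · replace hjk := hjk 3 5
    have hp5 := hp 5 (by norm_num) (by norm_num)
    have hp7 := hp 7 (by norm_num) (by norm_num)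
    simp only [Nat.descFactorial, Nat.reduceDiv, Nat.reduceSub, Nat.reduceMul, Nat.reducePow,
      Nat.reduceAdd] at hle hp5 hp7 hjk
    generalize H.index = n at *
    rcases hn with hn | rfl
    · interval_cases n <;> omega
    all_goals omega

end AltRestriction

namespace AltRestriction
open Equiv MulAction
open scoped Pointwise

def fixer {G : Type*} [Group G] {n : ℕ} (φ : G →* alternatingGroup (Fin n)) (ω : Fin n) :
    Subgroup G where
  carrier := {g | (φ g : Perm (Fin n)) ω = ω}
  one_mem' := by simp
  mul_mem' {g h} hg hh := by
    simp only [Set.mem_ofPred_eq, map_mul, Subgroup.coe_mul, Perm.mul_apply] at *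
    rw [hh, hg]
  inv_mem' {g} hg := by
    simp only [Set.mem_ofPred_eq, map_inv, Subgroup.coe_inv] at *
    exact Perm.inv_eq_iff_eq.2 hg.symm

section
variable {G : Type*} [Group G] {n : ℕ} {φ : G →* alternatingGroup (Fin n)}

lemma mem_fixer {ω : Fin n} {g : G} : g ∈ fixer φ ω ↔ (φ g : Perm (Fin n)) ω = ω := Iff.rfl

lemma index_fixer (htrans : ∀ a b, ∃ g, (φ g : Perm (Fin n)) a = b) (ω : Fin n) :
    (fixer φ ω).index = n := by
  let : MulAction G (Fin n) := MulAction.compHom (Fin n) φ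
  have : IsPretransitive G (Fin n) := ⟨htrans⟩
  have h := index_stabilizer_of_transitive G ω
  rw [Nat.card_fin] at h
  exact h

lemma TwoTransitive.mul_dvd_card (hφ : TwoTransitive φ) (hn : 2 ≤ n) :
    n * (n - 1) ∣ Nat.card G := by
  let : MulAction G (Fin n) := MulAction.compHom (Fin n) φ
  have : IsPretransitive G (Fin 2 ↪ Fin n) := ⟨fun x y => by
    obtain ⟨g, h0, h1⟩ := hφ (x 0) (x 1) (y 0) (y 1) (x.injective.ne (by decide))
      (y.injective.ne (by decide))
    refine ⟨g, ?_⟩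
    ext i
    fin_cases i
    · exact congrArg Fin.val h0
    · exact congrArg Fin.val h1⟩
  have hne : Nonempty (Fin 2 ↪ Fin n) := ⟨Fin.castLEEmb hn⟩
  have h := index_stabilizer_of_transitive G hne.some
  rw [Nat.card_eq_fintype_card, Fintype.card_embedding_eq, Fintype.card_fin, Fintype.card_fin] at h
  have h2 : n.descFactorial 2 = n * (n - 1) := by
    simp [Nat.descFactorial, mul_comm]
  rw [← h2, ← h]
  exact Subgroup.index_dvd_card _

lemma TwoTransitive.isPretransitive_fixer (hφ : TwoTransitive φ) {Δ : Type*} [Finite Δ]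
    [MulAction G Δ] [IsPretransitive G Δ] (hn : 2 ≤ n) (hΔ : Nat.card Δ < n) (ω : Fin n) :
    IsPretransitive (fixer φ ω) Δ :=
  ⟨fun x y => by
    obtain ⟨g, h1, h2⟩ := hφ.exists_fix_smul_eq hn hΔ ω x y
    exact ⟨⟨g, h1⟩, h2⟩⟩

end

section
variable {m : ℕ}

lemma exists_alt_map_pair (hm : 4 ≤ m) {a b i j : Fin m} (hab : a ≠ b) (hij : i ≠ j) :
    ∃ g : alternatingGroup (Fin m), (g : Perm (Fin m)) a = i ∧ (g : Perm (Fin m)) b = j := by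
  have hinj : ∀ {x y : Fin m}, x ≠ y → Function.Injective ![x, y] := fun {x y} h => by
    intro k l hkl
    fin_cases k <;> fin_cases l <;> simp_all
  obtain ⟨g, -, hg⟩ := exists_alt_map Finset.univ ![a, b] ![i, j] (hinj hab) (hinj hij)
    (fun _ => Finset.mem_univ _) (fun _ => Finset.mem_univ _) (by simpa using hm)
  exact ⟨g, hg 0, hg 1⟩

lemma isPretransitive_alternatingGroup (hm : 4 ≤ m) :
    IsPretransitive (alternatingGroup (Fin m)) (Fin m) :=
  ⟨fun x y => by
    have : Nontrivial (Fin m) := Fin.nontrivial_iff_two_le.2 (by omega)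
    obtain ⟨x', hx⟩ := exists_ne x
    obtain ⟨y', hy⟩ := exists_ne y
    obtain ⟨g, hg, -⟩ := exists_alt_map_pair hm hx.symm hy.symm
    exact ⟨g, hg⟩⟩

lemma hom_intUnits_eq_one (hm : 5 ≤ m) (χ : alternatingGroup (Fin m) →* ℤˣ) : χ = 1 := by
  have : Nontrivial (Fin m) := Fin.nontrivial_iff_two_le.2 (by omega)
  have hs := alternatingGroup.isSimpleGroup (α := Fin m) (by simpa using hm)
  rcases χ.normal_ker.eq_bot_or_eq_top with h | h
  · have h1 := Nat.card_le_card_of_injective χ ((MonoidHom.ker_eq_bot_iff χ).1 h)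
    have h2 := two_mul_nat_card_alternatingGroup (α := Fin m)
    rw [Nat.card_perm, Nat.card_fin] at h2
    have h3 : Nat.factorial 5 ≤ m.factorial := Nat.factorial_le hm
    rw [show Nat.factorial 5 = 120 from rfl] at h3
    have h4 : Nat.card ℤˣ = 2 := by rw [Nat.card_eq_fintype_card]; rfl
    omega
  · exact MonoidHom.ker_eq_top_iff.1 h

variable {n : ℕ} {φ : alternatingGroup (Fin m) →* alternatingGroup (Fin n)}

lemma exists_pair_labelling (hm : 4 ≤ m) (htrans : ∀ a b, ∃ g, (φ g : Perm (Fin n)) a = b)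
    (ω : Fin n) (hn : n = m.choose 2) {s : Set.powersetCard (Fin m) 2}
    (hs : fixer φ ω ≤ stabilizer (alternatingGroup (Fin m)) s) :
    ∃ P : Fin m → Fin m → Fin n, (∀ g i j, i ≠ j → (φ g : Perm (Fin n)) (P i j) =
      P ((g : Perm (Fin m)) i) ((g : Perm (Fin m)) j)) ∧
      ∀ i j k l, i ≠ j → k ≠ l → P i j = P k l → s(i, j) = s(k, l) := by
  have heq : fixer φ ω = stabilizer (alternatingGroup (Fin m)) s := by
    refine Subgroup.eq_of_le_of_card_ge hs ?_
    have h1 := Subgroup.card_mul_index (fixer φ ω)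
    rw [(index_fixer htrans ω).trans (hn.trans (index_stabilizer_powersetCard (by omega) s).symm),
      ← Subgroup.card_mul_index (stabilizer (alternatingGroup (Fin m)) s)] at h1
    exact (Nat.eq_of_mul_eq_mul_right
      (Nat.pos_of_ne_zero Subgroup.index_ne_zero_of_finite) h1).ge
  obtain ⟨a, b, hab, hsab⟩ := Finset.card_eq_two.1 (show (s : Finset (Fin m)).card = 2 from s.2)
  have hmem : ∀ g : alternatingGroup (Fin m), (φ g : Perm (Fin n)) ω = ω ↔
      s((g : Perm (Fin m)) a, (g : Perm (Fin m)) b) = s(a, b) := by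
    intro g
    have h1 : g • (s : Finset (Fin m)) =
        {(g : Perm (Fin m)) a, (g : Perm (Fin m)) b} := by
      rw [hsab, Finset.smul_finset_insert, Finset.smul_finset_singleton]
      rfl
    rw [← mem_fixer, heq, mem_stabilizer_iff, ← Subtype.coe_inj]
    change g • (s : Finset (Fin m)) = s ↔ _
    rw [h1, hsab, ← Finset.coe_inj, Finset.coe_pair, Finset.coe_pair, Set.pair_eq_pair_iff,
      Sym2.eq_iff]
  choose! c hc using fun i j (hij : i ≠ j) => exists_alt_map_pair hm hab hij
  have hsame : ∀ g h : alternatingGroup (Fin m),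
      (φ g : Perm (Fin n)) ω = (φ h : Perm (Fin n)) ω ↔
        s((g : Perm (Fin m)) a, (g : Perm (Fin m)) b) =
          s((h : Perm (Fin m)) a, (h : Perm (Fin m)) b) := by
    intro g h
    have h1 : (φ (h⁻¹ * g) : Perm (Fin n)) ω = ω ↔
        (φ g : Perm (Fin n)) ω = (φ h : Perm (Fin n)) ω := by
      simp [Perm.mul_apply, Equiv.symm_apply_eq]
    rw [← h1, hmem, ← (Sym2.map.injective (h : Perm (Fin m)).injective).eq_iff]
    simp [Perm.mul_apply]
  refine ⟨fun i j => (φ (c i j) : Perm (Fin n)) ω, fun g i j hij => ?_, fun i j k l hij hkl h => ?_⟩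
  · have hij' : (g : Perm (Fin m)) i ≠ (g : Perm (Fin m)) j := fun h => hij (Equiv.injective _ h)
    rw [← Perm.mul_apply, ← Subgroup.coe_mul, ← map_mul, hsame, (hc _ _ hij').1, (hc _ _ hij').2,
      Subgroup.coe_mul, Perm.mul_apply, Perm.mul_apply, (hc _ _ hij).1, (hc _ _ hij).2]
  · rwa [hsame, (hc _ _ hij).1, (hc _ _ hij).2, (hc _ _ hkl).1, (hc _ _ hkl).2] at h

end
end AltRestriction

namespace AltRestriction
open Equiv MulAction
open scoped Pointwise

section
universe u v
variable {F : Type u} {V : Type v} [Field F] [AddCommGroup V] [Module F V] {m n : ℕ}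
  {ρ : Representation F (alternatingGroup (Fin n)) V}
  {φ : alternatingGroup (Fin m) →* alternatingGroup (Fin n)}

lemma IsDoubleDifferenceSystem.finrank_le_of_pair_labelling
    {W : Fin n → Fin n → Fin n → Fin n → V} (hW : IsDoubleDifferenceSystem ρ W)
    (hm : 5 ≤ m) (hn : 2 * m + 1 ≤ n) (hirr : RepIrreducible (ρ.comp φ)) {P : Fin m → Fin m → Fin n}
    (hP : ∀ g i j, i ≠ j → (φ g : Perm (Fin n)) (P i j) =
      P ((g : Perm (Fin m)) i) ((g : Perm (Fin m)) j))
    (hinj : ∀ i j k l, i ≠ j → k ≠ l → P i j = P k l → s(i, j) = s(k, l)) :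
    Module.finrank F V * (2 * (m - 3).factorial) ≤ m.factorial := by
  have : Nontrivial (Fin m) := Fin.nontrivial_iff_two_le.2 (by omega)
  obtain ⟨p, q, hpq⟩ := exists_pair_ne (Fin m)
  have key : ∀ k, k ≤ m - 2 → ((k - 1 : ℕ) : F) ≠ 0 →
      Module.finrank F V * (2 * k.factorial) ≤ m.factorial := by
    intro k hk hk1
    obtain ⟨J, hJ, rfl⟩ := Finset.exists_subset_card_eq
      (show k ≤ ({p, q}ᶜ : Finset (Fin m)).card by
        rwa [Finset.card_compl, Finset.card_pair hpq, Fintype.card_fin])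
    exact hW.finrank_mul_le (by omega) φ hirr P hP hinj J hpq
      (fun h => by simpa using hJ h) (fun h => by simpa using hJ h) hk1 (by omega)
  by_cases h : ((m - 3 - 1 : ℕ) : F) = 0
  · refine le_trans (Nat.mul_le_mul_left _ (Nat.mul_le_mul_left _ (Nat.factorial_le ?_)))
      (key (m - 2) le_rfl ?_)
    · omega
    · rw [show m - 2 - 1 = (m - 3 - 1) + 1 by omega, Nat.cast_add, h]
      simp
  · exact key (m - 3) (by omega) h

variable [IsAlgClosed F]

lemma false_of_pair_stabilizer (hm : 9 ≤ m) (hmn : m < n)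
    (hirr : RepIrreducible (ρ.comp φ)) (hd : 1 < Module.finrank F V)
    (htrans : ∀ a b, ∃ g, (φ g : Perm (Fin n)) a = b) {ω : Fin n}
    (hω : ¬ IsPretransitive (fixer φ ω) (Fin m)) (hn : n = m.choose 2)
    {s : Set.powersetCard (Fin m) 2}
    (hs : fixer φ ω ≤ stabilizer (alternatingGroup (Fin m)) s)
    (D k₃ k₄ : ℕ) (hk₃ : 3 ≤ k₃) (hk₄ : 3 ≤ k₄) (hkn₃ : k₃ * 3 ≤ n) (hkn₄ : k₄ * 4 ≤ n)
    (h₃ : ∀ s ∈ Finset.Icc 3 k₃, D < 2 ^ s * k₃.choose s)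
    (h₄ : ∀ s ∈ Finset.Icc 3 k₄, D < 3 ^ s * k₄.choose s) (hD : Module.finrank F V ≤ D)
    (D' : ℕ) (hD' : m.factorial < (D' + 1) * (2 * (m - 3).factorial))
    (h₃' : ∀ s ∈ Finset.Icc 2 k₃, D' < 2 ^ s * k₃.choose s)
    (h₄' : ∀ s ∈ Finset.Icc 2 k₄, D' < 3 ^ s * k₄.choose s) : False := by
  have := hirr.finiteDimensional
  have := isPretransitive_alternatingGroup (m := m) (by omega)
  have hχ := hom_intUnits_eq_one (m := m) (by omega)
  have hcard : Nat.card (Fin m) < n := by rwa [Nat.card_fin]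
  have hn36 : 2 * m + 6 ≤ n := by
    have h1 := Nat.choose_two_right m
    have h2 : 2 * (2 * m + 6) ≤ m * (m - 1) := by
      obtain ⟨k, rfl⟩ : ∃ k, m = k + 9 := ⟨m - 9, by omega⟩
      rw [show k + 9 - 1 = k + 8 by omega]
      nlinarith
    omega
  rcases twoTransitive_or_isDoubleDifferenceSystem (by omega) hirr hd htrans hχ D k₃ k₄ hk₃ hk₄
    hkn₃ hkn₄ h₃ h₄ hD with ⟨hT, -⟩ | ⟨W, hW⟩
  · exact hω (hT.isPretransitive_fixer (by omega) hcard ω)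
  · obtain ⟨P, hP, hinj⟩ := exists_pair_labelling (by omega) htrans ω hn hs
    have h1 := hW.finrank_le_of_pair_labelling (by omega) (by omega) hirr hP hinj
    have h2 : Module.finrank F V < D' + 1 := by
      by_contra! h
      exact absurd (h1.trans_lt hD') (not_lt.2 (Nat.mul_le_mul_right _ h))
    exact hω ((twoTransitive_of_finrank_le (by omega) hirr hd htrans hχ D' k₃ k₄ (by omega)
      (by omega) hkn₃ hkn₄ h₃' h₄' (by omega)).1.isPretransitive_fixer (by omega) hcard ω)

lemma finrank_le_of_factorial_lt (hm : 2 ≤ m) (hirr : RepIrreducible (ρ.comp φ)) {D : ℕ}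
    (hD : m.factorial < 2 * (D + 1) ^ 2) : Module.finrank F V ≤ D := by
  have : Nontrivial (Fin m) := Fin.nontrivial_iff_two_le.2 hm
  have hc := two_mul_nat_card_alternatingGroup (α := Fin m)
  rw [Nat.card_perm, Nat.card_fin] at hc
  by_contra! h
  have h1 := hirr.finrank_sq_le
  have h2 := Nat.pow_le_pow_left (Nat.succ_le_of_lt h) 2
  rw [Nat.succ_eq_add_one] at h2
  omega

lemma twoTransitive_of_five_le (hm : 5 ≤ m) (hmn : m < n) (hn : 10 ≤ n)
    (hirr : RepIrreducible (ρ.comp φ)) (hd : 1 < Module.finrank F V)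
    (htrans : ∀ a b, ∃ g, (φ g : Perm (Fin n)) a = b) (D k₃ k₄ : ℕ)
    (hD : m.factorial < 2 * (D + 1) ^ 2) (hk₃ : 2 ≤ k₃) (hk₄ : 2 ≤ k₄)
    (hkn₃ : k₃ * 3 ≤ n) (hkn₄ : k₄ * 4 ≤ n)
    (h₃ : ∀ s ∈ Finset.Icc 2 k₃, D < 2 ^ s * k₃.choose s)
    (h₄ : ∀ s ∈ Finset.Icc 2 k₄, D < 3 ^ s * k₄.choose s) (ω : Fin n) :
    TwoTransitive φ ∧ n ≤ D + 2 ∧ 2 * (n * (n - 1)) ∣ m.factorial ∧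
      IsPretransitive (fixer φ ω) (Fin m) := by
  have := hirr.finiteDimensional
  have := isPretransitive_alternatingGroup (m := m) (by omega)
  have : Nontrivial (Fin m) := Fin.nontrivial_iff_two_le.2 (by omega)
  have hc := two_mul_nat_card_alternatingGroup (α := Fin m)
  rw [Nat.card_perm, Nat.card_fin] at hc
  have hdD := finrank_le_of_factorial_lt (by omega) hirr hD
  obtain ⟨hT, hle⟩ := twoTransitive_of_finrank_le hn hirr hd htrans
    (hom_intUnits_eq_one (m := m) hm) D k₃ k₄ hk₃ hk₄ hkn₃ hkn₄ h₃ h₄ hdD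
  refine ⟨hT, by omega, ?_, hT.isPretransitive_fixer (by omega) (by rwa [Nat.card_fin]) ω⟩
  rw [← hc]
  exact Nat.mul_dvd_mul_left 2 (hT.mul_dvd_card (by omega))

end

section
universe u v
variable {F : Type u} {V : Type v} [Field F] [IsAlgClosed F] [AddCommGroup V] [Module F V] {n : ℕ}
  {ρ : Representation F (alternatingGroup (Fin n)) V}

lemma eq_six_of_irreducible {φ : alternatingGroup (Fin 5) →* alternatingGroup (Fin n)}
    (hn : 5 < n) (hirr : RepIrreducible (ρ.comp φ)) (hd : 1 < Module.finrank F V)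
    (htrans : ∀ a b, ∃ g, (φ g : Perm (Fin n)) a = b) : n = 6 := by
  have hidx := index_fixer htrans ⟨0, by omega⟩
  have hc := two_mul_card_mul_index (H := fixer φ ⟨0, by omega⟩) (by norm_num)
  rw [show Nat.factorial 5 = 120 from rfl] at hc
  by_contra hne
  have key : ∀ k c, k ≠ 6 → 5 < k → k < 10 → 2 * (c * k) ≠ 120 := by
    intro k c h h1 h2
    interval_cases k <;> omega
  have h10 : 10 ≤ n := by
    by_contra! h
    exact key _ _ (by omega) (by omega) (by omega) hc
  have := (twoTransitive_of_five_le le_rfl hn h10 hirr hd htrans 7 3 2 (by decide) (by norm_num)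
    (by norm_num) (by omega) (by omega) (by decide) (by decide) ⟨0, by omega⟩).2.1
  omega

lemma eq_ten_of_irreducible {φ : alternatingGroup (Fin 6) →* alternatingGroup (Fin n)}
    (hn : 6 < n) (hirr : RepIrreducible (ρ.comp φ)) (hd : 1 < Module.finrank F V)
    (htrans : ∀ a b, ∃ g, (φ g : Perm (Fin n)) a = b) : n = 10 := by
  have hidx := index_fixer htrans ⟨0, by omega⟩
  by_cases h : n < 15
  · have := index_eq_of_lt_fifteen (H := fixer φ ⟨0, by omega⟩) (by omega) (by omega)
    omega
  · obtain ⟨-, h1, h2, -⟩ := twoTransitive_of_five_le (by norm_num) hn (by omega) hirr hd htrans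
      18 5 3 (by decide) (by norm_num) (by norm_num) (by omega) (by omega) (by decide)
      (by decide) ⟨0, by omega⟩
    have h3 : ∀ k ≤ 20, 15 ≤ k → ¬ 2 * (k * (k - 1)) ∣ Nat.factorial 6 := by decide +kernel
    exact absurd h2 (h3 n h1 (by omega))

lemma eq_fifteen_of_irreducible_seven {φ : alternatingGroup (Fin 7) →* alternatingGroup (Fin n)}
    (hn : 7 < n) (hirr : RepIrreducible (ρ.comp φ)) (hd : 1 < Module.finrank F V)
    (htrans : ∀ a b, ∃ g, (φ g : Perm (Fin n)) a = b) : n = 15 := by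
  set ω : Fin n := ⟨0, by omega⟩
  have hidx := index_fixer htrans ω
  have hc := two_mul_card_mul_index (H := fixer φ ω) (by norm_num)
  rw [show Nat.factorial 7 = 5040 from rfl] at hc
  by_cases h : n < 18
  · have := index_eq_of_lt_eighteen (H := fixer φ ω) (by omega) (by omega)
    omega
  · obtain ⟨hT, h1, h2, h3⟩ := twoTransitive_of_five_le (by norm_num) hn (by omega) hirr hd htrans
      50 6 4 (by decide) (by norm_num) (by norm_num) (by omega) (by omega) (by decide)
      (by decide) ω
    have h4 : ∀ k ≤ 52, 18 ≤ k → 2 * (k * (k - 1)) ∣ Nat.factorial 7 → k = 21 ∨ k = 36 := by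
      decide +kernel
    have h7 := dvd_card_of_isPretransitive (H := fixer φ ω)
    rcases h4 n h1 (by omega) h2 with h5 | h5
    · rw [hidx.trans h5] at hc
      omega
    · have := Set.powersetCard.isPretransitive_alternatingGroup (α := Fin 7) (n := 2)
        (by rw [Nat.card_fin]; norm_num)
      have hp : Nat.card (Set.powersetCard (Fin 7) 2) = 21 := by
        rw [Set.powersetCard.card, Nat.card_fin]
        rfl
      have h6 := hT.isPretransitive_fixer (Δ := Set.powersetCard (Fin 7) 2) (by omega)
        (by omega) ω
      have hne : Nonempty (Set.powersetCard (Fin 7) 2) := ⟨⟨{0, 1}, rfl⟩⟩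
      have h8 := Subgroup.index_dvd_card (stabilizer (fixer φ ω) hne.some)
      rw [index_stabilizer_of_transitive, hp] at h8
      rw [hidx.trans h5] at hc
      omega

lemma eq_fifteen_of_irreducible_eight {φ : alternatingGroup (Fin 8) →* alternatingGroup (Fin n)}
    (hn : 8 < n) (hirr : RepIrreducible (ρ.comp φ)) (hd : 1 < Module.finrank F V)
    (htrans : ∀ a b, ∃ g, (φ g : Perm (Fin n)) a = b) : n = 15 := by
  set ω : Fin n := ⟨0, by omega⟩
  have hidx := index_fixer htrans ω
  by_cases h : n < 28
  · have := index_eq_of_lt_twentyEight (H := fixer φ ω) (by omega) (by omega)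
    omega
  · obtain ⟨-, h1, h2, h3⟩ := twoTransitive_of_five_le (by norm_num) hn (by omega) hirr hd htrans
      141 9 7 (by decide) (by norm_num) (by norm_num) (by omega) (by omega) (by decide)
      (by decide) ω
    have h4 : ∀ k ≤ 143, 28 ≤ k → 2 * (k * (k - 1)) ∣ Nat.factorial 8 → k = 36 ∨ k = 64 := by
      decide +kernel
    have h5 := h4 n h1 (by omega) h2
    have := index_eq_fifteen_of_isPretransitive (H := fixer φ ω) (by omega) (by omega)
    omega

lemma false_of_irreducible_nine {φ : alternatingGroup (Fin 9) →* alternatingGroup (Fin n)}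
    (hn : 9 < n) (hirr : RepIrreducible (ρ.comp φ)) (hd : 1 < Module.finrank F V)
    (htrans : ∀ a b, ∃ g, (φ g : Perm (Fin n)) a = b) : False := by
  set ω : Fin n := ⟨0, by omega⟩
  have hidx := index_fixer htrans ω
  by_cases h : n < 48
  · have hH : ¬ IsPretransitive (fixer φ ω) (Fin 9) := fun hH =>
      index_ne_of_isPretransitive_nine (H := fixer φ ω) (by omega) (by omega)
    rcases choose_dvd_index_of_not_isPretransitive (by norm_num) hH (by omega) with
      h1 | ⟨a, h2, h3, h4, s, hs⟩
    · omega
    · obtain ⟨h5, h6⟩ : 2 ≤ a ∧ a ≤ 4 := by omega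
      obtain rfl : a = 2 := by interval_cases a <;> simp [Nat.choose] at h4 <;> omega
      have h7 : n = Nat.choose 9 2 := by
        simp [Nat.choose] at h4 ⊢
        omega
      exact false_of_pair_stabilizer le_rfl hn hirr hd htrans hH h7 hs 425 12 9 (by norm_num)
        (by norm_num) (by rw [h7]; decide) (by rw [h7]; decide) (by decide) (by decide)
        (finrank_le_of_factorial_lt (by norm_num) hirr (by decide)) 252 (by decide) (by decide)
        (by decide)
  · obtain ⟨-, h1, h2, h3⟩ := twoTransitive_of_five_le (by norm_num) hn (by omega) hirr hd htrans
      425 16 12 (by decide) (by norm_num) (by norm_num) (by omega) (by omega) (by decide +kernel)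
      (by decide +kernel) ω
    have h4 : ∀ k ≤ 427, 48 ≤ k → 2 * (k * (k - 1)) ∣ Nat.factorial 9 → k = 64 ∨ k = 81 := by
      decide +kernel
    have h5 := h4 n h1 (by omega) h2
    exact index_ne_of_isPretransitive_nine (H := fixer φ ω) (by omega) (by omega)

lemma false_of_irreducible_ten {φ : alternatingGroup (Fin 10) →* alternatingGroup (Fin n)}
    (hn : 10 < n) (hirr : RepIrreducible (ρ.comp φ)) (hd : 1 < Module.finrank F V)
    (htrans : ∀ a b, ∃ g, (φ g : Perm (Fin n)) a = b) : False := by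
  set ω : Fin n := ⟨0, by omega⟩
  have hidx := index_fixer htrans ω
  by_cases h : n < 81
  · have hH : ¬ IsPretransitive (fixer φ ω) (Fin 10) := fun hH =>
      index_ne_of_isPretransitive_ten (H := fixer φ ω) (by omega) (by omega)
    rcases choose_dvd_index_of_not_isPretransitive (by norm_num) hH (by omega) with
      h1 | ⟨a, h2, h3, h4, s, hs⟩
    · omega
    · obtain ⟨h5, h6⟩ : 2 ≤ a ∧ a ≤ 5 := by omega
      obtain rfl : a = 2 := by interval_cases a <;> simp [Nat.choose] at h4 <;> omega
      have h7 : n = Nat.choose 10 2 := by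
        simp [Nat.choose] at h4 ⊢
        omega
      exact false_of_pair_stabilizer (by norm_num) hn hirr hd htrans hH h7 hs 1346 15 11
        (by norm_num) (by norm_num) (by rw [h7]; decide) (by rw [h7]; decide) (by decide +kernel)
        (by decide +kernel) (finrank_le_of_factorial_lt (by norm_num) hirr (by decide)) 360
        (by decide) (by decide +kernel) (by decide +kernel)
  · obtain ⟨-, h1, h2, h3⟩ := twoTransitive_of_five_le (by norm_num) hn (by omega) hirr hd htrans
      1346 27 20 (by decide) (by norm_num) (by norm_num) (by omega) (by omega) (by decide +kernel)
      (by decide +kernel) ω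
    have h4 : ∀ k ≤ 1348, 81 ≤ k → 2 * (k * (k - 1)) ∣ Nat.factorial 10 → k = 81 ∨ k = 225 := by
      decide +kernel
    have h5 := h4 n h1 (by omega) h2
    exact index_ne_of_isPretransitive_ten (H := fixer φ ω) (by omega) (by omega)

end
end AltRestriction

/-- if `X ≤ Aₙ` is a transitive subgroup isomorphic to `A_m` with
`n > m` and `5 ≤ m ≤ 10`, `F` is algebraically closed, and `V` is an `F Aₙ`-module of
dimension `> 1` whose restriction to `X` is irreducible, then
`(m, n) ∈ {(5,6), (6,10), (7,15), (8,15)}`. -/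
theorem stmt15 {F : Type*} [Field F] [IsAlgClosed F]
    {n m : ℕ} (hm5 : 5 ≤ m) (hm10 : m ≤ 10) (hmn : m < n)
    (X : Subgroup (alternatingGroup (Fin n)))
    (hiso : Nonempty (X ≃* alternatingGroup (Fin m)))
    (htrans : MulAction.IsPretransitive X (Fin n))
    (V : Type*) [AddCommGroup V] [Module F V]
    (ρ : Representation F (alternatingGroup (Fin n)) V)
    (hdim : 1 < Module.rank F V)
    (hirr : RepIrreducible (ρ.comp X.subtype)) :
    (m, n) = (5, 6) ∨ (m, n) = (6, 10) ∨ (m, n) = (7, 15) ∨ (m, n) = (8, 15) := by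
  obtain ⟨e⟩ := hiso
  have := hirr.finiteDimensional
  have hd : 1 < Module.finrank F V := by
    rw [← Module.finrank_eq_rank] at hdim
    exact_mod_cast hdim
  have hirr' : RepIrreducible (ρ.comp (X.subtype.comp e.symm.toMonoidHom)) :=
    ⟨hirr.1, fun p hp => hirr.2 p fun g v hv => by simpa using hp (e g) v hv⟩
  have htrans' : ∀ a b, ∃ g, ((X.subtype.comp e.symm.toMonoidHom g : alternatingGroup (Fin n)) :
      Equiv.Perm (Fin n)) a = b := fun a b => by
    obtain ⟨g, hg⟩ := htrans.exists_smul_eq a b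
    exact ⟨e g, by simpa using show ((g : alternatingGroup (Fin n)) : Equiv.Perm (Fin n)) a = b from hg⟩
  interval_cases m
  · simp [AltRestriction.eq_six_of_irreducible hmn hirr' hd htrans']
  · simp [AltRestriction.eq_ten_of_irreducible hmn hirr' hd htrans']
  · simp [AltRestriction.eq_fifteen_of_irreducible_seven hmn hirr' hd htrans']
  · simp [AltRestriction.eq_fifteen_of_irreducible_eight hmn hirr' hd htrans']
  · exact (AltRestriction.false_of_irreducible_nine hmn hirr' hd htrans').elim
  · exact (AltRestriction.false_of_irreducible_ten hmn hirr' hd htrans').elim
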